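/- Let m, t ≥ 1 be fixed integers and fix γ ∈ (0,1); set R := N^γ. Let ψ_i(x) = Σ_{j=1}^t L_{ij}·x_j + b_i (1 ≤ i ≤ m) be linear forms in t integer variables with integer coefficients satisfying |L_{ij}| ≤ √(w(N))/2 for all i, j, such that no t-tuple (L_{ij})_{1≤j≤t} is identically zero and no two such t-tuples are rational multiples of each other, and set θ_i := W·ψ_i + 1. Let B = ∏_{j=1}^t I_j ⊂ ℤ^t be a product of t intervals of integers, each of length at least R^{10m}, such that θ_i(x) ≥ 1 for all x ∈ B and all i. Then E( Λ_R(θ_1(x))²·…·Λ_R(θ_m(x))² | x ∈ B ) = (1 + o_{m,t}(1))·(W·log R/φ(W))^m; that is, for every δ > 0 there exists N_0 (depending only on m, t, γ, δ) such that for all N ≥ N_0 and all such choices of linear forms, shifts b_i, and boxes B, the left-hand side differs from (W·log R/φ(W))^m by at most δ·(W·log R/φ(W))^m. -/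

import Mathlib

open Finset Filter
open scoped Classical

noncomputable section

/-- `ε_k := 1/(2^k (k+4)!)`. -/
def epsk (k : ℕ) : ℝ := 1 / (2 ^ k * (Nat.factorial (k + 4)))

/-- `W(N) := ∏_{p ≤ w(N)} p`. -/
def Wprim (w : ℕ → ℕ) (N : ℕ) : ℕ := ∏ p ∈ (Finset.range (w N + 1)).filter Nat.Prime, p

/-- W-tricked von Mangoldt function. -/
def tildeLambda (W n : ℕ) : ℝ :=
  if Nat.Prime (W * n + 1) then (Nat.totient W : ℝ) / W * Real.log (W * n + 1) else 0

/-- truncated divisor sum `Λ_R`. -/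
def LambdaR (R : ℝ) (n : ℕ) : ℝ :=
  ∑ d ∈ n.divisors.filter (fun d : ℕ => (d : ℝ) ≤ R),
    ((ArithmeticFunction.moebius d : ℤ) : ℝ) * Real.log (R / (d : ℝ))

/-- the representative of `n : ZMod m` lying in `[N, N+m)`. -/
def reprN (N : ℕ) {m : ℕ} (n : ZMod m) : ℕ := N + (n - (N : ZMod m)).val

/-- the condition `ε_k M ≤ n - N ≤ 2 ε_k M` on the representative in `[N, N+m)`. -/
def inWindow (k N : ℕ) {m : ℕ} (n : ZMod m) : Prop :=
  epsk k * m ≤ ((n - (N : ZMod m)).val : ℝ) ∧ ((n - (N : ZMod m)).val : ℝ) ≤ 2 * epsk k * m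

/-- `R := M^(1/(k 2^(k+4)))`. -/
def Rpar (k m : ℕ) : ℝ := (m : ℝ) ^ ((1 : ℝ) / (k * 2 ^ (k + 4)))

/-- the Green–Tao majorant `ν`. -/
def nuGT (k N W : ℕ) {m : ℕ} (n : ZMod m) : ℝ :=
  if inWindow k N n then
    (Nat.totient W : ℝ) / W * (LambdaR (Rpar k m) (W * reprN N n + 1)) ^ 2 / Real.log (Rpar k m)
  else 1

/-- the function `f`. -/
def fGT (k N W : ℕ) {m : ℕ} (n : ZMod m) : ℝ :=
  if inWindow k N n then tildeLambda W (reprN N n) / (k * 2 ^ (k + 5)) else 0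

/-- the set of integers `n` with `ε_k M ≤ n - N ≤ 2 ε_k M`. -/
def windowSet (k N m : ℕ) : Finset ℕ :=
  (Finset.range (N + m + 1)).filter
    (fun n => epsk k * m ≤ (n : ℝ) - N ∧ (n : ℝ) - N ≤ 2 * epsk k * m)

/-- `E(Λ̃(n) | ε_k M ≤ n - N ≤ 2 ε_k M)`. -/
def avgWindow (k N m W : ℕ) : ℝ :=
  (∑ n ∈ windowSet k N m, tildeLambda W n) / (windowSet k N m).card

/-- `E(g(x) | x ∈ Z_m)`. -/
def avgZ (m : ℕ) (g : ZMod m → ℝ) : ℝ := (∑ x ∈ Finset.range m, g (x : ZMod m)) / m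

/-- `E(g(x) g(x+r) ⋯ g(x+(k-1)r) | x, r ∈ Z_m)`. -/
def apAvg (k m : ℕ) (g : ZMod m → ℝ) : ℝ :=
  (∑ x ∈ Finset.range m, ∑ r ∈ Finset.range m,
    ∏ i ∈ Finset.range k, g ((x : ZMod m) + (i : ZMod m) * (r : ZMod m))) / (m : ℝ) ^ 2

/-- a rational number interpreted in `ZMod m`. -/
def ratZMod (q : ℚ) (m : ℕ) : ZMod m := (q.num : ZMod m) * (q.den : ZMod m)⁻¹

/-- the `(m₀,t₀,L₀)`-linear forms condition for a family `ν = ν_N : Z_{M(N)} → ℝ`. -/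
def LinearFormsCondition (M : ℕ → ℕ) (ν : ∀ N : ℕ, ZMod (M N) → ℝ) (m₀ t₀ L₀ : ℕ) : Prop :=
  ∀ m t : ℕ, m ≤ m₀ → t ≤ t₀ →
    ∀ L : Fin m → Fin t → ℚ,
      (∀ i j, (L i j).num.natAbs ≤ L₀ ∧ (L i j).den ≤ L₀) →
      (∀ i, L i ≠ 0) →
      (∀ i i', i ≠ i' → ∀ q : ℚ, L i ≠ q • L i') →
      ∀ δ : ℝ, 0 < δ → ∃ N₀ : ℕ, ∀ N ≥ N₀, L₀ < M N →
        ∀ b : Fin m → ZMod (M N),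
          |(∑ x : Fin t → Fin (M N), ∏ i : Fin m,
              ν N (∑ j : Fin t, ratZMod (L i j) (M N) * ((x j : ℕ) : ZMod (M N)) + b i)) /
              (M N : ℝ) ^ t - 1| ≤ δ

/-- the `m₀`-correlation condition for a family `ν = ν_N : Z_{M(N)} → ℝ`. -/
def CorrelationCondition (M : ℕ → ℕ) (ν : ∀ N : ℕ, ZMod (M N) → ℝ) (m₀ : ℕ) : Prop :=
  ∀ m : ℕ, 1 < m → m ≤ m₀ →
    ∃ τ : ∀ N : ℕ, ZMod (M N) → ℝ,
      (∀ N n, 0 ≤ τ N n) ∧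
      (∀ q : ℝ, 1 ≤ q → ∃ C : ℝ, ∀ N, avgZ (M N) (fun n => τ N n ^ q) ≤ C) ∧
      (∀ N : ℕ, ∀ h : Fin m → ZMod (M N),
        avgZ (M N) (fun x => ∏ i, ν N (x + h i)) ≤
          ∑ i : Fin m, ∑ j : Fin m, if i < j then τ N (h i - h j) else 0)

/-- `k`-pseudorandom measure. -/
def Pseudorandom (k : ℕ) (M : ℕ → ℕ) (ν : ∀ N : ℕ, ZMod (M N) → ℝ) : Prop :=
  (∀ δ : ℝ, 0 < δ → ∃ N₀, ∀ N ≥ N₀, |avgZ (M N) (ν N) - 1| ≤ δ) ∧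
  LinearFormsCondition M ν (k * 2 ^ (k - 1)) (3 * k - 4) k ∧
  CorrelationCondition M ν (2 ^ (k - 1))

namespace GoldstonYildirim

open ArithmeticFunction in
/-- The Riesz mean `∑_{k ≤ x} μ(k)/k * log (x/k)`. -/
def mobiusRiesz (x : ℝ) : ℝ :=
  ∑ k ∈ Ioc 0 ⌊x⌋₊, (moebius k : ℝ) / k * Real.log (x / k)

open ArithmeticFunction in
lemma sum_moebius_mul_div {n : ℕ} (hn : 0 < n) :
    ∑ k ∈ Ioc 0 n, (moebius k : ℝ) * (n / k : ℕ) = 1 := by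
  have h := sum_Ioc_mul_zeta_eq_sum (moebius : ArithmeticFunction ℤ) n
  rw [moebius_mul_coe_zeta] at h
  have h1 : ∑ k ∈ Ioc 0 n, (1 : ArithmeticFunction ℤ) k = 1 := by
    rw [sum_eq_single_of_mem 1 (by simp; omega)]
    · simp
    · intro b _ hb; exact one_apply_ne hb
  rw [h1] at h
  have h2 := congrArg (Int.cast : ℤ → ℝ) h.symm
  simpa only [Int.cast_sum, Int.cast_mul, Int.cast_natCast, Int.cast_one] using h2

open ArithmeticFunction in
lemma abs_moebius_real_le_one (k : ℕ) : |(moebius k : ℝ)| ≤ 1 := by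
  exact_mod_cast (abs_moebius_le_one (n := k))

open ArithmeticFunction in
lemma abs_sum_moebius_div_le_one (n : ℕ) : |∑ k ∈ Ioc 0 n, (moebius k : ℝ) / k| ≤ 1 := by
  rcases Nat.eq_zero_or_pos n with rfl | hn
  · simp
  have h := sum_moebius_mul_div hn
  have hn' : (0 : ℝ) < n := by exact_mod_cast hn
  have e : (n : ℝ) * ∑ k ∈ Ioc 0 n, (moebius k : ℝ) / k =
      1 + ∑ k ∈ Ioc 0 n, (moebius k : ℝ) * ((n : ℝ) / k - (n / k : ℕ)) := by
    rw [← h, mul_sum, ← sum_add_distrib]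
    refine sum_congr rfl fun k _ => by ring
  have key : |∑ k ∈ Ioc 0 n, (moebius k : ℝ) * ((n : ℝ) / k - (n / k : ℕ))| ≤ (n : ℝ) - 1 := by
    have hs : Ioc 0 n = insert 1 (Ioc 1 n) := by ext; simp; omega
    rw [hs, sum_insert (by simp)]
    simp only [Nat.cast_one, div_one, Nat.div_one, sub_self, mul_zero, zero_add]
    refine (abs_sum_le_sum_abs _ _).trans ?_
    have : ∀ k ∈ Ioc 1 n, |(moebius k : ℝ) * ((n : ℝ) / k - (n / k : ℕ))| ≤ 1 := by
      intro k hk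
      rw [abs_mul]
      have a1 := abs_moebius_real_le_one k
      have a2 : |(n : ℝ) / k - (n / k : ℕ)| ≤ 1 := by
        have f1 := Nat.floor_div_eq_div (K := ℝ) n k
        rw [← f1, abs_le]
        have := Nat.lt_floor_add_one ((n : ℝ) / k)
        have := Nat.floor_le (show 0 ≤ (n : ℝ) / k by positivity)
        constructor <;> linarith
      exact mul_le_one₀ a1 (abs_nonneg _) a2
    refine (sum_le_card_nsmul _ _ _ this).trans ?_
    simp [Nat.cast_sub (show 1 ≤ n from hn)]
  have h2 : |(n : ℝ) * ∑ k ∈ Ioc 0 n, (moebius k : ℝ) / k| ≤ n := by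
    rw [e]
    refine (abs_add_le _ _).trans ?_
    rw [abs_one]; linarith
  rw [abs_mul, abs_of_pos hn'] at h2
  by_contra hc
  push Not at hc
  nlinarith

open ArithmeticFunction in
lemma sum_moebius_div_mul_harmonic {n : ℕ} (hn : 0 < n) :
    ∑ k ∈ Ioc 0 n, (moebius k : ℝ) / k * (harmonic (n / k) : ℝ) = 1 := by
  let f : ArithmeticFunction ℝ := ⟨fun k => (moebius k : ℝ) / k, by simp⟩
  let g : ArithmeticFunction ℝ := ⟨fun k => 1 / (k : ℝ), by simp⟩
  have h := sum_Ioc_mul_eq_sum_sum f g n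
  have hg : ∀ N : ℕ, ∑ m ∈ Ioc 0 N, g m = (harmonic N : ℝ) := by
    intro N
    rw [harmonic_eq_sum_Icc]
    push_cast
    refine sum_congr (by ext; simp; omega) fun k _ => by simp [g]
  have hfg : ∀ k ∈ Ioc 0 n, (f * g) k = if k = 1 then 1 else 0 := by
    intro k hk
    have hk0 : (0 : ℝ) < k := by exact_mod_cast (mem_Ioc.1 hk).1
    rw [mul_apply]
    have : ∀ x ∈ k.divisorsAntidiagonal, f x.1 * g x.2 = (moebius x.1 : ℝ) / k := by
      intro x hx
      have := (Nat.mem_divisorsAntidiagonal.1 hx).1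
      simp only [f, g, coe_mk]
      rw [← this]; push_cast; rw [div_mul_div_comm, mul_one]
    rw [sum_congr rfl this, ← sum_div]
    have h3 : (∑ x ∈ k.divisorsAntidiagonal, (moebius x.1 : ℤ)) = if k = 1 then 1 else 0 := by
      have := congrArg (fun F : ArithmeticFunction ℤ => F k) moebius_mul_coe_zeta
      simp only [mul_apply, one_apply] at this
      rw [← this]
      refine sum_congr rfl fun x hx => ?_
      have := Nat.ne_zero_of_mem_divisorsAntidiagonal hx
      simp [natCoe_apply, zeta_apply, this.2]
    have h4 : (∑ x ∈ k.divisorsAntidiagonal, (moebius x.1 : ℝ)) = if k = 1 then 1 else 0 := by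
      exact_mod_cast h3
    rw [h4]
    split_ifs with h5
    · simp [h5]
    · simp
  rw [sum_congr rfl hfg, sum_ite_eq' , if_pos (by simp; omega)] at h
  rw [h]
  refine sum_congr rfl fun k _ => by rw [hg]; rfl

lemma abs_harmonic_sub_log_le {y : ℝ} (hy : 1 ≤ y) :
    |(harmonic ⌊y⌋₊ : ℝ) - Real.log y - Real.eulerMascheroniConstant| ≤ 2 / y := by
  have hN : 1 ≤ ⌊y⌋₊ := Nat.one_le_floor_iff y |>.2 hy
  have h1 := Real.eulerMascheroniSeq_lt_eulerMascheroniConstant ⌊y⌋₊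
  have h2 := Real.eulerMascheroniConstant_lt_eulerMascheroniSeq' ⌊y⌋₊
  rw [Real.eulerMascheroniSeq] at h1
  rw [Real.eulerMascheroniSeq', if_neg (by omega)] at h2
  have l1 := Nat.floor_le (show 0 ≤ y by linarith)
  have l2 := Nat.lt_floor_add_one y
  have hN' : (1 : ℝ) ≤ (⌊y⌋₊ : ℝ) := by exact_mod_cast hN
  set N : ℝ := (⌊y⌋₊ : ℝ)
  have h3 : Real.log (N + 1) - Real.log N ≤ 1 / N := by
    rw [← Real.log_div (by linarith) (by linarith)]
    have := Real.log_le_sub_one_of_pos (show 0 < (N + 1) / N by positivity)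
    have e : (N + 1) / N - 1 = 1 / N := by field_simp; ring
    linarith
  have h4 : 1 / N ≤ 2 / y := by
    rw [div_le_div_iff₀ (by linarith) (by linarith)]; linarith
  have h5 : Real.log N ≤ Real.log y := Real.log_le_log (by linarith) l1
  have h6 : Real.log y ≤ Real.log (N + 1) := Real.log_le_log (by linarith) l2.le
  rw [abs_le]; constructor <;> linarith

lemma mobiusRiesz_of_lt_one {x : ℝ} (hx : x < 1) : mobiusRiesz x = 0 := by
  have : ⌊x⌋₊ = 0 := Nat.floor_eq_zero.2 hx
  simp [mobiusRiesz, this]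

open ArithmeticFunction in
lemma abs_mobiusRiesz_le (x : ℝ) : |mobiusRiesz x| ≤ 4 := by
  rcases lt_or_ge x 1 with hx | hx
  · rw [mobiusRiesz_of_lt_one hx]; norm_num
  have hn : 0 < ⌊x⌋₊ := Nat.floor_pos.2 hx
  set n := ⌊x⌋₊ with hn_def
  have hnx := Nat.floor_le (show 0 ≤ x by linarith)
  have h := sum_moebius_div_mul_harmonic hn
  have hm := abs_sum_moebius_div_le_one n
  set c := Real.eulerMascheroniConstant
  have hc1 : c < 1 := by linarith [Real.eulerMascheroniConstant_lt_two_thirds]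
  have hc0 : 0 < c := by linarith [Real.one_half_lt_eulerMascheroniConstant]
  have e : mobiusRiesz x = 1 - c * (∑ k ∈ Ioc 0 n, (moebius k : ℝ) / k) -
      ∑ k ∈ Ioc 0 n, (moebius k : ℝ) / k * ((harmonic (n / k) : ℝ) - Real.log (x / k) - c) := by
    rw [← h, mul_sum, ← sum_sub_distrib, ← sum_sub_distrib, mobiusRiesz]
    refine sum_congr rfl fun k _ => by ring
  have h3 : |∑ k ∈ Ioc 0 n, (moebius k : ℝ) / k *
      ((harmonic (n / k) : ℝ) - Real.log (x / k) - c)| ≤ 2 := by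
    refine (abs_sum_le_sum_abs _ _).trans ?_
    have : ∀ k ∈ Ioc 0 n, |(moebius k : ℝ) / k *
        ((harmonic (n / k) : ℝ) - Real.log (x / k) - c)| ≤ 2 / x := by
      intro k hk
      have hk0 : (0 : ℝ) < k := by exact_mod_cast (mem_Ioc.1 hk).1
      have hkx : (k : ℝ) ≤ x := le_trans (by exact_mod_cast (mem_Ioc.1 hk).2) hnx
      have b := abs_harmonic_sub_log_le (y := x / k) (by rwa [le_div_iff₀ hk0, one_mul])
      rw [Nat.floor_div_natCast] at b
      rw [abs_mul, abs_div, abs_of_pos hk0]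
      calc |(moebius k : ℝ)| / k * _ ≤ 1 / k * (2 / (x / k)) := by
            gcongr
            exact abs_moebius_real_le_one k
        _ = 2 / x := by field_simp
    refine (sum_le_card_nsmul _ _ _ this).trans ?_
    simp only [Nat.card_Ioc, tsub_zero, nsmul_eq_mul]
    rw [mul_div_assoc', div_le_iff₀ (by linarith)]
    linarith
  rw [e]
  rw [abs_le] at *
  constructor <;> nlinarith

open ArithmeticFunction (moebius) in
open Real in
lemma mobiusRiesz_eq_sum_posLog {x : ℝ} (hx : 0 ≤ x) {N : ℕ} (hN : ⌊x⌋₊ ≤ N) :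
    mobiusRiesz x = ∑ k ∈ Ioc 0 N, (moebius k : ℝ) / k * log⁺ (x / k) := by
  rw [mobiusRiesz]
  have hsub : Ioc 0 ⌊x⌋₊ ⊆ Ioc 0 N := Ioc_subset_Ioc_right hN
  rw [← sum_subset hsub]
  · refine sum_congr rfl fun k hk => ?_
    have hk := mem_Ioc.1 hk
    have hk0 : (0 : ℝ) < k := by exact_mod_cast hk.1
    rw [posLog_eq_log]
    rw [abs_of_nonneg (by positivity), le_div_iff₀ hk0, one_mul]
    exact (Nat.le_floor_iff hx).1 hk.2
  · intro k hk hk'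
    have hk := mem_Ioc.1 hk
    have hk0 : (0 : ℝ) < k := by exact_mod_cast hk.1
    have : ⌊x⌋₊ < k := by
      by_contra hc; exact hk' (mem_Ioc.2 ⟨hk.1, by omega⟩)
    have : x < k := (Nat.floor_lt hx).1 this
    rw [(posLog_eq_zero_iff _).2, mul_zero]
    rw [abs_of_nonneg (by positivity), div_le_one hk0]; exact this.le

open ArithmeticFunction (moebius) in
open Real in
lemma continuous_mobiusRiesz_exp : Continuous (fun u : ℝ => mobiusRiesz (exp u)) := by
  rw [continuous_iff_continuousAt]
  intro u
  have : (fun u : ℝ => mobiusRiesz (exp u)) =ᶠ[nhds u] fun z =>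
      ∑ k ∈ Ioc 0 ⌊exp (u + 1)⌋₊, (moebius k : ℝ) / k * log⁺ (exp z / k) := by
    filter_upwards [gt_mem_nhds (show u < u + 1 by linarith)] with s hs
    exact mobiusRiesz_eq_sum_posLog (exp_pos _).le (Nat.floor_mono (exp_le_exp.2 (le_of_lt hs)))
  refine ContinuousAt.congr ?_ this.symm
  refine Continuous.continuousAt ?_
  exact continuous_finsetSum _ fun k _ => by fun_prop

open ArithmeticFunction (moebius) in
open Real in
lemma abs_mobiusRiesz_exp_sub_le {u v : ℝ} (huv : u ≤ v) :
    |mobiusRiesz (exp v) - mobiusRiesz (exp u)| ≤ v - u := by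
  have := norm_image_sub_le_of_norm_deriv_right_le_segment (a := u) (b := v)
    (f := fun u => mobiusRiesz (exp u))
    (f' := fun u => ∑ k ∈ Ioc 0 ⌊exp u⌋₊, (moebius k : ℝ) / k) (C := 1)
    continuous_mobiusRiesz_exp.continuousOn ?_ ?_ v ⟨huv, le_rfl⟩
  · simpa using this
  · intro s _
    have e : (fun u : ℝ => mobiusRiesz (exp u)) =ᶠ[nhdsWithin s (Set.Ici s)] fun u =>
        ∑ k ∈ Ioc 0 ⌊exp s⌋₊, (moebius k : ℝ) / k * (u - log k) := by
      have h1 : s < log (⌊exp s⌋₊ + 1) := by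
        rw [lt_log_iff_exp_lt (by positivity)]; exact Nat.lt_floor_add_one _
      filter_upwards [self_mem_nhdsWithin, mem_nhdsWithin_of_mem_nhds (gt_mem_nhds h1)]
        with z hz hz'
      have : ⌊exp z⌋₊ = ⌊exp s⌋₊ := by
        refine le_antisymm ?_ (Nat.floor_mono (exp_le_exp.2 hz))
        refine Nat.lt_succ_iff.1 ((Nat.floor_lt (exp_pos _).le).2 ?_)
        rw [lt_log_iff_exp_lt (by positivity)] at hz'
        push_cast; exact hz'
      rw [mobiusRiesz, this]
      refine sum_congr rfl fun k hk => ?_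
      have hk0 : (0 : ℝ) < k := by exact_mod_cast (mem_Ioc.1 hk).1
      rw [log_div (exp_pos _).ne' hk0.ne', log_exp]
    refine HasDerivWithinAt.congr_of_eventuallyEq ?_ e (e.self_of_nhdsWithin Set.self_mem_Ici)
    refine HasDerivWithinAt.fun_sum fun k _ => ?_
    simpa using (((hasDerivWithinAt_id s (Set.Ici s)).sub_const (log k)).const_mul
        ((moebius k : ℝ) / k))
  · intro s _
    exact abs_sum_moebius_div_le_one _

/-- The deviation of the Riesz mean of the Möbius function from its limit, on a logarithmic
scale. -/
def rieszDev (u : ℝ) : ℝ := mobiusRiesz (Real.exp u) - (Set.Ici (0 : ℝ)).indicator 1 u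

lemma rieszDev_of_neg {u : ℝ} (hu : u < 0) : rieszDev u = 0 := by
  rw [rieszDev, mobiusRiesz_of_lt_one (by simpa using hu),
    Set.indicator_of_notMem (by simpa using hu)]
  simp

lemma rieszDev_of_nonneg {u : ℝ} (hu : 0 ≤ u) : rieszDev u = mobiusRiesz (Real.exp u) - 1 := by
  rw [rieszDev, Set.indicator_of_mem (by simpa using hu)]; simp

lemma abs_rieszDev_le (u : ℝ) : |rieszDev u| ≤ 5 := by
  rcases lt_or_ge u 0 with hu | hu
  · rw [rieszDev_of_neg hu]; norm_num
  · rw [rieszDev_of_nonneg hu]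
    have := abs_mobiusRiesz_le (Real.exp u)
    rw [abs_le] at *; constructor <;> linarith

lemma abs_rieszDev_sub_le {u v : ℝ} (hv : 1 ≤ v) : |rieszDev v - rieszDev u| ≤ 5 * |v - u| := by
  rcases lt_or_ge u 0 with hu | hu
  · rw [rieszDev_of_neg hu, sub_zero]
    have := abs_rieszDev_le v
    have : 1 ≤ |v - u| := by rw [abs_of_nonneg] <;> linarith
    linarith
  · rw [rieszDev_of_nonneg hu, rieszDev_of_nonneg (by linarith), sub_sub_sub_cancel_right]
    rcases le_total u v with h | h
    · have := abs_mobiusRiesz_exp_sub_le h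
      rw [abs_of_nonneg (sub_nonneg.2 h)]; linarith
    · have := abs_mobiusRiesz_exp_sub_le h
      rw [abs_sub_comm, abs_sub_comm v u, abs_of_nonneg (sub_nonneg.2 h)]; linarith

lemma measurable_rieszDev : Measurable rieszDev :=
  continuous_mobiusRiesz_exp.measurable.sub (measurable_one.indicator measurableSet_Ici)

/-- `s * ζ (1 + s)`, with its limiting value at `0`. -/
def zetaReg : ℂ → ℂ := Function.update (fun s => s * riemannZeta (1 + s)) 0 1

lemma zetaReg_of_ne {s : ℂ} (hs : s ≠ 0) : zetaReg s = s * riemannZeta (1 + s) := by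
  simp [zetaReg, hs]

lemma differentiable_zetaReg : Differentiable ℂ zetaReg := by
  have h1 : ∀ s : ℂ, s ≠ 0 → DifferentiableAt ℂ zetaReg s := by
    intro s hs
    have : zetaReg =ᶠ[nhds s] fun s => s * riemannZeta (1 + s) := by
      filter_upwards [isOpen_ne.mem_nhds hs] with z hz using zetaReg_of_ne hz
    refine DifferentiableAt.congr_of_eventuallyEq ?_ this
    refine differentiableAt_id.mul ?_
    exact DifferentiableAt.comp s (differentiableAt_riemannZeta (by simpa using hs))
      (differentiableAt_id.const_add 1)
  intro s
  rcases eq_or_ne s 0 with rfl | hs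
  · refine (Complex.analyticAt_of_differentiable_on_punctured_nhds_of_continuousAt
      ?_ ?_).differentiableAt
    · filter_upwards [self_mem_nhdsWithin] with z hz using h1 z hz
    · rw [zetaReg, continuousAt_update_same]
      have h2 : Tendsto (fun s : ℂ => 1 + s) (nhdsWithin 0 {0}ᶜ) (nhdsWithin 1 {1}ᶜ) := by
        refine tendsto_nhdsWithin_iff.2 ⟨?_, ?_⟩
        · have : Tendsto (fun s : ℂ => 1 + s) (nhds 0) (nhds (1 + 0)) :=
            (continuous_const.add continuous_id).tendsto 0
          rw [add_zero] at this
          exact this.mono_left nhdsWithin_le_nhds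
        · filter_upwards [self_mem_nhdsWithin] with z hz
          simpa using hz
      have := riemannZeta_residue_one.comp h2
      refine this.congr fun z => by simp
  · exact h1 s hs

lemma zetaReg_ne_zero {s : ℂ} (hs : 0 ≤ s.re) : zetaReg s ≠ 0 := by
  rcases eq_or_ne s 0 with rfl | h
  · simp [zetaReg]
  · rw [zetaReg_of_ne h]
    exact mul_ne_zero h (riemannZeta_ne_zero_of_one_le_re (by simpa using hs))

/-- The Laplace transform of `rieszDev`, extended to the closed half plane `0 ≤ re s`. -/
def rieszLaplace : ℂ → ℂ := dslope (fun s => (zetaReg s)⁻¹) 0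

lemma continuousAt_rieszLaplace {s : ℂ} (hs : 0 ≤ s.re) : ContinuousAt rieszLaplace s := by
  have hd : DifferentiableAt ℂ (fun s => (zetaReg s)⁻¹) s :=
    (differentiable_zetaReg s).inv (zetaReg_ne_zero hs)
  rcases eq_or_ne s 0 with rfl | h
  · exact continuousAt_dslope_same.2 hd
  · exact (continuousAt_dslope_of_ne h).2 hd.continuousAt

lemma rieszLaplace_of_ne {s : ℂ} (hs : s ≠ 0) :
    rieszLaplace s = (s ^ 2 * riemannZeta (1 + s))⁻¹ - s⁻¹ := by
  rw [rieszLaplace, dslope_of_ne _ hs, slope_def_field, zetaReg_of_ne hs]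
  simp only [zetaReg, Function.update_self, inv_one, sub_zero]
  rcases eq_or_ne (riemannZeta (1 + s)) 0 with h | h
  · simp [h, neg_div]
  · field_simp

section

open MeasureTheory

lemma max_zero_mul_exp_eq_indicator (s : ℂ) :
    (fun v : ℝ => ((max 0 v : ℝ) : ℂ) * Complex.exp (-s * v)) =
      (Set.Ioi (0 : ℝ)).indicator (fun v : ℝ => (v : ℂ) ^ ((2 : ℂ) - 1) *
        Complex.exp (-s * v)) := by
  ext v
  rcases le_or_gt v 0 with h | h
  · rw [Set.indicator_of_notMem (by simpa using h)]; simp [h]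
  · rw [Set.indicator_of_mem (by simpa using h)]
    norm_num [max_eq_right h.le]

lemma integrable_max_zero_mul_exp {s : ℂ} (hs : 0 < s.re) :
    Integrable (fun v : ℝ => ((max 0 v : ℝ) : ℂ) * Complex.exp (-s * v)) := by
  rw [max_zero_mul_exp_eq_indicator, integrable_indicator_iff measurableSet_Ioi]
  have h := Real.GammaIntegral_convergent (s := 2) (by norm_num)
  have h2 : IntegrableOn (fun v : ℝ => v ^ (1 : ℝ) * Real.exp (-s.re * v)) (Set.Ioi 0) :=
    integrableOn_rpow_mul_exp_neg_mul_rpow (s := 1) (p := 1) (by norm_num) (by norm_num) hs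
      |>.congr_fun
      (fun v _ => by simp) measurableSet_Ioi
  refine (integrable_norm_iff ?_).1 ?_
  · refine Measurable.aestronglyMeasurable ?_
    fun_prop
  · refine h2.congr_fun (fun v hv => ?_) measurableSet_Ioi
    have hv : 0 < v := hv
    simp only [Real.rpow_one]
    norm_num [Complex.norm_exp, abs_of_pos hv]

lemma integral_max_zero_mul_exp {s : ℂ} (hs : 0 < s.re) :
    ∫ v : ℝ, ((max 0 v : ℝ) : ℂ) * Complex.exp (-s * v) = (s ^ 2)⁻¹ := by
  have hs0 : s ≠ 0 := by rintro rfl; simp at hs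
  have hint := integrable_max_zero_mul_exp hs
  rw [max_zero_mul_exp_eq_indicator, integrable_indicator_iff measurableSet_Ioi] at hint
  rw [max_zero_mul_exp_eq_indicator, integral_indicator measurableSet_Ioi]
  have hd : ∀ x ∈ Set.Ici (0 : ℝ), HasDerivAt
      (fun v : ℝ => -((v : ℂ) / s + (s ^ 2)⁻¹) * Complex.exp (-s * v))
      ((x : ℂ) ^ ((2 : ℂ) - 1) * Complex.exp (-s * x)) x := by
    intro x _
    have h1 : HasDerivAt (fun v : ℂ => -(v / s + (s ^ 2)⁻¹) * Complex.exp (-s * v))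
        ((x : ℂ) ^ ((2 : ℂ) - 1) * Complex.exp (-s * x)) (x : ℂ) := by
      have ha : HasDerivAt (fun v : ℂ => -(v / s + (s ^ 2)⁻¹)) (-(1 / s)) (x : ℂ) :=
        (((hasDerivAt_id _).div_const s).add_const _).neg
      have hb : HasDerivAt (fun v : ℂ => Complex.exp (-s * v)) (Complex.exp (-s * x) * (-s * 1))
        (x : ℂ) := ((hasDerivAt_id _).const_mul (-s)).cexp
      refine (ha.mul hb).congr_deriv ?_
      norm_num
      field_simp
      ring
    exact h1.comp_ofReal
  have hlim : Tendsto (fun v : ℝ => -((v : ℂ) / s + (s ^ 2)⁻¹) * Complex.exp (-s * v)) atTop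
      (nhds 0) := by
    have h0 : Tendsto (fun v : ℝ => Complex.exp (-s * v)) atTop (nhds 0) := by
      rw [tendsto_zero_iff_norm_tendsto_zero]
      simp only [Complex.norm_exp]
      refine Real.tendsto_exp_atBot.comp ?_
      have : (fun v : ℝ => (-s * (v : ℂ)).re) = fun v : ℝ => -(s.re * v) := by ext; simp
      rw [this]
      exact tendsto_neg_atTop_atBot.comp (tendsto_id.const_mul_atTop hs)
    have h1 : Tendsto (fun v : ℝ => (v : ℂ) * Complex.exp (-s * v)) atTop (nhds 0) := by
      rw [tendsto_zero_iff_norm_tendsto_zero]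
      have := (Real.tendsto_pow_mul_exp_neg_atTop_nhds_zero 1).comp
        (tendsto_id.const_mul_atTop hs)
      have := this.const_mul s.re⁻¹
      rw [mul_zero] at this
      refine this.congr' ?_
      filter_upwards [eventually_gt_atTop 0] with v hv
      simp [Complex.norm_exp, abs_of_pos hv]
      field_simp
    have := (h1.const_mul (-s⁻¹)).add (h0.const_mul (-(s ^ 2)⁻¹))
    simp only [mul_zero, add_zero] at this
    refine this.congr fun v => ?_
    ring
  rw [integral_Ioi_of_hasDerivAt_of_tendsto' hd hint hlim]
  simp

lemma integral_indicator_Ici_mul_exp {s : ℂ} (hs : 0 < s.re) :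
    Integrable (fun v : ℝ => ((Set.Ici (0 : ℝ)).indicator (1 : ℝ → ℂ) v) * Complex.exp (-s * v)) ∧
    ∫ v : ℝ, ((Set.Ici (0 : ℝ)).indicator (1 : ℝ → ℂ) v) * Complex.exp (-s * v) = s⁻¹ := by
  have e : (fun v : ℝ => ((Set.Ici (0 : ℝ)).indicator (1 : ℝ → ℂ) v) * Complex.exp (-s * v)) =
      (Set.Ici (0 : ℝ)).indicator (fun v : ℝ => Complex.exp (-s * v)) := by
    ext v
    by_cases h : v ∈ Set.Ici (0 : ℝ) <;> simp [h]
  have hs' : (-s).re < 0 := by simpa using hs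
  rw [e]
  refine ⟨?_, ?_⟩
  · rw [integrable_indicator_iff measurableSet_Ici, integrableOn_Ici_iff_integrableOn_Ioi]
    exact integrableOn_exp_mul_complex_Ioi hs' 0
  · rw [integral_indicator measurableSet_Ici, integral_Ici_eq_integral_Ioi,
      integral_exp_mul_complex_Ioi hs' 0]
    have : s ≠ 0 := by rintro rfl; simp at hs
    simp

open ArithmeticFunction (moebius) in
lemma mobiusRiesz_exp_eq_sum (u : ℝ) {N : ℕ} (hN : ⌊Real.exp u⌋₊ ≤ N) :
    mobiusRiesz (Real.exp u) = ∑ k ∈ Ioc 0 N, (moebius k : ℝ) / k * max 0 (u - Real.log k) := by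
  rw [mobiusRiesz_eq_sum_posLog (Real.exp_pos u).le hN]
  refine sum_congr rfl fun k hk => ?_
  have hk0 : (0 : ℝ) < k := by exact_mod_cast (mem_Ioc.1 hk).1
  rw [Real.posLog_apply, Real.log_div (Real.exp_pos _).ne' hk0.ne', Real.log_exp]

open ArithmeticFunction (moebius) in
lemma integral_mobiusRiesz_exp {s : ℂ} (hs : 0 < s.re) :
    ∫ u : ℝ, (mobiusRiesz (Real.exp u) : ℂ) * Complex.exp (-s * u) =
      (s ^ 2 * riemannZeta (1 + s))⁻¹ := by
  set φ : ℝ → ℂ := fun v => ((max 0 v : ℝ) : ℂ) * Complex.exp (-s * v) with hφ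
  have hφi : Integrable φ := integrable_max_zero_mul_exp hs
  set F : ℕ → ℝ → ℂ := fun k u => LSeries.term (fun n => (moebius n : ℂ)) (1 + s) k *
    φ (u - Real.log k) with hF
  have hs1 : 1 < (1 + s).re := by simpa using hs
  have hFi : ∀ k, Integrable (F k) := fun k => (hφi.comp_sub_right _).const_mul _
  have hFn : ∀ k, ∫ u, ‖F k u‖ =
      ‖LSeries.term (fun n => (moebius n : ℂ)) (1 + s) k‖ * ∫ v, ‖φ v‖ := by
    intro k
    simp only [hF, norm_mul]
    rw [integral_const_mul, integral_sub_right_eq_self (fun v => ‖φ v‖)]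
  have hsum := ArithmeticFunction.LSeriesSummable_moebius_iff.2 hs1
  have key := hasSum_integral_of_summable_integral_norm hFi (by
    simp only [hFn]
    exact hsum.norm.mul_right _)
  have hpt : ∀ u, ∑' k, F k u = (mobiusRiesz (Real.exp u) : ℂ) * Complex.exp (-s * u) := by
    intro u
    have hterm : ∀ k, F k u = ((moebius k : ℝ) / k * max 0 (u - Real.log k) : ℝ) *
        Complex.exp (-s * u) := by
      intro k
      rcases Nat.eq_zero_or_pos k with rfl | hk
      · simp [hF]
      · have hk0 : (k : ℂ) ≠ 0 := by exact_mod_cast hk.ne'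
        simp only [hF, hφ, LSeries.term_of_ne_zero hk.ne']
        rw [Complex.cpow_add _ _ hk0, Complex.cpow_one, Complex.cpow_def_of_ne_zero hk0,
          Complex.natCast_log.symm]
        push_cast
        have : Complex.exp (-s * (u - Complex.log k)) =
            Complex.exp (-s * u) * Complex.exp (Complex.log k * s) := by
          rw [← Complex.exp_add]; congr 1; ring
        rw [this]
        have := Complex.exp_ne_zero (Complex.log k * s)
        field_simp
    rw [tsum_eq_sum (s := Ioc 0 ⌊Real.exp u⌋₊)]
    · rw [mobiusRiesz_exp_eq_sum u le_rfl, sum_congr rfl fun k _ => hterm k, ← sum_mul]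
      push_cast; rfl
    · intro k hk
      rw [hterm]
      rcases Nat.eq_zero_or_pos k with rfl | hk'
      · simp
      · have hk0 : (0 : ℝ) < k := by exact_mod_cast hk'
        have : ⌊Real.exp u⌋₊ < k := by
          by_contra hc; exact hk (mem_Ioc.2 ⟨hk', by omega⟩)
        have : Real.exp u < k := (Nat.floor_lt (Real.exp_pos u).le).1 this
        have : u < Real.log k := (Real.lt_log_iff_exp_lt hk0).2 this
        rw [max_eq_left (by linarith)]; simp
  simp only [hpt] at key
  have hint : ∀ k, ∫ u, F k u = LSeries.term (fun n => (moebius n : ℂ)) (1 + s) k * (s ^ 2)⁻¹ := by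
    intro k
    simp only [hF]
    rw [integral_const_mul, integral_sub_right_eq_self φ, hφ, integral_max_zero_mul_exp hs]
  simp only [hint] at key
  have h2 := hsum.hasSum.mul_right (s ^ 2)⁻¹
  rw [key.unique h2]
  have h3 := ArithmeticFunction.LSeries_zeta_mul_Lseries_moebius hs1
  rw [ArithmeticFunction.LSeries_zeta_eq_riemannZeta hs1] at h3
  rw [mul_inv, mul_comm]
  congr 1
  exact eq_inv_of_mul_eq_one_right h3

lemma integrable_rieszDev_mul_exp {s : ℂ} (hs : 0 < s.re) :
    Integrable (fun u : ℝ => (rieszDev u : ℂ) * Complex.exp (-s * u)) := by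
  have h := (integral_indicator_Ici_mul_exp hs).1
  have := h.bdd_mul (c := 5) (f := fun u => (rieszDev u : ℂ))
    (Complex.measurable_ofReal.comp measurable_rieszDev).aestronglyMeasurable
    (ae_of_all _ fun u => by simpa using abs_rieszDev_le u)
  refine this.congr (ae_of_all _ fun u => ?_)
  rcases lt_or_ge u 0 with hu | hu
  · simp [rieszDev_of_neg hu]
  · simp [Set.indicator_of_mem (show u ∈ Set.Ici (0:ℝ) from hu)]

lemma integral_rieszDev_mul_exp {s : ℂ} (hs : 0 < s.re) :
    ∫ u : ℝ, (rieszDev u : ℂ) * Complex.exp (-s * u) = rieszLaplace s := by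
  have hs0 : s ≠ 0 := by rintro rfl; simp at hs
  obtain ⟨hi, he⟩ := integral_indicator_Ici_mul_exp hs
  have e : ∀ u : ℝ, (mobiusRiesz (Real.exp u) : ℂ) * Complex.exp (-s * u) =
      (rieszDev u : ℂ) * Complex.exp (-s * u) +
        ((Set.Ici (0 : ℝ)).indicator (1 : ℝ → ℂ) u) * Complex.exp (-s * u) := by
    intro u
    rw [rieszDev]
    by_cases h : u ∈ Set.Ici (0 : ℝ) <;> simp [h] ; ring
  have h := integral_mobiusRiesz_exp hs
  simp only [e] at h
  rw [integral_add (integrable_rieszDev_mul_exp hs) hi, he] at h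
  rw [rieszLaplace_of_ne hs0, ← h]; ring

open FourierTransform SchwartzMap in
lemma exists_bandlimited_kernel : ∃ Φ K : ℝ → ℂ, Continuous Φ ∧ HasCompactSupport Φ ∧
    Continuous K ∧ Integrable K ∧ Integrable (fun y => |y| * ‖K y‖) ∧ ∫ y, K y = 1 ∧
    ∀ y : ℝ, K y = ∫ t : ℝ, Φ t * Complex.exp (-(2 * Real.pi * t * y : ℝ) * Complex.I) := by
  let bump : ContDiffBump (0 : ℝ) := ⟨1, 2, by norm_num, by norm_num⟩
  have hs : ContDiff ℝ (⊤ : ℕ∞) (fun t => (bump t : ℂ)) :=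
    Complex.ofRealCLM.contDiff.comp bump.contDiff
  have hc : HasCompactSupport (fun t => (bump t : ℂ)) :=
    bump.hasCompactSupport.comp_left (g := fun x : ℝ => (x : ℂ)) (by simp)
  let Ψ : 𝓢(ℝ, ℂ) := hc.toSchwartzMap hs
  have hΨ : ∀ t, Ψ t = (bump t : ℂ) := fun t => rfl
  refine ⟨fun t => (bump t : ℂ), ⇑(𝓕 Ψ : 𝓢(ℝ, ℂ)), hs.continuous, hc, (𝓕 Ψ).continuous, (𝓕 Ψ).integrable,
    ?_,
    ?_, ?_⟩
  · refine ((𝓕 Ψ : 𝓢(ℝ, ℂ)).integrable_pow_mul volume 1).congr (ae_of_all _ fun y => ?_)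
    simp only [pow_one, Real.norm_eq_abs]
  · have h1 : 𝓕⁻ (𝓕 Ψ : 𝓢(ℝ, ℂ)) = Ψ := fourierInv_fourier_eq Ψ
    have h2 : 𝓕⁻ (⇑(𝓕 Ψ : 𝓢(ℝ, ℂ))) 0 = Ψ 0 := by rw [← fourierInv_coe, h1]
    rw [Real.fourierInv_eq', hΨ] at h2
    simp only [inner_zero_right, mul_zero, Complex.ofReal_zero, zero_mul, Complex.exp_zero,
      one_smul] at h2
    rw [h2, bump.one_of_mem_closedBall (by simp [bump])]
    simp
  · intro y
    rw [fourier_coe, Real.fourier_real_eq_integral_exp_smul]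
    refine integral_congr_ae (ae_of_all _ fun t => ?_)
    simp only [hΨ, smul_eq_mul]
    rw [mul_comm]
    congr 3
    push_cast; ring

/-- The phase `exp (-2 * π * i * t * y)`. -/
def phase (t y : ℝ) : ℂ := Complex.exp (-(2 * Real.pi * t * y : ℝ) * Complex.I)

lemma norm_phase (t y : ℝ) : ‖phase t y‖ = 1 := by
  rw [phase, ← Complex.ofReal_neg, Complex.norm_exp_ofReal_mul_I]

lemma continuous_phase : Continuous (Function.uncurry phase) := by
  unfold phase Function.uncurry
  fun_prop

lemma integral_rieszDev_mul_kernel {Φ K : ℝ → ℂ} (hΦ : Continuous Φ) (hΦc : HasCompactSupport Φ)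
    (hK : ∀ y, K y = ∫ t, Φ t * phase t y) {σ : ℝ} (hσ : 0 < σ) (l v : ℝ) :
    ∫ u, ((rieszDev u : ℂ) * Complex.exp (-(σ : ℂ) * u)) * K (l * (v - u)) =
      ∫ t, phase t (l * v) * (Φ t * rieszLaplace (σ - (2 * Real.pi * l * t : ℝ) * Complex.I)) := by
  have h1 := integrable_rieszDev_mul_exp (s := σ) (by simpa using hσ)
  have h2 : Integrable Φ := hΦ.integrable_of_hasCompactSupport hΦc
  have h3 := h1.mul_prod h2
  have h4 : Integrable (fun z : ℝ × ℝ => (((rieszDev z.1 : ℂ) * Complex.exp (-(σ : ℂ) * z.1)) *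
      Φ z.2) * phase z.2 (l * (v - z.1))) (volume.prod volume) := by
    refine h3.mul_bdd (c := 1) ?_ (ae_of_all _ fun z => (norm_phase _ _).le)
    refine Continuous.aestronglyMeasurable ?_
    exact continuous_phase.comp (f := fun z : ℝ × ℝ => (z.2, l * (v - z.1))) (by fun_prop)
  have h5 := integral_integral_swap (f := fun u t => (((rieszDev u : ℂ) *
    Complex.exp (-(σ : ℂ) * u)) * Φ t) * phase t (l * (v - u))) h4
  simp only [hK]
  calc _ = ∫ u, ∫ t, (((rieszDev u : ℂ) *
    Complex.exp (-(σ : ℂ) * u)) * Φ t) * phase t (l * (v - u)) := by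
        refine integral_congr_ae (ae_of_all _ fun u => ?_)
        simp only []
        rw [← integral_const_mul]
        simp only [mul_assoc]
    _ = _ := by
        rw [h5]
        refine integral_congr_ae (ae_of_all _ fun t => ?_)
        simp only []
        rw [← integral_rieszDev_mul_exp (by simpa using hσ), ← integral_const_mul,
          ← integral_const_mul]
        refine integral_congr_ae (ae_of_all _ fun u => ?_)
        simp only [phase]
        have : Complex.exp (-(2 * Real.pi * t * (l * (v - u)) : ℝ) * Complex.I) *
            Complex.exp (-(σ : ℂ) * u) =
            Complex.exp (-(2 * Real.pi * t * (l * v) : ℝ) * Complex.I) *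
            Complex.exp (-(σ - (2 * Real.pi * l * t : ℝ) * Complex.I) * u) := by
          rw [← Complex.exp_add, ← Complex.exp_add]
          congr 1; push_cast; ring
        linear_combination ((rieszDev u : ℂ) * Φ t) * this

lemma integral_rieszDev_mul_kernel_zero {Φ K : ℝ → ℂ} (hΦ : Continuous Φ)
    (hΦc : HasCompactSupport Φ) (hKc : Continuous K) (hKi : Integrable K)
    (hK : ∀ y, K y = ∫ t, Φ t * phase t y) {l : ℝ} (hl : 0 < l) (v : ℝ) :
    ∫ u, (rieszDev u : ℂ) * K (l * (v - u)) =
      ∫ t, phase t (l * v) * (Φ t * rieszLaplace (-(2 * Real.pi * l * t : ℝ) * Complex.I)) := by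
  have hKi' : Integrable (fun u => K (l * (v - u))) :=
    (hKi.comp_mul_left' hl.ne').comp_sub_left v
  have hL : Tendsto (fun σ : ℝ => ∫ u, ((rieszDev u : ℂ) * Complex.exp (-(σ : ℂ) * u)) *
      K (l * (v - u))) (nhdsWithin 0 (Set.Ioi 0))
        (nhds (∫ u, (rieszDev u : ℂ) * K (l * (v - u)))) := by
    refine tendsto_integral_filter_of_dominated_convergence
      (fun u => 5 * ‖K (l * (v - u))‖) ?_ ?_ (hKi'.norm.const_mul 5) ?_
    · refine Eventually.of_forall fun σ => Measurable.aestronglyMeasurable ?_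
      exact ((Complex.measurable_ofReal.comp measurable_rieszDev).mul (by fun_prop)).mul
        (hKc.measurable.comp (by fun_prop))
    · filter_upwards [self_mem_nhdsWithin] with σ hσ
      refine ae_of_all _ fun u => ?_
      have hσ : 0 < σ := hσ
      rw [norm_mul, norm_mul]
      refine mul_le_mul_of_nonneg_right ?_ (norm_nonneg _)
      rcases lt_or_ge u 0 with hu | hu
      · rw [rieszDev_of_neg hu]; simp
      · have h1 : ‖Complex.exp (-(σ : ℂ) * u)‖ ≤ 1 := by
          rw [Complex.norm_exp]; simpa using mul_nonneg hσ.le hu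
        have h2 : ‖(rieszDev u : ℂ)‖ ≤ 5 := by simpa using abs_rieszDev_le u
        nlinarith [norm_nonneg (rieszDev u : ℂ), norm_nonneg (Complex.exp (-(σ : ℂ) * u))]
    · refine ae_of_all _ fun u => ?_
      have : Tendsto (fun σ : ℝ => ((rieszDev u : ℂ) * Complex.exp (-(σ : ℂ) * u)) *
          K (l * (v - u))) (nhds 0) (nhds (((rieszDev u : ℂ) * Complex.exp (-((0 : ℝ) : ℂ) * u)) *
          K (l * (v - u)))) := by
        refine Continuous.tendsto ?_ 0
        fun_prop
      simpa using this.mono_left nhdsWithin_le_nhds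
  obtain ⟨C, hC⟩ : ∃ C, ∀ σ ∈ Set.Icc (0 : ℝ) 1, ∀ t ∈ tsupport Φ,
      ‖rieszLaplace (σ - (2 * Real.pi * l * t : ℝ) * Complex.I)‖ ≤ C := by
    have hcomp : IsCompact (Set.Icc (0 : ℝ) 1 ×ˢ tsupport Φ) := isCompact_Icc.prod hΦc
    have hcont : ContinuousOn (fun z : ℝ × ℝ =>
        rieszLaplace (z.1 - (2 * Real.pi * l * z.2 : ℝ) * Complex.I))
        (Set.Icc (0 : ℝ) 1 ×ˢ tsupport Φ) := by
      intro z hz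
      refine ContinuousAt.continuousWithinAt ?_
      have h1 : ContinuousAt rieszLaplace (z.1 - (2 * Real.pi * l * z.2 : ℝ) * Complex.I) :=
        continuousAt_rieszLaplace (by simpa using hz.1.1)
      exact ContinuousAt.comp (f := fun z : ℝ × ℝ =>
        ((z.1 : ℂ) - (2 * Real.pi * l * z.2 : ℝ) * Complex.I)) h1 (by fun_prop)
    obtain ⟨C, hC⟩ := hcomp.exists_bound_of_continuousOn hcont
    exact ⟨C, fun σ hσ t ht => hC (σ, t) ⟨hσ, ht⟩⟩
  have hC' : ∀ σ ∈ Set.Icc (0 : ℝ) 1, ∀ t,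
      ‖Φ t * rieszLaplace (σ - (2 * Real.pi * l * t : ℝ) * Complex.I)‖ ≤ ‖Φ t‖ * C := by
    intro σ hσ t
    by_cases ht : t ∈ tsupport Φ
    · rw [norm_mul]; exact mul_le_mul_of_nonneg_left (hC σ hσ t ht) (norm_nonneg _)
    · simp [image_eq_zero_of_notMem_tsupport ht]
  have hR : Tendsto (fun σ : ℝ => ∫ t, phase t (l * v) *
      (Φ t * rieszLaplace (σ - (2 * Real.pi * l * t : ℝ) * Complex.I)))
      (nhdsWithin 0 (Set.Ioi 0)) (nhds (∫ t, phase t (l * v) *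
        (Φ t * rieszLaplace (-(2 * Real.pi * l * t : ℝ) * Complex.I)))) := by
    refine tendsto_integral_filter_of_dominated_convergence (fun t => ‖Φ t‖ * C) ?_ ?_
      ((hΦ.integrable_of_hasCompactSupport hΦc).norm.mul_const C) ?_
    · filter_upwards [self_mem_nhdsWithin] with σ hσ
      have hσ : 0 < σ := hσ
      refine Continuous.aestronglyMeasurable ?_
      have h1 :
          Continuous (fun t : ℝ => rieszLaplace (σ - (2 * Real.pi * l * t : ℝ) * Complex.I)) := by
        rw [continuous_iff_continuousAt]
        intro t
        exact ContinuousAt.comp (f := fun t : ℝ =>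
          ((σ : ℂ) - (2 * Real.pi * l * t : ℝ) * Complex.I))
          (continuousAt_rieszLaplace (by simpa using hσ.le)) (by fun_prop)
      have h2 : Continuous (fun t => phase t (l * v)) :=
        continuous_phase.comp (f := fun t : ℝ => (t, l * v)) (by fun_prop)
      exact h2.mul (hΦ.mul h1)
    · have : Set.Ioc (0 : ℝ) 1 ∈ nhdsWithin (0 : ℝ) (Set.Ioi 0) := Ioc_mem_nhdsGT one_pos
      filter_upwards [this] with σ hσ
      refine ae_of_all _ fun t => ?_
      rw [norm_mul, norm_phase, one_mul]
      exact hC' σ ⟨hσ.1.le, hσ.2⟩ t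
    · refine ae_of_all _ fun t => ?_
      have h1 : Tendsto (fun σ : ℝ => rieszLaplace (σ - (2 * Real.pi * l * t : ℝ) * Complex.I))
          (nhds 0) (nhds (rieszLaplace (((0 : ℝ) : ℂ) - (2 * Real.pi * l * t : ℝ) * Complex.I))) :=
        ContinuousAt.comp (f := fun σ : ℝ =>
          ((σ : ℂ) - (2 * Real.pi * l * t : ℝ) * Complex.I)) (x := 0)
          (continuousAt_rieszLaplace (by simp)) (by fun_prop)
      simp only [Complex.ofReal_zero, zero_sub] at h1
      simp only [neg_mul]
      exact ((h1.mono_left nhdsWithin_le_nhds).const_mul _).const_mul _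
  refine tendsto_nhds_unique hL (hR.congr' ?_)
  filter_upwards [self_mem_nhdsWithin] with σ hσ
  exact (integral_rieszDev_mul_kernel hΦ hΦc hK hσ l v).symm

lemma tendsto_integral_rieszDev_mul_kernel {Φ K : ℝ → ℂ} (hΦ : Continuous Φ)
    (hΦc : HasCompactSupport Φ) (hKc : Continuous K) (hKi : Integrable K)
    (hK : ∀ y, K y = ∫ t, Φ t * phase t y) {l : ℝ} (hl : 0 < l) :
    Tendsto (fun v => ∫ u, (rieszDev u : ℂ) * K (l * (v - u))) atTop (nhds 0) := by
  simp only [integral_rieszDev_mul_kernel_zero hΦ hΦc hKc hKi hK hl]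
  have h1 := (Real.tendsto_integral_exp_smul_cocompact (fun t => Φ t *
    rieszLaplace (-(2 * Real.pi * l * t : ℝ) * Complex.I))).comp
    ((tendsto_id.const_mul_atTop hl).mono_right atTop_le_cocompact)
  refine h1.congr fun v => ?_
  refine integral_congr_ae (ae_of_all _ fun t => ?_)
  simp only [Circle.smul_def, Real.fourierChar_apply, phase, smul_eq_mul, id]
  congr 2
  push_cast; ring

lemma norm_rieszDev_sub_integral_kernel_le {K : ℝ → ℂ} (hKi : Integrable K)
    (hK1 : Integrable (fun y => |y| * ‖K y‖)) (hKint : ∫ y, K y = 1) {l : ℝ} (hl : 0 < l)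
    {v : ℝ} (hv : 1 ≤ v) :
    ‖(rieszDev v : ℂ) - l * ∫ u, (rieszDev u : ℂ) * K (l * (v - u))‖ ≤
      5 / l * ∫ y, |y| * ‖K y‖ := by
  have e1 : (l : ℂ) * ∫ u, (rieszDev u : ℂ) * K (l * (v - u)) =
      ∫ y, (rieszDev (v - y / l) : ℂ) * K y := by
    have h1 : ∫ u, (rieszDev u : ℂ) * K (l * (v - u)) =
        ∫ x, (rieszDev (v - x) : ℂ) * K (l * x) := by
      rw [← integral_sub_left_eq_self _ _ v]
      simp
    have h2 := Measure.integral_comp_mul_left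
      (fun y => (rieszDev (v - y / l) : ℂ) * K y) l
    simp only [mul_div_cancel_left₀ _ hl.ne'] at h2
    rw [h1, h2, abs_of_pos (inv_pos.2 hl), Complex.real_smul]
    have : (l : ℂ) ≠ 0 := by exact_mod_cast hl.ne'
    push_cast
    rw [← mul_assoc, mul_inv_cancel₀ this, one_mul]
  have hm : ∀ g : ℝ → ℝ, Measurable g → Integrable (fun y => (rieszDev (g y) : ℂ) * K y) :=
    fun g hg => hKi.bdd_mul (c := 5)
      (Complex.measurable_ofReal.comp (measurable_rieszDev.comp hg)).aestronglyMeasurable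
      (ae_of_all _ fun y => by simpa using abs_rieszDev_le _)
  have e2 : (rieszDev v : ℂ) = ∫ y, (rieszDev v : ℂ) * K y := by
    rw [integral_const_mul, hKint, mul_one]
  rw [e1, e2, ← integral_sub (hm (fun _ => v) measurable_const)
    (hm (fun y => v - y / l) (by fun_prop))]
  rw [← integral_const_mul]
  refine norm_integral_le_of_norm_le (hK1.const_mul _) (ae_of_all _ fun y => ?_)
  rw [← sub_mul, norm_mul, ← Complex.ofReal_sub, Complex.norm_real, Real.norm_eq_abs]
  have := abs_rieszDev_sub_le (u := v - y / l) hv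
  have e : |v - (v - y / l)| = |y| / l := by
    rw [sub_sub_cancel, abs_div, abs_of_pos hl]
  rw [e] at this
  calc _ ≤ (5 * (|y| / l)) * ‖K y‖ := mul_le_mul_of_nonneg_right this (norm_nonneg _)
    _ = _ := by ring

lemma tendsto_rieszDev : Tendsto rieszDev atTop (nhds 0) := by
  obtain ⟨Φ, K, hΦ, hΦc, hKc, hKi, hK1, hKint, hK⟩ := exists_bandlimited_kernel
  set C := ∫ y, |y| * ‖K y‖ with hC
  have hC0 : 0 ≤ C := integral_nonneg fun y => by positivity
  rw [Metric.tendsto_atTop]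
  intro ε hε
  set l : ℝ := 10 * (C + 1) / ε with hl
  have hl0 : 0 < l := by positivity
  have h1 := tendsto_integral_rieszDev_mul_kernel hΦ hΦc hKc hKi hK hl0
  obtain ⟨V, hV⟩ := (Metric.tendsto_atTop.1 h1) (ε / 2 / l) (by positivity)
  refine ⟨max V 1, fun v hv => ?_⟩
  have h2 := hV v (le_trans (le_max_left _ _) hv)
  have h3 := norm_rieszDev_sub_integral_kernel_le hKi hK1 hKint hl0
    (le_trans (le_max_right _ _) hv)
  rw [dist_zero_right] at h2 ⊢
  set J := ∫ u, (rieszDev u : ℂ) * K (l * (v - u))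
  have h4 : ‖(rieszDev v : ℂ)‖ ≤ ‖(rieszDev v : ℂ) - l * J‖ + ‖(l : ℂ) * J‖ := by
    simpa using norm_add_le ((rieszDev v : ℂ) - l * J) (l * J)
  rw [Complex.norm_real] at h4
  have h5 : ‖(l : ℂ) * J‖ < ε / 2 := by
    rw [norm_mul, Complex.norm_real, Real.norm_of_nonneg hl0.le]
    rwa [lt_div_iff₀ hl0, mul_comm] at h2
  have h6 : 5 / l * C ≤ ε / 2 := by
    rw [div_mul_eq_mul_div, div_le_iff₀ hl0]
    have : ε / 2 * l = 5 * (C + 1) := by rw [hl]; field_simp; ring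
    linarith
  linarith

lemma eventually_abs_mobiusRiesz_sub_one_le {η : ℝ} (hη : 0 < η) :
    ∃ Y : ℝ, 1 ≤ Y ∧ ∀ x, Y ≤ x → |mobiusRiesz x - 1| ≤ η := by
  obtain ⟨V, hV⟩ := (Metric.tendsto_atTop.1 tendsto_rieszDev) η hη
  refine ⟨Real.exp (max V 0), by simp, fun x hx => ?_⟩
  have hx0 : 0 < x := (Real.exp_pos _).trans_le hx
  have hl : max V 0 ≤ Real.log x := (Real.le_log_iff_exp_le hx0).2 hx
  have := hV (Real.log x) ((le_max_left _ _).trans hl)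
  rw [dist_zero_right, rieszDev_of_nonneg ((le_max_right _ _).trans hl), Real.exp_log hx0] at this
  exact this.le

end

/-- The product of the elements of a finite set of natural numbers, as a real number. -/
def realProd (A : Finset ℕ) : ℝ := ∏ p ∈ A, (p : ℝ)

lemma realProd_empty : realProd ∅ = 1 := by simp [realProd]

lemma realProd_insert {p : ℕ} {A : Finset ℕ} (hp : p ∉ A) :
    realProd (insert p A) = p * realProd A := by rw [realProd, prod_insert hp, realProd]

lemma realProd_eq_cast (A : Finset ℕ) : realProd A = ((∏ p ∈ A, p : ℕ) : ℝ) := by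
  rw [realProd, Nat.cast_prod]

lemma one_le_realProd {A : Finset ℕ} (hA : ∀ p ∈ A, p.Prime) : 1 ≤ realProd A := by
  rw [realProd_eq_cast]
  exact_mod_cast Nat.one_le_iff_ne_zero.2 (prod_ne_zero_iff.2 fun p hp => (hA p hp).ne_zero)

lemma realProd_pos {A : Finset ℕ} (hA : ∀ p ∈ A, p.Prime) : 0 < realProd A :=
  zero_lt_one.trans_le (one_le_realProd hA)

lemma realProd_union {A B : Finset ℕ} (h : Disjoint A B) :
    realProd (A ∪ B) = realProd A * realProd B := prod_union h

open ArithmeticFunction (moebius isMultiplicative_moebius moebius_apply_prime) in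
lemma moebius_prod_primes {A : Finset ℕ} (hA : ∀ p ∈ A, p.Prime) :
    moebius (∏ p ∈ A, p) = (-1) ^ #A := by
  rw [isMultiplicative_moebius.map_prod_of_prime _ hA,
    prod_congr rfl fun p hp => moebius_apply_prime (hA p hp), prod_const]

open ArithmeticFunction (moebius moebius_eq_zero_of_not_squarefree) in
lemma sum_powerset_eq_sum_moebius {V : Finset ℕ} (hV : ∀ p ∈ V, p.Prime) {D : Finset ℕ}
    {f : ℕ → ℝ} (h1 : ∀ d ∈ D, Squarefree d → f d ≠ 0 → d.primeFactors ⊆ V)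
    (h2 : ∀ A ⊆ V, f (∏ p ∈ A, p) ≠ 0 → ∏ p ∈ A, p ∈ D) :
    ∑ A ∈ V.powerset, (-1) ^ #A * f (∏ p ∈ A, p) = ∑ d ∈ D, (moebius d : ℝ) * f d := by
  refine sum_bij_ne_zero (fun A _ _ => ∏ p ∈ A, p) ?_ ?_ ?_ ?_
  · intro A hA hne
    exact h2 A (mem_powerset.1 hA) (right_ne_zero_of_mul hne)
  · intro A hA _ B hB _ hAB
    have hA' := Nat.primeFactors_prod fun p hp => hV p (mem_powerset.1 hA hp)
    have hB' := Nat.primeFactors_prod fun p hp => hV p (mem_powerset.1 hB hp)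
    replace hAB : ∏ p ∈ A, p = ∏ p ∈ B, p := hAB
    rw [← hA', ← hB', hAB]
  · intro d hd hne
    have hsq : Squarefree d := by
      by_contra hc
      exact hne (by rw [moebius_eq_zero_of_not_squarefree hc]; simp)
    have hf := right_ne_zero_of_mul hne
    have hsub := h1 d hd hsq hf
    have hprod := Nat.prod_primeFactors_of_squarefree hsq
    refine ⟨d.primeFactors, mem_powerset.2 hsub, ?_, hprod⟩
    rw [hprod]
    exact mul_ne_zero (pow_ne_zero _ (by norm_num)) hf
  · intro A hA _
    rw [moebius_prod_primes fun p hp => hV p (mem_powerset.1 hA hp)]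
    push_cast; rfl

/-- The Riesz-type mean of `μ(d)/d` over products `d` of primes in `V`. -/
def sievedRiesz (V : Finset ℕ) (x : ℝ) : ℝ :=
  ∑ A ∈ V.powerset, (-1) ^ #A / realProd A * Real.posLog (x / realProd A)

lemma sievedRiesz_insert {p : ℕ} {V : Finset ℕ} (hp : p ∉ V) (x : ℝ) :
    sievedRiesz (insert p V) x = sievedRiesz V x - 1 / p * sievedRiesz V (x / p) := by
  rw [sievedRiesz, sum_powerset_insert hp, sub_eq_add_neg]
  congr 1
  rw [sievedRiesz, mul_sum, ← sum_neg_distrib]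
  refine sum_congr rfl fun A hA => ?_
  have hpA : p ∉ A := fun h => hp (mem_powerset.1 hA h)
  rw [card_insert_of_notMem hpA, realProd_insert hpA, div_div]
  ring

lemma posLog_eq_zero_of_le_one {x : ℝ} (h0 : 0 ≤ x) (h1 : x ≤ 1) : Real.posLog x = 0 :=
  (Real.posLog_eq_zero_iff _).2 (by rwa [abs_of_nonneg h0])

lemma sievedRiesz_eq_zero {V : Finset ℕ} (hV : ∀ p ∈ V, p.Prime) {x : ℝ} (h0 : 0 ≤ x)
    (h1 : x ≤ 1) : sievedRiesz V x = 0 := by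
  refine sum_eq_zero fun A hA => ?_
  have hA1 := one_le_realProd fun p hp => hV p (mem_powerset.1 hA hp)
  rw [posLog_eq_zero_of_le_one (by positivity) (div_le_one_of_le₀ (h1.trans hA1) (by positivity)),
    mul_zero]

/-- The primes not exceeding `R`. -/
def primesLE (R : ℝ) : Finset ℕ := (Ioc 0 ⌊R⌋₊).filter Nat.Prime

lemma prime_of_mem_primesLE {R : ℝ} {p : ℕ} (h : p ∈ primesLE R) : p.Prime := (mem_filter.1 h).2

lemma mem_primesLE {R : ℝ} {p : ℕ} (hp : p.Prime) (h : (p : ℝ) ≤ R) : p ∈ primesLE R :=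
  mem_filter.2 ⟨mem_Ioc.2 ⟨hp.pos, Nat.le_floor h⟩, hp⟩

lemma sievedRiesz_primesLE {R x : ℝ} (hx : 0 < x) (hxR : x ≤ R) :
    sievedRiesz (primesLE R) x = mobiusRiesz x := by
  rw [mobiusRiesz_eq_sum_posLog hx.le (Nat.floor_mono hxR)]
  have := sum_powerset_eq_sum_moebius (V := primesLE R) (fun p => prime_of_mem_primesLE)
    (D := Ioc 0 ⌊R⌋₊) (f := fun d => 1 / d * Real.posLog (x / d)) ?_ ?_
  · rw [sievedRiesz]
    refine Eq.trans (sum_congr rfl fun A _ => ?_) (this.trans (sum_congr rfl fun k _ => ?_))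
    · rw [realProd_eq_cast]; ring
    · ring
  · intro d hd _ _ p hp
    have hd := mem_Ioc.1 hd
    have hp' := Nat.prime_of_mem_primeFactors hp
    have := Nat.le_of_dvd hd.1 (Nat.dvd_of_mem_primeFactors hp)
    exact mem_filter.2 ⟨mem_Ioc.2 ⟨hp'.pos, this.trans hd.2⟩, hp'⟩
  · intro A hA hne
    have hAp : ∀ p ∈ A, p.Prime := fun p hp => prime_of_mem_primesLE (hA hp)
    have h1 := one_le_realProd hAp
    rw [← realProd_eq_cast] at hne
    have h2 := right_ne_zero_of_mul hne
    have h3 : realProd A ≤ x := by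
      by_contra hc
      exact h2 (posLog_eq_zero_of_le_one (by positivity)
        (div_le_one_of_le₀ (not_le.1 hc).le (by positivity)))
    rw [mem_Ioc]
    rw [realProd_eq_cast] at h3 h1
    exact ⟨by exact_mod_cast h1, Nat.le_floor (h3.trans hxR)⟩

/-- `∏ p/(p-1)` over `p ∈ P`. -/
def sieveFactor (P : Finset ℕ) : ℝ := ∏ p ∈ P, (p : ℝ) / (p - 1)

/-- `∑ log p/(p-1)` over `p ∈ P`. -/
def sieveShift (P : Finset ℕ) : ℝ := ∑ p ∈ P, Real.log p / (p - 1)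

lemma sieveFactor_pos {P : Finset ℕ} (hP : ∀ p ∈ P, p.Prime) : 0 < sieveFactor P := by
  refine prod_pos fun p hp => ?_
  have : (1 : ℝ) < p := by exact_mod_cast (hP p hp).one_lt
  have : (0 : ℝ) < p - 1 := by linarith
  positivity

lemma sieveShift_nonneg {P : Finset ℕ} (hP : ∀ p ∈ P, p.Prime) : 0 ≤ sieveShift P := by
  refine sum_nonneg fun p hp => ?_
  have h1 : (1 : ℝ) < p := by exact_mod_cast (hP p hp).one_lt
  have : (0 : ℝ) < p - 1 := by linarith
  have := Real.log_nonneg h1.le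
  positivity

lemma sieveFactor_union {P Q : Finset ℕ} (h : Disjoint P Q) :
    sieveFactor (P ∪ Q) = sieveFactor P * sieveFactor Q := prod_union h

lemma abs_sievedRiesz_sub_le_of_insert {p : ℕ} (hp : p.Prime) {U : Finset ℕ} (hU : ∀ q ∈ U, q.Prime)
    (hpU : p ∉ U) {c α β X : ℝ} (hβ : 0 ≤ β)
    (h : ∀ y, 0 < y → y ≤ X → |sievedRiesz (insert p U) y - c| ≤ α + β * -Real.log y) :
    ∀ y, 0 < y → y ≤ X → |sievedRiesz U y - c * (p / (p - 1))| ≤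
      p / (p - 1) * (α + β * (Real.log p / (p - 1) - Real.log y)) := by
  have hp1 : (2 : ℝ) ≤ p := by exact_mod_cast hp.two_le
  have hp0 : (0 : ℝ) < p := by linarith
  have hpm : (0 : ℝ) < p - 1 := by linarith
  have hlp : 0 ≤ Real.log p := Real.log_nonneg (by linarith)
  have key : ∀ n : ℕ, ∀ y, 0 < y → y ≤ X → y < 2 ^ n → |sievedRiesz U y - c * (p / (p - 1))| ≤
      p / (p - 1) * (α + β * (Real.log p / (p - 1) - Real.log y)) := by
    intro n
    induction n with
    | zero =>
      intro y hy hyX hy1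
      rw [pow_zero] at hy1
      have h1 := h y hy hyX
      have hins : ∀ q ∈ insert p U, q.Prime := by
        intro q hq
        rcases mem_insert.1 hq with rfl | hq
        exacts [hp, hU q hq]
      rw [sievedRiesz_eq_zero hins hy.le hy1.le] at h1
      rw [sievedRiesz_eq_zero hU hy.le hy1.le]
      rw [zero_sub, abs_neg] at h1 ⊢
      rw [abs_mul, abs_of_pos (by positivity : 0 < (p : ℝ) / (p - 1)), mul_comm]
      refine mul_le_mul_of_nonneg_left (h1.trans ?_) (by positivity)
      have : 0 ≤ β * (Real.log p / (p - 1)) := by positivity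
      linarith
    | succ n ih =>
      intro y hy hyX hyn
      have h1 := h y hy hyX
      have hyp : y / p ≤ y := div_le_self hy.le (by linarith)
      have h2 := ih (y / p) (by positivity) (hyp.trans hyX) (by
        rw [div_lt_iff₀ hp0]
        calc y < 2 ^ n * 2 := by rw [← pow_succ]; exact hyn
          _ ≤ 2 ^ n * p := by gcongr)
      rw [sievedRiesz_insert hpU] at h1
      have e : sievedRiesz U y - c * (p / (p - 1)) =
          (sievedRiesz U y - 1 / p * sievedRiesz U (y / p) - c) +
          1 / p * (sievedRiesz U (y / p) - c * (p / (p - 1))) := by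
        field_simp; ring
      rw [e]
      refine (abs_add_le _ _).trans ?_
      rw [abs_mul, abs_of_pos (by positivity : 0 < 1 / (p : ℝ))]
      refine (add_le_add h1 (mul_le_mul_of_nonneg_left h2 (by positivity))).trans (le_of_eq ?_)
      rw [Real.log_div hy.ne' hp0.ne']
      field_simp
      ring
  intro y hy hyX
  obtain ⟨n, hn⟩ := pow_unbounded_of_one_lt y one_lt_two
  exact key n y hy hyX hn

lemma abs_sievedRiesz_sub_le_of_union {P U : Finset ℕ} (hP : ∀ q ∈ P, q.Prime)
    (hU : ∀ q ∈ U, q.Prime) (hPU : Disjoint P U) {c α β X : ℝ} (hβ : 0 ≤ β)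
    (h : ∀ y, 0 < y → y ≤ X → |sievedRiesz (P ∪ U) y - c| ≤ α + β * -Real.log y) :
    ∀ y, 0 < y → y ≤ X → |sievedRiesz U y - c * sieveFactor P| ≤
      sieveFactor P * (α + β * (sieveShift P - Real.log y)) := by
  induction P using Finset.induction_on generalizing c α β U with
  | empty =>
    intro y hy hyX
    simpa [sieveFactor, sieveShift] using h y hy hyX
  | insert p P hp ih =>
    have hpp : p.Prime := hP p (mem_insert_self _ _)
    have hP' : ∀ q ∈ P, q.Prime := fun q hq => hP q (mem_insert_of_mem hq)
    rw [disjoint_insert_left] at hPU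
    have hins : ∀ q ∈ insert p U, q.Prime := by
      intro q hq
      rcases mem_insert.1 hq with rfl | hq
      exacts [hpp, hU q hq]
    have h1 := ih (U := insert p U) hP' hins (by
      rw [disjoint_insert_right]; exact ⟨hp, hPU.2⟩) hβ (by
      intro y hy hyX
      rw [union_insert, ← insert_union]
      exact h y hy hyX)
    have hF := sieveFactor_pos hP'
    have h2 := abs_sievedRiesz_sub_le_of_insert hpp hU hPU.1 (c := c * sieveFactor P)
      (α := sieveFactor P * (α + β * sieveShift P)) (β := sieveFactor P * β) (X := X)
      (by positivity) (by
        intro y hy hyX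
        refine (h1 y hy hyX).trans (le_of_eq ?_)
        ring)
    intro y hy hyX
    have e1 : sieveFactor (insert p P) = p / (p - 1) * sieveFactor P := prod_insert hp
    have e2 : sieveShift (insert p P) = Real.log p / (p - 1) + sieveShift P := sum_insert hp
    have h3 := h2 y hy hyX
    rw [e1, e2]
    calc _ = |sievedRiesz U y - c * sieveFactor P * (p / (p - 1))| := by ring_nf
      _ ≤ _ := h3
      _ = _ := by ring

lemma abs_sievedRiesz_sdiff_le {R : ℝ} {P : Finset ℕ} (hP : P ⊆ primesLE R) {y : ℝ} (hy : 0 < y)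
    (hyR : y ≤ R) : |sievedRiesz (primesLE R \ P) y| ≤ 4 * sieveFactor P := by
  have := abs_sievedRiesz_sub_le_of_union (P := P) (U := primesLE R \ P) (c := 0) (α := 4) (β := 0)
    (X := R) (fun q hq => prime_of_mem_primesLE (hP hq))
    (fun q hq => prime_of_mem_primesLE (mem_sdiff.1 hq).1) disjoint_sdiff le_rfl
    (by
      intro y hy hyR
      rw [union_sdiff_of_subset hP, sievedRiesz_primesLE hy hyR]
      simpa using abs_mobiusRiesz_le y) y hy hyR
  simpa [mul_comm] using this

lemma abs_sievedRiesz_sdiff_sub_le {η Y : ℝ} (hη : 0 ≤ η) (hY0 : 1 ≤ Y)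
    (hY : ∀ x, Y ≤ x → |mobiusRiesz x - 1| ≤ η) {R : ℝ} {P : Finset ℕ}
    (hP : P ⊆ primesLE R) {z : ℝ} (hz : Y < z) (hzR : z ≤ R) :
    |sievedRiesz (primesLE R \ P) z - sieveFactor P| ≤
      sieveFactor P * (η + 5 / Real.log (z / Y) * sieveShift P) := by
  have hY' : 0 < Y := by linarith
  have hz0 : 0 < z := by linarith
  have hl : 0 < Real.log (z / Y) := Real.log_pos ((one_lt_div hY').2 hz)
  have hlog : Real.log (z / Y) = Real.log z - Real.log Y := Real.log_div hz0.ne' hY'.ne'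
  set κ := 5 / Real.log (z / Y) with hκ
  have hκ0 : 0 < κ := by positivity
  have := abs_sievedRiesz_sub_le_of_union (P := P) (U := primesLE R \ P) (c := 1)
    (α := η + κ * Real.log z) (β := κ)
    (X := z) (fun q hq => prime_of_mem_primesLE (hP hq))
    (fun q hq => prime_of_mem_primesLE (mem_sdiff.1 hq).1) disjoint_sdiff hκ0.le
    (by
      intro y hy hyz
      rw [union_sdiff_of_subset hP, sievedRiesz_primesLE hy (hyz.trans hzR)]
      have hyz' : Real.log y ≤ Real.log z := Real.log_le_log hy hyz
      rcases le_or_gt Y y with h | h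
      · have := hY y h
        nlinarith
      · have h1 : |mobiusRiesz y - 1| ≤ 5 := by
          have := abs_le.1 (abs_mobiusRiesz_le y)
          rw [abs_le]; constructor <;> linarith
        have h2 : Real.log y ≤ Real.log Y := Real.log_le_log hy h.le
        have h3 : κ * Real.log (z / Y) = 5 := by rw [hκ]; field_simp
        rw [hlog] at h3
        nlinarith) z hz0 le_rfl
  rw [one_mul] at this
  refine this.trans (le_of_eq ?_)
  ring

/-- The bilinear sieve sum over pairs of sets of primes. -/
def pairSum (V : Finset ℕ) (x y : ℝ) : ℝ :=
  ∑ A ∈ V.powerset, ∑ B ∈ V.powerset, (-1) ^ #A * (-1) ^ #B *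
    (Real.posLog (x / realProd A) * Real.posLog (y / realProd B)) / realProd (A ∪ B)

lemma realProd_eq_sum_powerset (C : Finset ℕ) :
    realProd C = ∑ E ∈ C.powerset, ∏ p ∈ E, ((p : ℝ) - 1) := by
  rw [← prod_one_add]
  exact prod_congr rfl fun p _ => by ring

lemma sum_superset_eq {V E : Finset ℕ} (hE : E ⊆ V) (x : ℝ) :
    ∑ A ∈ V.powerset with E ⊆ A, (-1) ^ #A / realProd A * Real.posLog (x / realProd A) =
      (-1) ^ #E / realProd E * sievedRiesz (V \ E) (x / realProd E) := by
  rw [sievedRiesz, mul_sum]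
  refine sum_nbij' (fun A => A \ E) (fun A => A ∪ E) ?_ ?_ ?_ ?_ ?_
  · intro A hA
    rw [mem_filter, mem_powerset] at hA
    exact mem_powerset.2 (sdiff_subset_sdiff hA.1 subset_rfl)
  · intro A hA
    rw [mem_powerset] at hA
    rw [mem_filter, mem_powerset]
    exact ⟨union_subset (hA.trans sdiff_subset) hE, subset_union_right⟩
  · intro A hA
    rw [mem_filter] at hA
    exact sdiff_union_of_subset hA.2
  · intro A hA
    rw [mem_powerset] at hA
    exact union_sdiff_cancel_right (disjoint_of_subset_left hA sdiff_disjoint)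
  · intro A hA
    rw [mem_filter] at hA
    have h1 : realProd A = realProd E * realProd (A \ E) := by
      rw [← realProd_union disjoint_sdiff, union_sdiff_of_subset hA.2]
    have h2 : #A = #E + #(A \ E) := by
      rw [← card_union_of_disjoint disjoint_sdiff, union_sdiff_of_subset hA.2]
    rw [h1, h2, div_div, pow_add]
    ring

lemma pairSum_eq {V : Finset ℕ} (hV : ∀ p ∈ V, p.Prime) (x y : ℝ) :
    pairSum V x y = ∑ E ∈ V.powerset, (∏ p ∈ E, ((p : ℝ) - 1) / p ^ 2) *
      (sievedRiesz (V \ E) (x / realProd E) * sievedRiesz (V \ E) (y / realProd E)) := by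
  set f : ℝ → Finset ℕ → ℝ := fun x A =>
    (-1) ^ #A / realProd A * Real.posLog (x / realProd A) with hf
  have h1 : pairSum V x y = ∑ A ∈ V.powerset, ∑ B ∈ V.powerset, ∑ E ∈ V.powerset,
      (∏ p ∈ E, ((p : ℝ) - 1)) * ((if E ⊆ A then f x A else 0) * (if E ⊆ B then f y B else 0)) := by
    refine sum_congr rfl fun A hA => sum_congr rfl fun B hB => ?_
    rw [mem_powerset] at hA hB
    have hA0 := realProd_pos fun p hp => hV p (hA hp)
    have hB0 := realProd_pos fun p hp => hV p (hB hp)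
    have hU0 := realProd_pos (A := A ∪ B) fun p hp => by
      rcases mem_union.1 hp with h | h
      exacts [hV p (hA h), hV p (hB h)]
    have hm : realProd (A ∪ B) * realProd (A ∩ B) = realProd A * realProd B := prod_union_inter
    have e1 : (-1) ^ #A * (-1) ^ #B *
        (Real.posLog (x / realProd A) * Real.posLog (y / realProd B)) /
        realProd (A ∪ B) = realProd (A ∩ B) * (f x A * f y B) := by
      simp only [hf]
      rw [div_eq_iff hU0.ne']
      have : realProd (A ∩ B) * ((-1) ^ #A / realProd A * Real.posLog (x / realProd A) *
          ((-1) ^ #B / realProd B * Real.posLog (y / realProd B))) * realProd (A ∪ B) =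
          (realProd (A ∪ B) * realProd (A ∩ B)) * ((-1) ^ #A / realProd A *
          Real.posLog (x / realProd A) *
            ((-1) ^ #B / realProd B * Real.posLog (y / realProd B))) := by
        ring
      rw [this, hm]
      field_simp
    rw [e1, realProd_eq_sum_powerset, sum_mul]
    rw [← sum_subset (powerset_mono.2 (inter_subset_left.trans hA) : (A ∩ B).powerset ⊆ V.powerset)]
    · refine sum_congr rfl fun E hE => ?_
      rw [mem_powerset, subset_inter_iff] at hE
      rw [if_pos hE.1, if_pos hE.2]
    · intro E _ hE
      rw [mem_powerset, subset_inter_iff, not_and_or] at hE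
      rcases hE with h | h <;> simp [h]
  rw [h1]
  have h2 : ∀ A ∈ V.powerset, ∑ B ∈ V.powerset, ∑ E ∈ V.powerset,
      (∏ p ∈ E, ((p : ℝ) - 1)) * ((if E ⊆ A then f x A else 0) * (if E ⊆ B then f y B else 0)) =
      ∑ E ∈ V.powerset, (∏ p ∈ E, ((p : ℝ) - 1)) * (if E ⊆ A then f x A else 0) *
        ∑ B ∈ V.powerset, (if E ⊆ B then f y B else 0) := by
    intro A _
    rw [sum_comm]
    refine sum_congr rfl fun E _ => ?_
    rw [mul_sum]
    exact sum_congr rfl fun B _ => by ring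
  rw [sum_congr rfl h2, sum_comm]
  refine sum_congr rfl fun E hE => ?_
  rw [mem_powerset] at hE
  have hE0 := realProd_pos fun p hp => hV p (hE hp)
  have h3 : ∀ x, ∑ A ∈ V.powerset, (if E ⊆ A then f x A else 0) =
      (-1) ^ #E / realProd E * sievedRiesz (V \ E) (x / realProd E) := by
    intro x
    rw [← sum_filter]; exact sum_superset_eq hE x
  rw [← sum_mul, ← mul_sum, h3, h3, prod_div_distrib, prod_pow]
  change _ = _ / realProd E ^ 2 * _
  have : ((-1 : ℝ) ^ #E) * (-1) ^ #E = 1 := by rw [← mul_pow]; simp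
  field_simp
  linear_combination (∏ p ∈ E, ((p : ℝ) - 1)) * sievedRiesz (V \ E) (x / realProd E) *
    sievedRiesz (V \ E) (y / realProd E) * this

/-- `∑ 1/φ(d)` over products `d ≤ z` of primes in `V`. -/
def totientSum (V : Finset ℕ) (z : ℝ) : ℝ :=
  ∑ E ∈ V.powerset with realProd E ≤ z, ∏ p ∈ E, 1 / ((p : ℝ) - 1)

lemma prod_inv_sub_one_nonneg {E : Finset ℕ} (hE : ∀ p ∈ E, p.Prime) :
    0 ≤ ∏ p ∈ E, 1 / ((p : ℝ) - 1) := by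
  refine prod_nonneg fun p hp => ?_
  have : (1 : ℝ) < p := by exact_mod_cast (hE p hp).one_lt
  exact div_nonneg zero_le_one (by linarith)

lemma totientSum_mono {V V' : Finset ℕ} (hV : ∀ p ∈ V', p.Prime) (h : V ⊆ V') (z : ℝ) :
    totientSum V z ≤ totientSum V' z := by
  refine sum_le_sum_of_subset_of_nonneg (filter_subset_filter _ (powerset_mono.2 h)) ?_
  intro E hE _
  exact prod_inv_sub_one_nonneg fun p hp => hV p (mem_powerset.1 (mem_filter.1 hE).1 hp)

lemma prod_local_mul_sieveFactor_sq {E : Finset ℕ} (hE : ∀ p ∈ E, p.Prime) :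
    (∏ p ∈ E, ((p : ℝ) - 1) / p ^ 2) * sieveFactor E ^ 2 = ∏ p ∈ E, 1 / ((p : ℝ) - 1) := by
  rw [sieveFactor, ← prod_pow, ← prod_mul_distrib]
  refine prod_congr rfl fun p hp => ?_
  have : (1 : ℝ) < p := by exact_mod_cast (hE p hp).one_lt
  have h1 : (p : ℝ) - 1 ≠ 0 := by linarith
  have h2 : (p : ℝ) ≠ 0 := by linarith
  field_simp

lemma prod_local_nonneg {E : Finset ℕ} (hE : ∀ p ∈ E, p.Prime) :
    0 ≤ ∏ p ∈ E, ((p : ℝ) - 1) / p ^ 2 := by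
  refine prod_nonneg fun p hp => ?_
  have : (1 : ℝ) < p := by exact_mod_cast (hE p hp).one_lt
  exact div_nonneg (by linarith) (by positivity)

lemma abs_pairSum_le {R : ℝ} {P : Finset ℕ} (hP : P ⊆ primesLE R) {x y : ℝ} (hx : 0 < x)
    (hxR : x ≤ R) (hy : 0 < y) (hyR : y ≤ R) :
    |pairSum (primesLE R \ P) x y| ≤
      16 * sieveFactor P ^ 2 * totientSum (primesLE R \ P) R := by
  have hV : ∀ p ∈ primesLE R \ P, p.Prime := fun p hp => prime_of_mem_primesLE (mem_sdiff.1 hp).1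
  have hPp : ∀ p ∈ P, p.Prime := fun p hp => prime_of_mem_primesLE (hP hp)
  rw [pairSum_eq hV, totientSum, sum_filter, mul_sum]
  refine (abs_sum_le_sum_abs _ _).trans (sum_le_sum fun E hE => ?_)
  rw [mem_powerset] at hE
  have hEp : ∀ p ∈ E, p.Prime := fun p hp => hV p (hE hp)
  have hE1 := one_le_realProd hEp
  have hE0 := realProd_pos hEp
  have hc := prod_local_nonneg hEp
  rw [abs_mul, abs_mul, abs_of_nonneg hc]
  split_ifs with h
  · have hPE : P ∪ E ⊆ primesLE R := union_subset hP (hE.trans sdiff_subset)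
    have hd : Disjoint P E := (disjoint_of_subset_left hE sdiff_disjoint).symm
    have hG : ∀ z, 0 < z → z ≤ R → |sievedRiesz ((primesLE R \ P) \ E) (z / realProd E)| ≤
        4 * (sieveFactor P * sieveFactor E) := by
      intro z hz hzR
      rw [sdiff_sdiff_left, ← sieveFactor_union hd]
      exact abs_sievedRiesz_sdiff_le hPE (by positivity) ((div_le_self hz.le hE1).trans hzR)
    have hP0 := sieveFactor_pos hPp
    have hE0' := sieveFactor_pos hEp
    rw [← prod_local_mul_sieveFactor_sq hEp]
    calc _ ≤ (∏ p ∈ E, ((p : ℝ) - 1) / p ^ 2) * ((4 * (sieveFactor P * sieveFactor E)) *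
          (4 * (sieveFactor P * sieveFactor E))) :=
          mul_le_mul_of_nonneg_left (mul_le_mul (hG x hx hxR) (hG y hy hyR) (abs_nonneg _)
            (by positivity)) hc
      _ = _ := by ring
  · have : x / realProd E ≤ 1 :=
      div_le_one_of_le₀ (hxR.trans (not_le.1 h).le) hE0.le
    rw [sievedRiesz_eq_zero (fun p hp => hV p (mem_sdiff.1 hp).1) (by positivity) this]
    simp

lemma abs_pairSum_sub_le {R : ℝ} (hR : 1 ≤ R) {P : Finset ℕ} (hP : P ⊆ primesLE R) {R₁ θ : ℝ}
    (hR₁ : R₁ ≤ R) (hθ1 : θ ≤ 1)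
    (h : ∀ E ⊆ primesLE R \ P, realProd E ≤ R₁ →
      |sievedRiesz (primesLE R \ (P ∪ E)) (R / realProd E) - sieveFactor (P ∪ E)| ≤
        sieveFactor (P ∪ E) * θ) :
    |pairSum (primesLE R \ P) R R - sieveFactor P ^ 2 * totientSum (primesLE R \ P) R| ≤
      sieveFactor P ^ 2 * (3 * θ * totientSum (primesLE R \ P) R₁ +
        17 * (totientSum (primesLE R \ P) R - totientSum (primesLE R \ P) R₁)) := by
  have hV : ∀ p ∈ primesLE R \ P, p.Prime := fun p hp => prime_of_mem_primesLE (mem_sdiff.1 hp).1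
  have hPp : ∀ p ∈ P, p.Prime := fun p hp => prime_of_mem_primesLE (hP hp)
  have hP0 := sieveFactor_pos hPp
  have hR0 : 0 < R := by linarith
  rw [pairSum_eq hV]
  simp only [totientSum, sum_filter]
  rw [mul_sum, ← sum_sub_distrib, ← sum_sub_distrib, mul_sum, mul_sum, ← sum_add_distrib, mul_sum]
  refine (abs_sum_le_sum_abs _ _).trans (sum_le_sum fun E hE => ?_)
  rw [mem_powerset] at hE
  have hEp : ∀ p ∈ E, p.Prime := fun p hp => hV p (hE hp)
  have hE1 := one_le_realProd hEp
  have hE0 := realProd_pos hEp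
  have hc := prod_local_nonneg hEp
  have hPE : P ∪ E ⊆ primesLE R := union_subset hP (hE.trans sdiff_subset)
  have hd : Disjoint P E := (disjoint_of_subset_left hE sdiff_disjoint).symm
  have hFE := sieveFactor_pos hEp
  rw [sdiff_sdiff_left, sup_eq_union]
  set g := sievedRiesz (primesLE R \ (P ∪ E)) (R / realProd E) with hg
  set c := ∏ p ∈ E, ((p : ℝ) - 1) / p ^ 2 with hcdef
  set r := sieveFactor (P ∪ E) with hr
  have hr' : r = sieveFactor P * sieveFactor E := sieveFactor_union hd
  have hr0 : 0 < r := by rw [hr']; positivity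
  rw [← prod_local_mul_sieveFactor_sq hEp, ← hcdef]
  have e : sieveFactor P ^ 2 * (c * sieveFactor E ^ 2) = c * r ^ 2 := by rw [hr']; ring
  by_cases h1 : realProd E ≤ R
  · rw [if_pos h1]
    by_cases h2 : realProd E ≤ R₁
    · rw [if_pos h2, e]
      have h3 := h E hE h2
      rw [← hg] at h3
      have hθ0 : 0 ≤ θ := by
        by_contra hc
        have := abs_nonneg (g - r)
        nlinarith
      have h4 : |g * g - r ^ 2| ≤ 3 * θ * r ^ 2 := by
        have : g * g - r ^ 2 = (g - r) * (g - r) + 2 * r * (g - r) := by ring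
        rw [this]
        refine (abs_add_le _ _).trans ?_
        rw [abs_mul, abs_mul, abs_of_pos (by positivity : 0 < 2 * r)]
        have h5 : |g - r| * |g - r| ≤ (r * θ) * (r * θ) :=
          mul_le_mul h3 h3 (abs_nonneg _) (by positivity)
        have h6 : 2 * r * |g - r| ≤ 2 * r * (r * θ) := by gcongr
        have h7 : θ * θ ≤ θ := mul_le_of_le_one_left hθ0 hθ1
        nlinarith [sq_nonneg r]
      rw [← mul_sub, abs_mul, abs_of_nonneg hc]
      calc _ ≤ c * (3 * θ * r ^ 2) := mul_le_mul_of_nonneg_left h4 hc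
        _ = 3 * θ * (c * r ^ 2) := by ring
        _ = _ := by rw [← e]; ring
    · rw [if_neg h2, e]
      have h3 : |g| ≤ 4 * r := abs_sievedRiesz_sdiff_le hPE (by positivity) (div_le_self hR0.le hE1)
      have h4 : |g * g - r ^ 2| ≤ 17 * r ^ 2 := by
        refine (abs_sub _ _).trans ?_
        rw [abs_mul, abs_of_nonneg (sq_nonneg r)]
        nlinarith [abs_nonneg g]
      rw [← mul_sub, abs_mul, abs_of_nonneg hc]
      calc _ ≤ c * (17 * r ^ 2) := mul_le_mul_of_nonneg_left h4 hc
        _ = 17 * (c * r ^ 2) := by ring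
        _ = _ := by rw [← e]; ring
  · have h2 : ¬ realProd E ≤ R₁ := fun h => h1 (h.trans hR₁)
    have h3 : g = 0 := sievedRiesz_eq_zero (fun p hp => prime_of_mem_primesLE (mem_sdiff.1 hp).1)
      (by positivity) (div_le_one_of_le₀ (not_le.1 h1).le hE0.le)
    rw [if_neg h1, if_neg h2, h3]
    simp

/-- The harmonic sum over integers up to `z` all of whose prime factors lie in `V`. -/
def smoothHarmonic (V : Finset ℕ) (z : ℝ) : ℝ :=
  ∑ k ∈ Ioc 0 ⌊z⌋₊ with k.primeFactors ⊆ V, 1 / (k : ℝ)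

lemma smoothHarmonic_mono {V V' : Finset ℕ} (h : V ⊆ V') {z z' : ℝ} (hz : z ≤ z') :
    smoothHarmonic V z ≤ smoothHarmonic V' z' := by
  refine sum_le_sum_of_subset_of_nonneg ?_ fun _ _ _ => by positivity
  intro k hk
  rw [mem_filter] at hk ⊢
  exact ⟨Ioc_subset_Ioc_right (Nat.floor_mono hz) hk.1, hk.2.trans h⟩

lemma smoothHarmonic_of_lt_one (V : Finset ℕ) {z : ℝ} (hz : z < 1) : smoothHarmonic V z = 0 := by
  rw [smoothHarmonic, Nat.floor_eq_zero.2 hz]; simp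

lemma smoothHarmonic_insert {p : ℕ} (hp : p.Prime) {V : Finset ℕ} (hpV : p ∉ V) (z : ℝ) :
    smoothHarmonic (insert p V) z =
      smoothHarmonic V z + 1 / p * smoothHarmonic (insert p V) (z / p) := by
  rw [smoothHarmonic, ← sum_filter_add_sum_filter_not _ (fun k => ¬ p ∣ k)]
  congr 1
  · refine sum_congr ?_ fun _ _ => rfl
    ext k
    simp only [mem_filter, mem_Ioc]
    constructor
    · rintro ⟨⟨hk, hs⟩, hpk⟩
      refine ⟨hk, fun q hq => ?_⟩
      rcases mem_insert.1 (hs hq) with rfl | h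
      · exact absurd (Nat.dvd_of_mem_primeFactors hq) hpk
      · exact h
    · rintro ⟨hk, hs⟩
      refine ⟨⟨hk, hs.trans (subset_insert _ _)⟩, fun hpk => hpV (hs ?_)⟩
      exact Nat.mem_primeFactors.2 ⟨hp, hpk, by omega⟩
  · rw [smoothHarmonic, mul_sum]
    symm
    refine sum_nbij (fun k => p * k) ?_ ?_ ?_ ?_
    · intro k hk
      rw [mem_filter, mem_Ioc, Nat.floor_div_natCast] at hk
      simp only [mem_filter, mem_Ioc, not_not]
      refine ⟨⟨⟨Nat.mul_pos hp.pos hk.1.1, ?_⟩, ?_⟩, dvd_mul_right _ _⟩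
      · rw [mul_comm]; exact (Nat.le_div_iff_mul_le hp.pos).1 hk.1.2
      · rw [Nat.primeFactors_mul hp.ne_zero (by omega), hp.primeFactors]
        exact union_subset (by simp) hk.2
    · intro a _ b _ hab
      exact Nat.eq_of_mul_eq_mul_left hp.pos hab
    · intro k hk
      simp only [coe_filter, Set.mem_ofPred_eq, mem_filter, mem_Ioc, not_not] at hk
      obtain ⟨⟨⟨h0, h1⟩, h2⟩, ⟨c, rfl⟩⟩ := hk
      have hc : c ≠ 0 := by rintro rfl; simp at h0
      refine ⟨c, ?_, rfl⟩
      simp only [coe_filter, Set.mem_ofPred_eq, mem_Ioc, Nat.floor_div_natCast]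
      refine ⟨⟨Nat.pos_of_ne_zero hc, (Nat.le_div_iff_mul_le hp.pos).2 (by rwa [mul_comm])⟩, ?_⟩
      rw [Nat.primeFactors_mul hp.ne_zero hc] at h2
      exact subset_union_right.trans h2
    · intro k _
      push_cast
      rw [one_div_mul_one_div]

lemma totientSum_insert {p : ℕ} (hp : p.Prime) {V : Finset ℕ} (hpV : p ∉ V) (z : ℝ) :
    totientSum (insert p V) z = totientSum V z + 1 / (p - 1) * totientSum V (z / p) := by
  have hp0 : (0 : ℝ) < p := by exact_mod_cast hp.pos
  simp only [totientSum, sum_filter]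
  rw [sum_powerset_insert hpV, mul_sum]
  congr 1
  refine sum_congr rfl fun E hE => ?_
  have hpE : p ∉ E := fun h => hpV (mem_powerset.1 hE h)
  rw [realProd_insert hpE, prod_insert hpE]
  simp only [le_div_iff₀ hp0, mul_comm (p : ℝ)]
  split_ifs <;> simp

lemma smoothHarmonic_empty {z : ℝ} (hz : 1 ≤ z) : smoothHarmonic ∅ z = 1 := by
  have : (Ioc 0 ⌊z⌋₊).filter (fun k => k.primeFactors ⊆ ∅) = {1} := by
    ext k
    simp only [mem_filter, mem_Ioc, subset_empty, Nat.primeFactors_eq_empty, mem_singleton]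
    constructor
    · rintro ⟨h1, h2⟩; omega
    · rintro rfl
      exact ⟨⟨one_pos, Nat.le_floor (by simpa using hz)⟩, Or.inr rfl⟩
  rw [smoothHarmonic, this]; simp

lemma totientSum_empty {z : ℝ} (hz : 1 ≤ z) : totientSum ∅ z = 1 := by
  simp [totientSum, sum_filter, realProd_empty, hz]

lemma totientSum_of_lt_one {V : Finset ℕ} (hV : ∀ p ∈ V, p.Prime) {z : ℝ} (hz : z < 1) :
    totientSum V z = 0 := by
  rw [totientSum, sum_filter]
  refine sum_eq_zero fun E hE => if_neg ?_
  have := one_le_realProd fun p hp => hV p (mem_powerset.1 hE hp)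
  linarith

lemma totientSum_empty_eq (z : ℝ) : totientSum ∅ z = smoothHarmonic ∅ z := by
  rcases le_or_gt 1 z with h | h
  · rw [totientSum_empty h, smoothHarmonic_empty h]
  · rw [totientSum_of_lt_one (by simp) h, smoothHarmonic_of_lt_one _ h]

lemma smoothHarmonic_insert_le {p : ℕ} (hp : p.Prime) {V : Finset ℕ} (hpV : p ∉ V) (z : ℝ) :
    smoothHarmonic (insert p V) z ≤ p / (p - 1) * smoothHarmonic V z := by
  have hp1 : (2 : ℝ) ≤ p := by exact_mod_cast hp.two_le
  have hp0 : (0 : ℝ) < p := by linarith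
  have hpm : (0 : ℝ) < p - 1 := by linarith
  have key : ∀ n : ℕ, ∀ z : ℝ, z < 2 ^ n →
      smoothHarmonic (insert p V) z ≤ p / (p - 1) * smoothHarmonic V z := by
    intro n
    induction n with
    | zero =>
      intro z hz
      rw [pow_zero] at hz
      rw [smoothHarmonic_of_lt_one _ hz, smoothHarmonic_of_lt_one _ hz, mul_zero]
    | succ n ih =>
      intro z hz
      rcases lt_or_ge z 1 with h1 | h1
      · rw [smoothHarmonic_of_lt_one _ h1, smoothHarmonic_of_lt_one _ h1, mul_zero]
      rw [smoothHarmonic_insert hp hpV]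
      have h2 := ih (z / p) (by
        rw [div_lt_iff₀ hp0]
        calc z < 2 ^ n * 2 := by rw [← pow_succ]; exact hz
          _ ≤ 2 ^ n * p := by gcongr)
      have h3 : smoothHarmonic V (z / p) ≤ smoothHarmonic V z :=
        smoothHarmonic_mono subset_rfl (div_le_self (by linarith) (by linarith))
      have h4 : smoothHarmonic (insert p V) (z / p) ≤ p / (p - 1) * smoothHarmonic V z :=
        h2.trans (by gcongr)
      calc _ ≤ smoothHarmonic V z + 1 / p * (p / (p - 1) * smoothHarmonic V z) := by gcongr
        _ = _ := by field_simp; ring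
  obtain ⟨n, hn⟩ := pow_unbounded_of_one_lt z one_lt_two
  exact key n z hn

lemma smoothHarmonic_le_totientSum {V : Finset ℕ} (hV : ∀ p ∈ V, p.Prime) (z : ℝ) :
    smoothHarmonic V z ≤ totientSum V z := by
  induction V using Finset.induction_on generalizing z with
  | empty => rw [totientSum_empty_eq]
  | insert p V hpV ih =>
    have hp := hV p (mem_insert_self _ _)
    have ih := ih fun q hq => hV q (mem_insert_of_mem hq)
    have hp1 : (2 : ℝ) ≤ p := by exact_mod_cast hp.two_le
    have hpm : (0 : ℝ) < p - 1 := by linarith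
    rw [totientSum_insert hp hpV, smoothHarmonic_insert hp hpV]
    refine add_le_add (ih z) ?_
    calc 1 / (p : ℝ) * smoothHarmonic (insert p V) (z / p) ≤
          1 / p * (p / (p - 1) * smoothHarmonic V (z / p)) := by
          gcongr; exact smoothHarmonic_insert_le hp hpV _
      _ = 1 / (p - 1) * smoothHarmonic V (z / p) := by field_simp
      _ ≤ _ := by gcongr; exact ih _

lemma totientSum_le_smoothHarmonic {V : Finset ℕ} (hV : ∀ p ∈ V, p.Prime) {z : ℝ} (hz : 0 ≤ z) :
    totientSum V z ≤ (∏ p ∈ V, (1 + 1 / ((p : ℝ) * (p - 1)))) * smoothHarmonic V z := by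
  induction V using Finset.induction_on generalizing z with
  | empty => rw [totientSum_empty_eq]; simp
  | insert p V hpV ih =>
    have hp := hV p (mem_insert_self _ _)
    have hV' : ∀ q ∈ V, q.Prime := fun q hq => hV q (mem_insert_of_mem hq)
    have ih := @ih hV'
    have hp1 : (2 : ℝ) ≤ p := by exact_mod_cast hp.two_le
    have hpm : (0 : ℝ) < p - 1 := by linarith
    have hC : 0 ≤ ∏ p ∈ V, (1 + 1 / ((p : ℝ) * (p - 1))) := by
      refine prod_nonneg fun q hq => ?_
      have h1 : (1 : ℝ) < q := by exact_mod_cast (hV' q hq).one_lt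
      have : (0 : ℝ) < q - 1 := by linarith
      positivity
    rw [prod_insert hpV, totientSum_insert hp hpV]
    set C := ∏ p ∈ V, (1 + 1 / ((p : ℝ) * (p - 1)))
    have h1 := ih hz
    have h2 := ih (z := z / p) (by positivity)
    have hzp : z / p ≤ z := div_le_self hz (by linarith)
    have h3 : smoothHarmonic V (z / p) ≤ smoothHarmonic (insert p V) z :=
      smoothHarmonic_mono (subset_insert _ _) hzp
    have h4 : smoothHarmonic V (z / p) ≤ smoothHarmonic (insert p V) (z / p) :=
      smoothHarmonic_mono (subset_insert _ _) le_rfl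
    calc totientSum V z + 1 / ((p : ℝ) - 1) * totientSum V (z / p)
        ≤ C * smoothHarmonic V z + 1 / ((p : ℝ) - 1) * (C * smoothHarmonic V (z / p)) := by gcongr
      _ = C * (smoothHarmonic V z + 1 / p * smoothHarmonic V (z / p) +
            1 / (p * (p - 1)) * smoothHarmonic V (z / p)) := by field_simp; ring
      _ ≤ C * (smoothHarmonic V z + 1 / p * smoothHarmonic (insert p V) (z / p) +
            1 / (p * (p - 1)) * smoothHarmonic (insert p V) z) := by gcongr
      _ = C * (smoothHarmonic (insert p V) z +
            1 / (p * (p - 1)) * smoothHarmonic (insert p V) z) := by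
          rw [← smoothHarmonic_insert hp hpV]
      _ = _ := by ring

lemma sum_inv_mul_sub_one_le {w : ℕ} (hw : 1 ≤ w) {V : Finset ℕ} (hV : ∀ p ∈ V, w < p) :
    ∑ p ∈ V, 1 / ((p : ℝ) * (p - 1)) ≤ 1 / w := by
  have h1 : ∀ n : ℕ, ∑ k ∈ Ioc w (w + n), 1 / ((k : ℝ) * (k - 1)) = 1 / w - 1 / (w + n : ℕ) := by
    intro n
    induction n with
    | zero => simp
    | succ n ih =>
      rw [← add_assoc, ← insert_Ioc_right_eq_Ioc_add_one (by omega), sum_insert (by simp), ih]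
      have : (0 : ℝ) < w := by exact_mod_cast hw
      push_cast
      have : (0 : ℝ) < w + n := by positivity
      have : (0 : ℝ) < w + n + 1 := by positivity
      rw [add_sub_cancel_right]
      field_simp
      ring
  have hsub : V ⊆ Ioc w (w + V.sup id) := by
    intro p hp
    rw [mem_Ioc]
    have : p ≤ V.sup id := le_sup (f := id) hp
    exact ⟨hV p hp, by omega⟩
  refine (sum_le_sum_of_subset_of_nonneg hsub ?_).trans ?_
  · intro k hk _
    have : (1 : ℝ) ≤ k := by
      have := (mem_Ioc.1 hk).1
      exact_mod_cast (by omega : 1 ≤ k)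
    have : (0 : ℝ) ≤ k - 1 := by linarith
    positivity
  · rw [h1]
    have : (0 : ℝ) ≤ 1 / (w + V.sup id : ℕ) := by positivity
    linarith

lemma prod_one_add_le_exp {w : ℕ} (hw : 1 ≤ w) {V : Finset ℕ} (hV : ∀ p ∈ V, w < p) {C : ℝ}
    (hC : 0 ≤ C) :
    ∏ p ∈ V, (1 + C * (1 / ((p : ℝ) * (p - 1)))) ≤ Real.exp (C / w) := by
  calc _ ≤ ∏ p ∈ V, Real.exp (C * (1 / ((p : ℝ) * (p - 1)))) := by
        refine prod_le_prod (fun p hp => ?_) fun p hp => ?_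
        · have : (1 : ℝ) ≤ p := by
            have := hV p hp
            exact_mod_cast (by omega : 1 ≤ p)
          have : (0 : ℝ) ≤ p - 1 := by linarith
          positivity
        · rw [add_comm]; exact Real.add_one_le_exp _
    _ = Real.exp (C * ∑ p ∈ V, 1 / ((p : ℝ) * (p - 1))) := by rw [← Real.exp_sum, mul_sum]
    _ ≤ _ := by
        refine Real.exp_le_exp.2 ?_
        rw [div_eq_mul_one_div]
        exact mul_le_mul_of_nonneg_left (sum_inv_mul_sub_one_le hw hV) hC

lemma sum_coprime_Ico_le {W n : ℕ} (hn : 0 < n) :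
    ∑ k ∈ Ico n (n + W) with W.Coprime k, 1 / (k : ℝ) ≤ W.totient / n := by
  have : ∀ k ∈ (Ico n (n + W)).filter (fun k => W.Coprime k), 1 / (k : ℝ) ≤ 1 / n := by
    intro k hk
    have := (mem_Ico.1 (mem_filter.1 hk).1).1
    have h0 : (0 : ℝ) < n := by exact_mod_cast hn
    exact one_div_le_one_div_of_le h0 (by exact_mod_cast this)
  refine (sum_le_card_nsmul _ _ _ this).trans (le_of_eq ?_)
  rw [Nat.filter_coprime_Ico_eq_totient, nsmul_eq_mul]; ring

lemma le_sum_coprime_Ico {W n : ℕ} (h1 : n = 0 → W.Coprime 0 → False) :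
    (W.totient : ℝ) / (n + W : ℕ) ≤ ∑ k ∈ Ico n (n + W) with W.Coprime k, 1 / (k : ℝ) := by
  have : ∀ k ∈ (Ico n (n + W)).filter (fun k => W.Coprime k), 1 / ((n + W : ℕ) : ℝ) ≤ 1 / k := by
    intro k hk
    rw [mem_filter, mem_Ico] at hk
    have h0 : 0 < k := by
      rcases Nat.eq_zero_or_pos k with rfl | h
      · exact (h1 (by omega) hk.2).elim
      · exact h
    have h0' : (0 : ℝ) < k := by exact_mod_cast h0
    exact one_div_le_one_div_of_le h0' (by exact_mod_cast hk.1.2.le)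
  refine le_trans (le_of_eq ?_) (card_nsmul_le_sum _ _ _ this)
  rw [Nat.filter_coprime_Ico_eq_totient, nsmul_eq_mul]; ring

lemma sum_coprime_range_le {W : ℕ} (hW : 1 ≤ W) (J : ℕ) :
    ∑ k ∈ range ((J + 1) * W) with W.Coprime k, 1 / (k : ℝ) ≤
      1 + Real.log W + W.totient / W * harmonic J := by
  have hW0 : (0 : ℝ) < W := by exact_mod_cast hW
  induction J with
  | zero =>
    simp only [zero_add, one_mul, harmonic_zero, Rat.cast_zero, mul_zero, add_zero]
    have h1 : ∑ k ∈ range W with W.Coprime k, 1 / (k : ℝ) ≤ ∑ k ∈ range (W + 1), 1 / (k : ℝ) := by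
      refine sum_le_sum_of_subset_of_nonneg ?_ fun _ _ _ => by positivity
      exact (filter_subset _ _).trans (range_mono (by omega))
    have h2 : ∑ k ∈ range (W + 1), 1 / (k : ℝ) = ((harmonic W : ℚ) : ℝ) := by
      rw [sum_range_succ', harmonic]; push_cast; simp
    rw [h2] at h1
    exact h1.trans (harmonic_le_one_add_log W)
  | succ J ih =>
    have e : range ((J + 1 + 1) * W) =
        range ((J + 1) * W) ∪ Ico ((J + 1) * W) ((J + 1) * W + W) := by
      ext k; simp only [mem_range, mem_union, mem_Ico]
      have : (J + 1 + 1) * W = (J + 1) * W + W := by ring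
      omega
    rw [e, filter_union, sum_union]
    · have h1 := sum_coprime_Ico_le (W := W) (n := (J + 1) * W) (by positivity)
      rw [harmonic_succ]
      push_cast at h1 ⊢
      have : (W.totient : ℝ) / W * (harmonic J + ((J : ℝ) + 1)⁻¹) =
          W.totient / W * harmonic J + W.totient / ((J + 1) * W) := by
        field_simp
      rw [this]
      linarith
    · refine disjoint_filter_filter ?_
      rw [disjoint_left]
      intro k h1 h2
      rw [mem_range] at h1; rw [mem_Ico] at h2; omega

lemma le_sum_coprime_range {W : ℕ} (hW : 2 ≤ W) (J : ℕ) :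
    W.totient / W * (harmonic J : ℝ) ≤ ∑ k ∈ range (J * W) with W.Coprime k, 1 / (k : ℝ) := by
  have hW0 : (0 : ℝ) < W := by exact_mod_cast (by omega : 0 < W)
  induction J with
  | zero => simp
  | succ J ih =>
    have e : range ((J + 1) * W) = range (J * W) ∪ Ico (J * W) (J * W + W) := by
      ext k; simp only [mem_range, mem_union, mem_Ico]
      have : (J + 1) * W = J * W + W := by ring
      omega
    rw [e, filter_union, sum_union]
    · have h1 := le_sum_coprime_Ico (W := W) (n := J * W) (by
        intro _ h; rw [Nat.coprime_zero_right] at h; omega)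
      rw [harmonic_succ]
      push_cast at h1 ⊢
      have : (W.totient : ℝ) / W * (harmonic J + ((J : ℝ) + 1)⁻¹) =
          W.totient / W * harmonic J + W.totient / (J * W + W) := by
        field_simp
      rw [this]
      linarith
    · refine disjoint_filter_filter ?_
      rw [disjoint_left]
      intro k h1 h2
      rw [mem_range] at h1; rw [mem_Ico] at h2; omega

lemma sum_coprime_le_log {W : ℕ} (hW : 1 ≤ W) {z : ℝ} (hz : 1 ≤ z) :
    ∑ k ∈ Ioc 0 ⌊z⌋₊ with W.Coprime k, 1 / (k : ℝ) ≤
      1 + Real.log W + W.totient / W * (1 + Real.log z) := by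
  have hz1 : 1 ≤ ⌊z⌋₊ := Nat.le_floor (by simpa using hz)
  have h1 := sum_coprime_range_le hW ⌊z⌋₊
  have h2 : (harmonic ⌊z⌋₊ : ℝ) ≤ 1 + Real.log z :=
    (harmonic_le_one_add_log _).trans (by
      gcongr
      exact Nat.floor_le (by linarith))
  have h3 : ∑ k ∈ Ioc 0 ⌊z⌋₊ with W.Coprime k, 1 / (k : ℝ) ≤
      ∑ k ∈ range ((⌊z⌋₊ + 1) * W) with W.Coprime k, 1 / (k : ℝ) := by
    refine sum_le_sum_of_subset_of_nonneg (filter_subset_filter _ ?_) fun _ _ _ => by positivity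
    intro k hk
    rw [mem_Ioc] at hk; rw [mem_range]
    nlinarith
  refine h3.trans (h1.trans ?_)
  gcongr

lemma log_le_sum_coprime {W : ℕ} (hW : 2 ≤ W) {z : ℝ} (hz : 0 < z) :
    W.totient / W * (Real.log z - Real.log W) ≤
      ∑ k ∈ Ioc 0 ⌊z⌋₊ with W.Coprime k, 1 / (k : ℝ) := by
  have hW0 : (0 : ℝ) < W := by exact_mod_cast (by omega : 0 < W)
  have h1 := le_sum_coprime_range hW (⌊z / W⌋₊)
  have h2 : Real.log z - Real.log W ≤ (harmonic ⌊z / W⌋₊ : ℝ) := by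
    rw [← Real.log_div hz.ne' hW0.ne']
    refine le_trans ?_ (log_add_one_le_harmonic _)
    refine Real.log_le_log (by positivity) ?_
    push_cast
    exact (Nat.lt_floor_add_one _).le
  have h3 : ∑ k ∈ range (⌊z / W⌋₊ * W) with W.Coprime k, 1 / (k : ℝ) ≤
      ∑ k ∈ Ioc 0 ⌊z⌋₊ with W.Coprime k, 1 / (k : ℝ) := by
    refine sum_le_sum_of_subset_of_nonneg ?_ fun _ _ _ => by positivity
    intro k hk
    rw [mem_filter, mem_range] at hk
    rw [mem_filter, mem_Ioc]
    refine ⟨⟨?_, ?_⟩, hk.2⟩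
    · rcases Nat.eq_zero_or_pos k with rfl | h
      · have := hk.2; rw [Nat.coprime_zero_right] at this; omega
      · exact h
    · refine Nat.le_floor ?_
      have h4 : (k : ℝ) ≤ (⌊z / W⌋₊ * W : ℕ) := by exact_mod_cast hk.1.le
      refine h4.trans ?_
      push_cast
      calc _ ≤ z / W * W := by gcongr; exact Nat.floor_le (by positivity)
        _ = z := by field_simp
  refine le_trans ?_ (h1.trans h3)
  gcongr

/-- The primes not exceeding `w`. -/
def smallPrimes (w : ℕ) : Finset ℕ := (range (w + 1)).filter Nat.Prime

lemma prime_of_mem_smallPrimes {w p : ℕ} (h : p ∈ smallPrimes w) : p.Prime := (mem_filter.1 h).2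

lemma mem_smallPrimes {w p : ℕ} (hp : p.Prime) : p ∈ smallPrimes w ↔ p ≤ w := by
  simp [smallPrimes, hp]

/-- The product of the primes not exceeding `w`. -/
def smallPrimorial (w : ℕ) : ℕ := ∏ p ∈ smallPrimes w, p

lemma smallPrimorial_pos (w : ℕ) : 0 < smallPrimorial w :=
  prod_pos fun _ hp => (prime_of_mem_smallPrimes hp).pos

lemma primeFactors_smallPrimorial (w : ℕ) : (smallPrimorial w).primeFactors = smallPrimes w :=
  Nat.primeFactors_prod fun _ => prime_of_mem_smallPrimes

lemma realProd_smallPrimes (w : ℕ) : realProd (smallPrimes w) = smallPrimorial w :=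
  realProd_eq_cast _

lemma two_le_smallPrimorial {w : ℕ} (hw : 2 ≤ w) : 2 ≤ smallPrimorial w :=
  Nat.le_of_dvd (smallPrimorial_pos w) (dvd_prod_of_mem (fun p => p)
    ((mem_smallPrimes Nat.prime_two).2 hw))

lemma sieveFactor_smallPrimes (w : ℕ) :
    sieveFactor (smallPrimes w) = smallPrimorial w / (smallPrimorial w).totient := by
  have h := Nat.totient_eq_mul_prod_factors (smallPrimorial w)
  rw [primeFactors_smallPrimorial] at h
  have h' : ((smallPrimorial w).totient : ℝ) =
      smallPrimorial w * ∏ p ∈ smallPrimes w, (1 - (p : ℝ)⁻¹) := by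
    have h' := congrArg (fun q : ℚ => (q : ℝ)) h
    push_cast at h'
    exact h'
  have hW : (smallPrimorial w : ℝ) ≠ 0 := by exact_mod_cast (smallPrimorial_pos w).ne'
  rw [h', div_mul_eq_div_div, div_self hW, one_div, ← prod_inv_distrib, sieveFactor]
  refine prod_congr rfl fun p hp => ?_
  have : (1 : ℝ) < p := by exact_mod_cast (prime_of_mem_smallPrimes hp).one_lt
  have h1 : (p : ℝ) - 1 ≠ 0 := by linarith
  have h2 : (p : ℝ) ≠ 0 := by linarith
  field_simp

lemma one_le_sieveFactor {P : Finset ℕ} (hP : ∀ p ∈ P, p.Prime) : 1 ≤ sieveFactor P := by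
  refine Finset.prod_induction _ (fun x : ℝ => 1 ≤ x) (fun a b ha hb => by nlinarith) le_rfl ?_
  intro p hp
  have : (1 : ℝ) < p := by exact_mod_cast (hP p hp).one_lt
  rw [le_div_iff₀ (by linarith)]; linarith

lemma sieveFactor_le_two_pow {P : Finset ℕ} (hP : ∀ p ∈ P, p.Prime) : sieveFactor P ≤ 2 ^ #P := by
  rw [sieveFactor, ← prod_const]
  refine prod_le_prod (fun p hp => ?_) fun p hp => ?_
  · have : (1 : ℝ) < p := by exact_mod_cast (hP p hp).one_lt
    exact div_nonneg (by linarith) (by linarith)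
  · have : (2 : ℝ) ≤ p := by exact_mod_cast (hP p hp).two_le
    rw [div_le_iff₀ (by linarith)]; linarith

lemma exists_sieveShift_le {ε : ℝ} (hε : 0 < ε) :
    ∃ K : ℝ, 0 ≤ K ∧ ∀ P : Finset ℕ, (∀ p ∈ P, p.Prime) →
      sieveShift P ≤ K + ε * Real.log (realProd P) := by
  set M := ⌈1 / ε⌉₊ + 1 with hM
  refine ⟨(M + 1 : ℕ), by positivity, fun P hP => ?_⟩
  have h1 : ∀ p ∈ P, Real.log p / (p - 1) ≤ (if p ≤ M then 1 else 0) + ε * Real.log p := by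
    intro p hp
    have hp1 : (1 : ℝ) < p := by exact_mod_cast (hP p hp).one_lt
    have hlog : 0 ≤ Real.log p := Real.log_nonneg hp1.le
    have hlog' : Real.log p ≤ p - 1 := Real.log_le_sub_one_of_pos (by linarith)
    split_ifs with h
    · have : Real.log p / (p - 1) ≤ 1 := div_le_one_of_le₀ hlog' (by linarith)
      have : 0 ≤ ε * Real.log p := by positivity
      linarith
    · have h2 : (M : ℝ) ≤ p := by exact_mod_cast (not_le.1 h).le
      have h3 : 1 / ε ≤ p - 1 := by
        have := Nat.le_ceil (1 / ε)
        rw [hM] at h2; push_cast at h2; linarith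
      rw [zero_add, div_le_iff₀ (by linarith)]
      have : 1 ≤ ε * (p - 1) := by
        rw [div_le_iff₀ hε] at h3; linarith
      nlinarith
  have h2 : ∑ p ∈ P, (if p ≤ M then (1 : ℝ) else 0) ≤ (M + 1 : ℕ) := by
    rw [← sum_filter, sum_const, nsmul_eq_mul, mul_one]
    have : P.filter (fun p => p ≤ M) ⊆ range (M + 1) := by
      intro p hp
      rw [mem_range]; have := (mem_filter.1 hp).2; omega
    have := card_le_card this
    rw [card_range] at this
    exact_mod_cast this
  have h3 : Real.log (realProd P) = ∑ p ∈ P, Real.log p :=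
    Real.log_prod fun p hp => by exact_mod_cast (hP p hp).ne_zero
  rw [h3, mul_sum]
  calc _ ≤ ∑ p ∈ P, ((if p ≤ M then (1 : ℝ) else 0) + ε * Real.log p) := sum_le_sum h1
    _ = _ := sum_add_distrib
    _ ≤ _ := by linarith

/-- The primes in `(w, R]`. -/
def largePrimes (w : ℕ) (R : ℝ) : Finset ℕ := primesLE R \ smallPrimes w

lemma prime_of_mem_largePrimes {w p : ℕ} {R : ℝ} (h : p ∈ largePrimes w R) : p.Prime :=
  prime_of_mem_primesLE (mem_sdiff.1 h).1

lemma lt_of_mem_largePrimes {w p : ℕ} {R : ℝ} (h : p ∈ largePrimes w R) : w < p := by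
  have := (mem_sdiff.1 h).2
  rw [mem_smallPrimes (prime_of_mem_largePrimes h)] at this
  omega

lemma smallPrimes_subset_primesLE {w : ℕ} {R : ℝ} (h : (w : ℝ) ≤ R) :
    smallPrimes w ⊆ primesLE R := by
  intro p hp
  have hpp := prime_of_mem_smallPrimes hp
  rw [mem_smallPrimes hpp] at hp
  exact mem_primesLE hpp (le_trans (by exact_mod_cast hp) h)

lemma smoothHarmonic_largePrimes {w : ℕ} {R z : ℝ} (hz : 0 ≤ z) (hzR : z ≤ R) :
    smoothHarmonic (largePrimes w R) z =
      ∑ k ∈ Ioc 0 ⌊z⌋₊ with (smallPrimorial w).Coprime k, 1 / (k : ℝ) := by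
  refine sum_congr (filter_congr fun k hk => ?_) fun _ _ => rfl
  rw [mem_Ioc] at hk
  constructor
  · intro h
    refine Nat.Coprime.symm ?_
    rw [smallPrimorial, Nat.coprime_prod_right_iff]
    intro p hp
    have hpp := prime_of_mem_smallPrimes hp
    refine ((Nat.Prime.coprime_iff_not_dvd hpp).2 fun hpk => ?_).symm
    have := h (Nat.mem_primeFactors.2 ⟨hpp, hpk, by omega⟩)
    exact (mem_sdiff.1 this).2 hp
  · intro h p hp
    have hpp := Nat.prime_of_mem_primeFactors hp
    have hpk := Nat.dvd_of_mem_primeFactors hp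
    refine mem_sdiff.2 ⟨mem_primesLE hpp ?_, fun hps => ?_⟩
    · have h1 : (p : ℝ) ≤ ⌊z⌋₊ := by exact_mod_cast (Nat.le_of_dvd hk.1 hpk).trans hk.2
      exact (h1.trans (Nat.floor_le hz)).trans hzR
    · have h1 : p ∣ smallPrimorial w := dvd_prod_of_mem (fun p => p) hps
      have := Nat.dvd_gcd h1 hpk
      rw [h] at this
      exact hpp.one_lt.ne' (Nat.dvd_one.1 this)

lemma log_sub_le_sieveFactor_mul_totientSum {w : ℕ} (hw : 2 ≤ w) {R z : ℝ} (hz : 0 < z)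
    (hzR : z ≤ R) : Real.log z - Real.log (smallPrimorial w) ≤
      sieveFactor (smallPrimes w) * totientSum (largePrimes w R) z := by
  have h1 := smoothHarmonic_le_totientSum (V := largePrimes w R)
    (fun p => prime_of_mem_largePrimes) z
  rw [smoothHarmonic_largePrimes hz.le hzR] at h1
  have h2 := (log_le_sum_coprime (two_le_smallPrimorial hw) hz).trans h1
  have h3 := mul_le_mul_of_nonneg_left h2
    (sieveFactor_pos (P := smallPrimes w) fun p => prime_of_mem_smallPrimes).le
  refine le_trans (le_of_eq ?_) h3
  rw [sieveFactor_smallPrimes]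
  have hW : (smallPrimorial w : ℝ) ≠ 0 := by exact_mod_cast (smallPrimorial_pos w).ne'
  have hφ : ((smallPrimorial w).totient : ℝ) ≠ 0 := by
    exact_mod_cast (Nat.totient_pos.2 (smallPrimorial_pos w)).ne'
  field_simp

lemma sieveFactor_mul_totientSum_le {w : ℕ} (hw : 2 ≤ w) {R z : ℝ} (hz : 1 ≤ z) (hzR : z ≤ R) :
    sieveFactor (smallPrimes w) * totientSum (largePrimes w R) z ≤ Real.exp (1 / w) *
      (sieveFactor (smallPrimes w) * (1 + Real.log (smallPrimorial w)) + 1 + Real.log z) := by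
  have hV : ∀ p ∈ largePrimes w R, p.Prime := fun p => prime_of_mem_largePrimes
  have h1 := totientSum_le_smoothHarmonic hV (z := z) (by linarith)
  rw [smoothHarmonic_largePrimes (by linarith) hzR] at h1
  have h2 := prod_one_add_le_exp (w := w) (by omega) (V := largePrimes w R)
    (fun p => lt_of_mem_largePrimes) zero_le_one
  simp only [one_mul] at h2
  have h3 := sum_coprime_le_log (smallPrimorial_pos w) hz
  have hF := sieveFactor_pos (P := smallPrimes w) fun p => prime_of_mem_smallPrimes
  have h4 : totientSum (largePrimes w R) z ≤ Real.exp (1 / w) * (1 + Real.log (smallPrimorial w) +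
      (smallPrimorial w).totient / smallPrimorial w * (1 + Real.log z)) :=
    h1.trans (mul_le_mul h2 h3 (sum_nonneg fun _ _ => by positivity) (Real.exp_pos _).le)
  refine (mul_le_mul_of_nonneg_left h4 hF.le).trans (le_of_eq ?_)
  rw [sieveFactor_smallPrimes]
  have hW : (smallPrimorial w : ℝ) ≠ 0 := by exact_mod_cast (smallPrimorial_pos w).ne'
  have hφ : ((smallPrimorial w).totient : ℝ) ≠ 0 := by
    exact_mod_cast (Nat.totient_pos.2 (smallPrimorial_pos w)).ne'
  field_simp
  ring

lemma sieveFactor_mul_totientSum_le_four_log {w : ℕ} (hw : 2 ≤ w) {R : ℝ} (hR : 1 ≤ R)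
    (hc : 1 + sieveFactor (smallPrimes w) * (1 + Real.log (smallPrimorial w)) ≤ Real.log R) :
    sieveFactor (smallPrimes w) * totientSum (largePrimes w R) R ≤ 4 * Real.log R := by
  refine (sieveFactor_mul_totientSum_le hw hR le_rfl).trans ?_
  have h1 : Real.exp (1 / w) ≤ 2 := by
    have h2 : (1 : ℝ) / w ≤ 1 / 2 := by
      have : (2 : ℝ) ≤ w := by exact_mod_cast hw
      exact one_div_le_one_div_of_le two_pos this
    calc Real.exp (1 / w) ≤ Real.exp (1 / 2) := Real.exp_le_exp.2 h2
      _ ≤ 2 := by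
        rw [← Real.le_log_iff_exp_le two_pos]
        linarith [Real.log_two_gt_d9]
  have hL : 0 ≤ Real.log R := Real.log_nonneg hR
  nlinarith [Real.exp_pos (1 / (w : ℝ))]

lemma abs_sub_le_of_totientSum_bounds {e τ F L g g₁ S l : ℝ} (he0 : 0 < e) (he1 : e ≤ 1 / 60)
    (hτ : τ = e / 5) (hF1 : 1 ≤ F) (hL0 : 0 < L) (hup : F * g ≤ (1 + 3 * τ) * L)
    (hlo : L - l ≤ F * g) (hlo₁ : (1 - e) * L - l ≤ F * g₁) (hl : l ≤ τ * L)
    (hg₁ : F * g₁ ≤ F * g)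
    (key : |S - F ^ 2 * g| ≤ F ^ 2 * (3 * e * g₁ + 17 * (g - g₁))) :
    |S - F * L| ≤ 60 * e * (F * L) := by
  have hF0 : 0 < F := by linarith
  have hτL : 0 < τ * L := by rw [hτ]; positivity
  have h1 : |F ^ 2 * g - F * L| ≤ F * (3 * τ * L) := by
    have : F ^ 2 * g - F * L = F * (F * g - L) := by ring
    rw [this, abs_mul, abs_of_pos hF0]
    refine mul_le_mul_of_nonneg_left ?_ hF0.le
    rw [abs_le]; constructor <;> linarith
  have h2 : F ^ 2 * (3 * e * g₁ + 17 * (g - g₁)) ≤ F * (12 * e * L + 17 * (4 * τ + e) * L) := by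
    have : F ^ 2 * (3 * e * g₁ + 17 * (g - g₁)) =
        F * (3 * e * (F * g₁) + 17 * (F * g - F * g₁)) := by ring
    rw [this]
    refine mul_le_mul_of_nonneg_left ?_ hF0.le
    have h3 : F * g₁ ≤ 4 * L := by
      have : (1 + 3 * τ) * L ≤ 4 * L := by gcongr; linarith
      linarith
    have h4 : 3 * e * (F * g₁) ≤ 3 * e * (4 * L) := by gcongr
    linarith
  calc |S - F * L| ≤ |S - F ^ 2 * g| + |F ^ 2 * g - F * L| := abs_sub_le _ _ _
    _ ≤ F * (12 * e * L + 17 * (4 * τ + e) * L) + F * (3 * τ * L) := add_le_add (key.trans h2) h1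
    _ = (12 * e + 17 * (4 * τ + e) + 3 * τ) * (F * L) := by ring
    _ ≤ 60 * e * (F * L) := by
        refine mul_le_mul_of_nonneg_right ?_ (by positivity)
        rw [hτ]; linarith

set_option maxHeartbeats 1000000 in
lemma pairSum_asymptotic {δ : ℝ} (hδ : 0 < δ) :
    ∃ (w₀ : ℕ) (τ L₀ : ℝ), 2 ≤ w₀ ∧ 0 < τ ∧ τ ≤ 1 ∧ ∀ (w : ℕ) (R : ℝ), w₀ ≤ w → (w : ℝ) ≤ R →
      L₀ ≤ Real.log R →
      1 + sieveFactor (smallPrimes w) * (1 + Real.log (smallPrimorial w)) ≤ τ * Real.log R →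
      |pairSum (largePrimes w R) R R - sieveFactor (smallPrimes w) * Real.log R| ≤
        δ * (sieveFactor (smallPrimes w) * Real.log R) := by
  set e : ℝ := min δ 1 / 60 with he
  have hm : 0 < min δ 1 := lt_min hδ one_pos
  have he0 : 0 < e := by positivity
  have he1 : e ≤ 1 / 60 := by
    rw [he]; linarith [min_le_right δ 1]
  have heδ : 60 * e ≤ δ := by rw [he]; linarith [min_le_left δ 1]
  obtain ⟨Y, hY1, hY⟩ := eventually_abs_mobiusRiesz_sub_one_le (η := e / 2) (by positivity)
  obtain ⟨K, hK0, hK⟩ := exists_sieveShift_le (ε := e ^ 2 / 60) (by positivity)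
  set τ : ℝ := e / 5 with hτ
  have hτ0 : 0 < τ := by positivity
  obtain ⟨w₁, hw₁⟩ := exists_nat_gt (1 / Real.log (1 + τ))
  have hlτ : 0 < Real.log (1 + τ) := Real.log_pos (by linarith)
  refine ⟨max 2 w₁, τ, max (2 * Real.log Y / e + 1) (K / (e ^ 2 / 60)), le_max_left _ _, hτ0,
    by linarith, fun w R hw hwR hL hc => ?_⟩
  have hw2 : 2 ≤ w := (le_max_left _ _).trans hw
  have hw2' : (2 : ℝ) ≤ w := by exact_mod_cast hw2
  have hR2 : 2 ≤ R := hw2'.trans hwR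
  have hR0 : 0 < R := by linarith
  set L := Real.log R with hLdef
  set F := sieveFactor (smallPrimes w) with hFdef
  have hF1 : 1 ≤ F := one_le_sieveFactor fun p => prime_of_mem_smallPrimes
  have hlW : 0 ≤ Real.log (smallPrimorial w) := Real.log_natCast_nonneg _
  have hL0 : 0 < L := Real.log_pos (by linarith)
  have hLY : 2 * Real.log Y / e + 1 ≤ L := (le_max_left _ _).trans hL
  have hLK : K ≤ e ^ 2 / 60 * L := by
    have := (le_max_right _ _).trans hL
    rwa [div_le_iff₀ (by positivity), mul_comm] at this
  have hlWτ : Real.log (smallPrimorial w) ≤ τ * L := by nlinarith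
  have hexp : Real.exp (1 / w) ≤ 1 + τ := by
    rw [← Real.le_log_iff_exp_le (by linarith), div_le_iff₀ (by linarith)]
    have h1 : (w₁ : ℝ) ≤ w := by exact_mod_cast (le_max_right _ _).trans hw
    rw [div_lt_iff₀ hlτ] at hw₁
    nlinarith
  set R₁ := Real.exp ((1 - e) * L) with hR₁
  have hlR₁ : Real.log R₁ = (1 - e) * L := Real.log_exp _
  have hR₁R : R₁ ≤ R := by
    rw [hR₁, ← Real.le_log_iff_exp_le hR0]
    linarith [mul_pos he0 hL0]
  have hP := smallPrimes_subset_primesLE hwR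
  have key := abs_pairSum_sub_le (R := R) (by linarith) hP hR₁R (θ := e) (by linarith) (by
    intro E hE hER
    have hEp : ∀ p ∈ E, p.Prime := fun p hp => prime_of_mem_largePrimes (hE hp)
    have hE0 := realProd_pos hEp
    have hE1 := one_le_realProd hEp
    have hd : Disjoint (smallPrimes w) E := (disjoint_of_subset_left hE sdiff_disjoint).symm
    have hPE : smallPrimes w ∪ E ⊆ primesLE R := union_subset hP (hE.trans sdiff_subset)
    have hPEp : ∀ p ∈ smallPrimes w ∪ E, p.Prime := fun p hp => prime_of_mem_primesLE (hPE hp)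
    have hlE : Real.log (realProd E) ≤ (1 - e) * L := by
      rw [← hlR₁]; exact Real.log_le_log hE0 hER
    have hY0 : 0 < Y := by linarith
    have hlz : Real.log (R / realProd E / Y) = L - Real.log (realProd E) - Real.log Y := by
      rw [Real.log_div (by positivity) hY0.ne', Real.log_div hR0.ne' hE0.ne']
    have hlY : Real.log Y ≤ e * L / 2 - e / 2 := by
      have : 2 * Real.log Y / e ≤ L - 1 := by linarith
      rw [div_le_iff₀ he0] at this; linarith
    have hlz' : e * L / 2 < Real.log (R / realProd E / Y) := by rw [hlz]; linarith
    have heL : 0 < e * L / 2 := by positivity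
    have hzY : Y < R / realProd E := by
      rw [← one_lt_div hY0]
      exact (Real.log_pos_iff (by positivity)).1 (heL.trans hlz')
    have h1 := abs_sievedRiesz_sdiff_sub_le (by positivity) hY1 hY hPE hzY
      (div_le_self hR0.le hE1)
    refine h1.trans (mul_le_mul_of_nonneg_left ?_ (sieveFactor_pos hPEp).le)
    have h2 := hK _ hPEp
    rw [realProd_union hd, Real.log_mul (realProd_pos fun p => prime_of_mem_smallPrimes).ne'
      hE0.ne',
      realProd_smallPrimes] at h2
    have h3 : sieveShift (smallPrimes w ∪ E) ≤ 3 * (e ^ 2 / 60) * L := by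
      have : Real.log (smallPrimorial w) + Real.log (realProd E) ≤ 2 * L := by nlinarith
      have h4 : e ^ 2 / 60 * (Real.log (smallPrimorial w) + Real.log (realProd E)) ≤
        e ^ 2 / 60 * (2 * L) := by gcongr
      linarith
    have h4 : 5 / Real.log (R / realProd E / Y) * sieveShift (smallPrimes w ∪ E) ≤
        5 / (e * L / 2) * (3 * (e ^ 2 / 60) * L) := by
      refine mul_le_mul ?_ h3 (sieveShift_nonneg hPEp) (by positivity)
      gcongr
    have h5 : 5 / (e * L / 2) * (3 * (e ^ 2 / 60) * L) = e / 2 := by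
      field_simp; norm_num
    linarith)
  change |pairSum (largePrimes w R) R R - F ^ 2 * totientSum (largePrimes w R) R| ≤
    F ^ 2 * (3 * e * totientSum (largePrimes w R) R₁ +
      17 * (totientSum (largePrimes w R) R - totientSum (largePrimes w R) R₁)) at key
  have hup := sieveFactor_mul_totientSum_le hw2 (R := R) (by linarith : 1 ≤ R) le_rfl
  have hlo := log_sub_le_sieveFactor_mul_totientSum hw2 hR0 (le_refl R)
  have hlo₁ := log_sub_le_sieveFactor_mul_totientSum hw2 (Real.exp_pos ((1 - e) * L)) hR₁R
  rw [← hR₁, hlR₁] at hlo₁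
  set g := totientSum (largePrimes w R) R
  set g₁ := totientSum (largePrimes w R) R₁
  rw [← hFdef, ← hLdef] at hup hlo
  rw [← hFdef] at hlo₁
  have hup' : F * g ≤ (1 + 3 * τ) * L := by
    have : Real.exp (1 / w) * (F * (1 + Real.log (smallPrimorial w)) + 1 + L) ≤
        (1 + τ) * (τ * L + L) := by
      refine mul_le_mul hexp (by linarith) (by positivity) (by linarith)
    have hτ1 : τ * (τ * L) ≤ 1 * (τ * L) := by gcongr; linarith
    linarith
  have hg₁ : F * g₁ ≤ F * g := by
    refine mul_le_mul_of_nonneg_left ?_ (by linarith)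
    refine sum_le_sum_of_subset_of_nonneg ?_ ?_
    · intro E hE
      rw [mem_filter] at hE ⊢
      exact ⟨hE.1, hE.2.trans hR₁R⟩
    · intro E hE _
      exact prod_inv_sub_one_nonneg fun p hp =>
        prime_of_mem_largePrimes (mem_powerset.1 (mem_filter.1 hE).1 hp)
  refine (abs_sub_le_of_totientSum_bounds he0 he1 hτ hF1 hL0 hup' hlo hlo₁ hlWτ hg₁ key).trans ?_
  gcongr

/-- The sieve weight attached to a pair of sets of primes. -/
def pairWeight (R : ℝ) (X : Finset ℕ × Finset ℕ) : ℝ :=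
  (-1) ^ #X.1 * (-1) ^ #X.2 * (Real.posLog (R / realProd X.1) * Real.posLog (R / realProd X.2))

/-- Pairs of subsets of `V`. -/
def subsetPairs (V : Finset ℕ) : Finset (Finset ℕ × Finset ℕ) := V.powerset ×ˢ V.powerset

lemma mem_subsetPairs {V : Finset ℕ} {X : Finset ℕ × Finset ℕ} :
    X ∈ subsetPairs V ↔ X.1 ⊆ V ∧ X.2 ⊆ V := by
  simp [subsetPairs]

lemma card_subsetPairs (V : Finset ℕ) : #(subsetPairs V) = 4 ^ #V := by
  rw [subsetPairs, card_product, card_powerset, ← mul_pow]; norm_num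

/-- The indices `i` for which `p` occurs in the pair `D i`. -/
def indicesAt {m : ℕ} (p : ℕ) (D : Fin m → Finset ℕ × Finset ℕ) : Finset (Fin m) :=
  univ.filter fun i => p ∈ (D i).1 ∪ (D i).2

lemma sum_subsetPairs_eq_pairSum (V : Finset ℕ) (R : ℝ) :
    ∑ X ∈ subsetPairs V, pairWeight R X / realProd (X.1 ∪ X.2) = pairSum V R R := by
  rw [subsetPairs, sum_product]; rfl

lemma pairWeight_union {Q K : Finset ℕ} (hQK : Disjoint Q K) (R : ℝ)
    {U X : Finset ℕ × Finset ℕ} (hU : U ∈ subsetPairs Q) (hX : X ∈ subsetPairs K) :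
    pairWeight R (U.1 ∪ X.1, U.2 ∪ X.2) = (-1) ^ #U.1 * (-1) ^ #U.2 *
      ((-1) ^ #X.1 * (-1) ^ #X.2 * (Real.posLog (R / realProd U.1 / realProd X.1) *
        Real.posLog (R / realProd U.2 / realProd X.2))) := by
  rw [mem_subsetPairs] at hU hX
  have h1 : Disjoint U.1 X.1 := disjoint_of_subset_left hU.1 (disjoint_of_subset_right hX.1 hQK)
  have h2 : Disjoint U.2 X.2 := disjoint_of_subset_left hU.2 (disjoint_of_subset_right hX.2 hQK)
  simp only [pairWeight, card_union_of_disjoint h1, card_union_of_disjoint h2, realProd_union h1,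
    realProd_union h2, pow_add, div_div]
  ring

lemma sum_piFinset_subsetPairs {m : ℕ} {V Q : Finset ℕ} (hQ : Q ⊆ V)
    (f : (Fin m → Finset ℕ × Finset ℕ) → ℝ) :
    ∑ D ∈ Fintype.piFinset (fun _ : Fin m => subsetPairs V), f D =
      ∑ U ∈ Fintype.piFinset (fun _ : Fin m => subsetPairs Q),
        ∑ X ∈ Fintype.piFinset (fun _ : Fin m => subsetPairs (V \ Q)),
          f fun i => ((U i).1 ∪ (X i).1, (U i).2 ∪ (X i).2) := by
  rw [← sum_product']
  symm
  refine sum_nbij' (fun Z i => ((Z.1 i).1 ∪ (Z.2 i).1, (Z.1 i).2 ∪ (Z.2 i).2))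
    (fun D => (fun i => ((D i).1 ∩ Q, (D i).2 ∩ Q), fun i => ((D i).1 \ Q, (D i).2 \ Q)))
    ?_ ?_ ?_ ?_ ?_
  · intro Z hZ
    simp only [mem_product, Fintype.mem_piFinset, mem_subsetPairs] at hZ ⊢
    exact fun i => ⟨union_subset ((hZ.1 i).1.trans hQ) ((hZ.2 i).1.trans sdiff_subset),
      union_subset ((hZ.1 i).2.trans hQ) ((hZ.2 i).2.trans sdiff_subset)⟩
  · intro D hD
    simp only [mem_product, Fintype.mem_piFinset, mem_subsetPairs] at hD ⊢
    exact ⟨fun i => ⟨inter_subset_right, inter_subset_right⟩,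
      fun i => ⟨sdiff_subset_sdiff (hD i).1 le_rfl, sdiff_subset_sdiff (hD i).2 le_rfl⟩⟩
  · intro Z hZ
    simp only [mem_product, Fintype.mem_piFinset, mem_subsetPairs, subset_iff,
      Finset.mem_sdiff] at hZ
    refine Prod.ext (funext fun i => Prod.ext ?_ ?_) (funext fun i => Prod.ext ?_ ?_) <;>
    · ext p
      have := (hZ.1 i).1 (x := p)
      have := (hZ.1 i).2 (x := p)
      have := (hZ.2 i).1 (x := p)
      have := (hZ.2 i).2 (x := p)
      simp only [mem_inter, mem_union, Finset.mem_sdiff]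
      tauto
  · intro D hD
    refine funext fun i => Prod.ext ?_ ?_ <;>
    · ext p
      simp only [mem_inter, mem_union, Finset.mem_sdiff]
      tauto
  · intro Z _
    rfl

lemma prod_pow_card_indicesAt {m : ℕ} {V : Finset ℕ} {D : Fin m → Finset ℕ × Finset ℕ}
    (hD : D ∈ Fintype.piFinset (fun _ : Fin m => subsetPairs V)) :
    ∏ p ∈ V, (1 / (p : ℝ)) ^ #(indicesAt p D) = ∏ i, 1 / realProd ((D i).1 ∪ (D i).2) := by
  simp only [indicesAt, ← prod_const, prod_filter]
  rw [Finset.prod_comm]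
  refine prod_congr rfl fun i _ => ?_
  have h := (mem_subsetPairs.1 ((Fintype.mem_piFinset.1 hD) i))
  rw [← prod_filter, filter_mem_eq_inter, inter_eq_right.2 (union_subset h.1 h.2), realProd,
    one_div, ← prod_inv_distrib]
  simp

/-- The sum over tuples of pairs weighted by local densities `ω p`. -/
def localSum (m : ℕ) (V : Finset ℕ) (R : ℝ) (ω : ℕ → Finset (Fin m) → ℝ) : ℝ :=
  ∑ D ∈ Fintype.piFinset (fun _ : Fin m => subsetPairs V),
    (∏ i, pairWeight R (D i)) * ∏ p ∈ V, ω p (indicesAt p D)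

lemma sum_pairWeight_mul_eq_pow (m : ℕ) (V : Finset ℕ) (R : ℝ) :
    ∑ D ∈ Fintype.piFinset (fun _ : Fin m => subsetPairs V),
      (∏ i, pairWeight R (D i)) * ∏ p ∈ V, (1 / (p : ℝ)) ^ #(indicesAt p D) =
      pairSum V R R ^ m := by
  rw [← sum_subsetPairs_eq_pairSum]
  have : (∑ X ∈ subsetPairs V, pairWeight R X / realProd (X.1 ∪ X.2)) ^ m =
      ∏ _i : Fin m, ∑ X ∈ subsetPairs V, pairWeight R X / realProd (X.1 ∪ X.2) := by simp
  rw [this, prod_univ_sum]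
  refine sum_congr rfl fun D hD => ?_
  rw [prod_pow_card_indicesAt hD, ← prod_mul_distrib]
  exact prod_congr rfl fun i _ => by rw [mul_one_div]

lemma abs_mixed_sum_le {m : ℕ} {V Q : Finset ℕ} (hV : ∀ p ∈ V, p.Prime) (hQ : Q ⊆ V) {R S : ℝ}
    (hR : 0 < R) (hS : ∀ x y, 0 < x → x ≤ R → 0 < y → y ≤ R →
      |pairSum (V \ Q) x y| ≤ S * 4 ^ #Q)
    {β : ℕ → Finset (Fin m) → ℝ} (hβ : ∀ p ∈ Q, ∀ T, |β p T| ≤ 1 / (p : ℝ) ^ 2) :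
    |∑ D ∈ Fintype.piFinset (fun _ : Fin m => subsetPairs V), (∏ i, pairWeight R (D i)) *
      ((∏ p ∈ Q, β p (indicesAt p D)) *
        ∏ p ∈ V \ Q, (1 / (p : ℝ)) ^ #(indicesAt p D))| ≤
      S ^ m * ∏ p ∈ Q, (16 : ℝ) ^ m * (1 / (p : ℝ) ^ 2) := by
  rw [sum_piFinset_subsetPairs hQ]
  have hterm : ∀ U ∈ Fintype.piFinset (fun _ : Fin m => subsetPairs Q),
      |∑ X ∈ Fintype.piFinset (fun _ : Fin m => subsetPairs (V \ Q)),
        (∏ i, pairWeight R ((U i).1 ∪ (X i).1, (U i).2 ∪ (X i).2)) *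
        ((∏ p ∈ Q, β p (indicesAt p fun i => ((U i).1 ∪ (X i).1, (U i).2 ∪ (X i).2))) *
        ∏ p ∈ V \ Q, (1 / (p : ℝ)) ^
          #(indicesAt p fun i => ((U i).1 ∪ (X i).1, (U i).2 ∪ (X i).2)))| ≤
      (∏ p ∈ Q, 1 / (p : ℝ) ^ 2) * (S * 4 ^ #Q) ^ m := by
    intro U hU
    have hU' := fun i => mem_subsetPairs.1 (Fintype.mem_piFinset.1 hU i)
    have heq : ∀ X ∈ Fintype.piFinset (fun _ : Fin m => subsetPairs (V \ Q)),
        (∏ i, pairWeight R ((U i).1 ∪ (X i).1, (U i).2 ∪ (X i).2)) *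
        ((∏ p ∈ Q, β p (indicesAt p fun i => ((U i).1 ∪ (X i).1, (U i).2 ∪ (X i).2))) *
        ∏ p ∈ V \ Q, (1 / (p : ℝ)) ^
          #(indicesAt p fun i => ((U i).1 ∪ (X i).1, (U i).2 ∪ (X i).2))) =
        ((∏ p ∈ Q, β p (indicesAt p U)) * ∏ i, ((-1) ^ #(U i).1 * (-1) ^ #(U i).2)) *
        ∏ i, ((-1) ^ #(X i).1 * (-1) ^ #(X i).2 *
          (Real.posLog (R / realProd (U i).1 / realProd (X i).1) *
          Real.posLog (R / realProd (U i).2 / realProd (X i).2)) /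
            realProd ((X i).1 ∪ (X i).2)) := by
      intro X hX
      have hX' := fun i => mem_subsetPairs.1 (Fintype.mem_piFinset.1 hX i)
      have e1 : ∏ p ∈ Q, β p (indicesAt p fun i => ((U i).1 ∪ (X i).1, (U i).2 ∪ (X i).2)) =
          ∏ p ∈ Q, β p (indicesAt p U) := by
        refine prod_congr rfl fun p hp => ?_
        congr 1
        refine filter_congr fun i _ => ?_
        have a1 : p ∉ (X i).1 := fun h => (mem_sdiff.1 ((hX' i).1 h)).2 hp
        have a2 : p ∉ (X i).2 := fun h => (mem_sdiff.1 ((hX' i).2 h)).2 hp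
        simp [a1, a2]
      have e2 : ∏ p ∈ V \ Q, (1 / (p : ℝ)) ^
          #(indicesAt p fun i => ((U i).1 ∪ (X i).1, (U i).2 ∪ (X i).2)) =
          ∏ i, 1 / realProd ((X i).1 ∪ (X i).2) := by
        rw [← prod_pow_card_indicesAt hX]
        refine prod_congr rfl fun p hp => ?_
        congr 2
        refine filter_congr fun i _ => ?_
        have a1 : p ∉ (U i).1 := fun h => (mem_sdiff.1 hp).2 ((hU' i).1 h)
        have a2 : p ∉ (U i).2 := fun h => (mem_sdiff.1 hp).2 ((hU' i).2 h)
        simp [a1, a2]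
      rw [e1, e2, prod_congr rfl fun i _ => pairWeight_union (disjoint_sdiff (s := Q) (t := V)) R
        (Fintype.mem_piFinset.1 hU i) (Fintype.mem_piFinset.1 hX i), prod_mul_distrib]
      simp only [div_eq_mul_inv _ (realProd _), one_mul, prod_mul_distrib]
      ring
    rw [sum_congr rfl heq, ← mul_sum, ← prod_univ_sum (fun _ : Fin m => subsetPairs (V \ Q))
      (fun i X => (-1) ^ #X.1 * (-1) ^ #X.2 *
          (Real.posLog (R / realProd (U i).1 / realProd X.1) *
          Real.posLog (R / realProd (U i).2 / realProd X.2)) / realProd (X.1 ∪ X.2)),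
      abs_mul, abs_mul, abs_prod, abs_prod, abs_prod]
    have e3 : ∏ i, |(-1 : ℝ) ^ #(U i).1 * (-1) ^ #(U i).2| = 1 :=
      prod_eq_one fun i _ => by simp [abs_mul]
    rw [e3, mul_one]
    refine mul_le_mul (prod_le_prod (fun _ _ => abs_nonneg _) fun p hp => hβ p hp _) ?_
      (prod_nonneg fun _ _ => abs_nonneg _) (prod_nonneg fun _ _ => by positivity)
    have e4 : (S * 4 ^ #Q) ^ m = ∏ _i : Fin m, (S * 4 ^ #Q) := by simp
    rw [e4]
    refine prod_le_prod (fun _ _ => abs_nonneg _) fun i _ => ?_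
    rw [subsetPairs, sum_product]
    have b1 := one_le_realProd fun p hp => hV p (hQ ((hU' i).1 hp))
    have b2 := one_le_realProd fun p hp => hV p (hQ ((hU' i).2 hp))
    exact hS _ _ (div_pos hR (by linarith)) (div_le_self hR.le b1) (div_pos hR (by linarith))
      (div_le_self hR.le b2)
  refine (abs_sum_le_sum_abs _ _).trans ((sum_le_sum hterm).trans (le_of_eq ?_))
  rw [sum_const, Fintype.card_piFinset, prod_const, card_subsetPairs, card_univ, Fintype.card_fin,
    nsmul_eq_mul, prod_mul_distrib, prod_const, mul_pow]
  have : (16 : ℝ) = 4 * 4 := by norm_num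
  rw [this, mul_pow, mul_pow]
  push_cast
  rw [← pow_mul, ← pow_mul, mul_comm m (#Q)]
  ring

lemma abs_localSum_sub_pow_le {m : ℕ} {V : Finset ℕ} (hV : ∀ p ∈ V, p.Prime) {R S : ℝ}
    (hR : 0 < R) (hS : ∀ Q ⊆ V, ∀ x y, 0 < x → x ≤ R → 0 < y → y ≤ R →
      |pairSum (V \ Q) x y| ≤ S * 4 ^ #Q)
    {ω : ℕ → Finset (Fin m) → ℝ}
    (hω : ∀ p ∈ V, ∀ T, |ω p T - (1 / (p : ℝ)) ^ #T| ≤ 1 / (p : ℝ) ^ 2) :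
    |localSum m V R ω - pairSum V R R ^ m| ≤
      S ^ m * (∏ p ∈ V, (1 + (16 : ℝ) ^ m * (1 / (p : ℝ) ^ 2)) - 1) := by
  have hexp : localSum m V R ω = ∑ Q ∈ V.powerset,
      ∑ D ∈ Fintype.piFinset (fun _ : Fin m => subsetPairs V), (∏ i, pairWeight R (D i)) *
      ((∏ p ∈ Q, (ω p (indicesAt p D) - (1 / (p : ℝ)) ^ #(indicesAt p D))) *
        ∏ p ∈ V \ Q, (1 / (p : ℝ)) ^ #(indicesAt p D)) := by
    rw [sum_comm]
    refine sum_congr rfl fun D _ => ?_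
    rw [← mul_sum, ← prod_add]
    simp
  rw [hexp, ← sum_erase_add _ _ (empty_mem_powerset V)]
  simp only [prod_empty, one_mul, sdiff_empty]
  rw [sum_pairWeight_mul_eq_pow, add_sub_cancel_right]
  refine (abs_sum_le_sum_abs _ _).trans ?_
  have h2 : ∏ p ∈ V, (1 + (16 : ℝ) ^ m * (1 / (p : ℝ) ^ 2)) - 1 =
      ∑ Q ∈ V.powerset.erase ∅, ∏ p ∈ Q, (16 : ℝ) ^ m * (1 / (p : ℝ) ^ 2) := by
    rw [prod_one_add, ← sum_erase_add _ _ (empty_mem_powerset V), prod_empty, add_sub_cancel_right]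
  rw [h2, mul_sum]
  refine sum_le_sum fun Q hQ => ?_
  have hQV := mem_powerset.1 (mem_of_mem_erase hQ)
  exact abs_mixed_sum_le (β := fun p T => ω p T - (1 / (p : ℝ)) ^ #T) hV hQV hR (hS Q hQV)
    fun p hp T => hω p (hQV hp) T

lemma abs_pairSum_largePrimes_sdiff_le {w : ℕ} {R : ℝ} (hw : 2 ≤ w) (hwR : (w : ℝ) ≤ R)
    (hc : 1 + sieveFactor (smallPrimes w) * (1 + Real.log (smallPrimorial w)) ≤ Real.log R)
    {Q : Finset ℕ} (hQ : Q ⊆ largePrimes w R) {x y : ℝ} (hx : 0 < x) (hxR : x ≤ R) (hy : 0 < y)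
    (hyR : y ≤ R) : |pairSum (largePrimes w R \ Q) x y| ≤
      64 * (sieveFactor (smallPrimes w) * Real.log R) * 4 ^ #Q := by
  have hR1 : 1 ≤ R := le_trans (by exact_mod_cast (by omega : 1 ≤ w)) hwR
  have hQp : ∀ p ∈ Q, p.Prime := fun p hp => prime_of_mem_largePrimes (hQ hp)
  have hP : smallPrimes w ∪ Q ⊆ primesLE R :=
    union_subset (smallPrimes_subset_primesLE hwR) (hQ.trans sdiff_subset)
  have hd : Disjoint (smallPrimes w) Q := (disjoint_of_subset_left hQ sdiff_disjoint).symm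
  have h1 := abs_pairSum_le hP hx hxR hy hyR
  have he : primesLE R \ (smallPrimes w ∪ Q) = largePrimes w R \ Q := by
    rw [largePrimes, sdiff_sdiff_left, sup_eq_union]
  rw [he, sieveFactor_union hd] at h1
  refine h1.trans ?_
  have h2 : totientSum (largePrimes w R \ Q) R ≤ totientSum (largePrimes w R) R :=
    totientSum_mono (fun p => prime_of_mem_largePrimes) sdiff_subset R
  have h3 := sieveFactor_mul_totientSum_le_four_log hw hR1 hc
  have hF : 1 ≤ sieveFactor (smallPrimes w) := one_le_sieveFactor fun p => prime_of_mem_smallPrimes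
  have hFQ : 1 ≤ sieveFactor Q := one_le_sieveFactor hQp
  have hL : 0 ≤ Real.log R := Real.log_nonneg hR1
  have h4 : sieveFactor Q ^ 2 ≤ 4 ^ #Q := by
    calc sieveFactor Q ^ 2 ≤ (2 ^ #Q) ^ 2 := by gcongr; exact sieveFactor_le_two_pow hQp
      _ = 4 ^ #Q := by rw [← pow_mul, mul_comm, pow_mul]; norm_num
  have h5 : sieveFactor (smallPrimes w) * totientSum (largePrimes w R \ Q) R ≤ 4 * Real.log R :=
    (mul_le_mul_of_nonneg_left h2 (by linarith)).trans h3
  calc 16 * (sieveFactor (smallPrimes w) * sieveFactor Q) ^ 2 *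
        totientSum (largePrimes w R \ Q) R
      = 16 * sieveFactor (smallPrimes w) * sieveFactor Q ^ 2 *
        (sieveFactor (smallPrimes w) * totientSum (largePrimes w R \ Q) R) := by ring
    _ ≤ 16 * sieveFactor (smallPrimes w) * 4 ^ #Q * (4 * Real.log R) := by
        refine mul_le_mul (by gcongr) h5 ?_ (by positivity)
        refine mul_nonneg (by linarith) (sum_nonneg fun E hE => ?_)
        exact prod_inv_sub_one_nonneg fun p hp => prime_of_mem_largePrimes
          (sdiff_subset (mem_powerset.1 (mem_filter.1 hE).1 hp))
    _ = _ := by ring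

/-- The error from non-independence of the local conditions is negligible. -/
lemma abs_localSum_largePrimes_sub_pow_le {m w : ℕ} {R : ℝ} (hw : 2 ≤ w) (hwR : (w : ℝ) ≤ R)
    (hc : 1 + sieveFactor (smallPrimes w) * (1 + Real.log (smallPrimorial w)) ≤ Real.log R)
    {ω : ℕ → Finset (Fin m) → ℝ}
    (hω : ∀ p ∈ largePrimes w R, ∀ T, |ω p T - (1 / (p : ℝ)) ^ #T| ≤ 1 / (p : ℝ) ^ 2) :
    |localSum m (largePrimes w R) R ω - pairSum (largePrimes w R) R R ^ m| ≤
      64 ^ m * (Real.exp (16 ^ m / w) - 1) * (sieveFactor (smallPrimes w) * Real.log R) ^ m := by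
  have hR1 : 1 ≤ R := le_trans (by exact_mod_cast (by omega : 1 ≤ w)) hwR
  have h := abs_localSum_sub_pow_le (fun p => prime_of_mem_largePrimes) (by linarith)
    (fun Q hQ x y hx hxR hy hyR => abs_pairSum_largePrimes_sdiff_le hw hwR hc hQ hx hxR hy hyR) hω
  refine h.trans ?_
  have h1 : ∏ p ∈ largePrimes w R, (1 + (16 : ℝ) ^ m * (1 / (p : ℝ) ^ 2)) ≤
      Real.exp (16 ^ m / w) := by
    refine le_trans (prod_le_prod (fun _ _ => by positivity) fun p hp => ?_)
      (prod_one_add_le_exp (w := w) (by omega) (fun p => lt_of_mem_largePrimes)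
        (by positivity : (0 : ℝ) ≤ 16 ^ m))
    have : (1 : ℝ) < p := by exact_mod_cast (prime_of_mem_largePrimes hp).one_lt
    have : 0 < (p : ℝ) * (p - 1) := mul_pos (by linarith) (by linarith)
    gcongr
    nlinarith
  have hF : 1 ≤ sieveFactor (smallPrimes w) := one_le_sieveFactor fun p => prime_of_mem_smallPrimes
  have hL : 0 ≤ Real.log R := Real.log_nonneg hR1
  calc _ ≤ (64 * (sieveFactor (smallPrimes w) * Real.log R)) ^ m *
        (Real.exp (16 ^ m / w) - 1) := by gcongr
    _ = _ := by rw [mul_pow]; ring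

/-- The reduction modulo `p` of the affine form `∑ j, l j * x j + k`. -/
def affineForm {t : ℕ} (p : ℕ) (l : Fin t → ℤ) (k : ℤ) (y : Fin t → ZMod p) : ZMod p :=
  ∑ j, (l j : ZMod p) * y j + k

/-- The proportion of `y` modulo `p` at which the forms indexed by `T` all vanish. -/
def localDensity {m t : ℕ} (l : Fin m → Fin t → ℤ) (k : Fin m → ℤ) (p : ℕ) (T : Finset (Fin m)) :
    ℝ :=
  (Nat.card {y : Fin t → ZMod p // ∀ i ∈ T, affineForm p (l i) (k i) y = 0} : ℝ) / (p : ℝ) ^ t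

/-- The linear part of an affine form modulo `p`. -/
def linearPart {t : ℕ} (p : ℕ) (l : Fin t → ℤ) : (Fin t → ZMod p) →+ ZMod p where
  toFun y := ∑ j, (l j : ZMod p) * y j
  map_zero' := by simp
  map_add' y z := by simp [mul_add, sum_add_distrib]

lemma affineForm_eq_zero_iff {t p : ℕ} {l : Fin t → ℤ} {k : ℤ} {y : Fin t → ZMod p} :
    affineForm p l k y = 0 ↔ linearPart p l y = -k := by
  rw [← add_eq_zero_iff_eq_neg]; rfl

lemma linearPart_single {t p : ℕ} (l : Fin t → ℤ) (j : Fin t) (u : ZMod p) :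
    linearPart p l (Pi.single j u) = l j * u := by
  change ∑ i, (l i : ZMod p) * (Pi.single j u : Fin t → ZMod p) i = _
  rw [sum_eq_single j]
  · simp
  · intro i _ hij; simp [hij]
  · simp

lemma card_fiber_mul_card {G H : Type*} [AddCommGroup G] [AddCommGroup H] [Fintype G] [Fintype H]
    (f : G →+ H) (hf : Function.Surjective f) (h : H) :
    Nat.card {g : G // f g = h} * Nat.card H = Nat.card G := by
  rw [Nat.card_eq_fintype_card, Nat.card_eq_fintype_card, Nat.card_eq_fintype_card,
    Fintype.card_subtype]
  have h1 := card_eq_sum_card_fiberwise (f := f) (s := univ) (t := univ) fun _ _ => by simp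
  rw [← card_univ (α := G), h1, sum_const_nat (m := #{g | f g = h}), card_univ, mul_comm]
  intro x _
  exact AddMonoidHom.card_fiber_eq_of_mem_range f (hf x) (hf h)

lemma card_fun_zmod (t p : ℕ) : Nat.card (Fin t → ZMod p) = p ^ t := by
  simp [Nat.card_fun]

lemma localDensity_empty {m t : ℕ} (l : Fin m → Fin t → ℤ) (k : Fin m → ℤ) {p : ℕ}
    (hp : p ≠ 0) : localDensity l k p ∅ = 1 := by
  rw [localDensity]
  have : Nat.card {y : Fin t → ZMod p // ∀ i ∈ (∅ : Finset (Fin m)),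
      affineForm p (l i) (k i) y = 0} = p ^ t := by
    rw [← card_fun_zmod]
    exact Nat.card_congr (Equiv.subtypeUnivEquiv fun _ => by simp)
  rw [this]
  push_cast
  exact div_self (pow_ne_zero _ (by exact_mod_cast hp))

lemma localDensity_nonneg {m t : ℕ} (l : Fin m → Fin t → ℤ) (k : Fin m → ℤ) (p : ℕ)
    (T : Finset (Fin m)) : 0 ≤ localDensity l k p T := by
  unfold localDensity; positivity

lemma localDensity_singleton {m t : ℕ} {l : Fin m → Fin t → ℤ} (k : Fin m → ℤ) {p : ℕ}
    (hp : p.Prime) {i : Fin m} {j : Fin t} (hj : (l i j : ZMod p) ≠ 0) :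
    localDensity l k p {i} = 1 / p := by
  have := Fact.mk hp
  have hsurj : Function.Surjective (linearPart p (l i)) := fun c =>
    ⟨Pi.single j ((l i j : ZMod p)⁻¹ * c), by rw [linearPart_single, mul_inv_cancel_left₀ hj]⟩
  have h := card_fiber_mul_card _ hsurj (-(k i : ZMod p))
  have e : Nat.card {y : Fin t → ZMod p // ∀ i' ∈ ({i} : Finset (Fin m)),
      affineForm p (l i') (k i') y = 0} =
      Nat.card {y : Fin t → ZMod p // linearPart p (l i) y = -(k i : ZMod p)} :=
    Nat.card_congr (Equiv.subtypeEquivRight fun y => by simp [affineForm_eq_zero_iff])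
  rw [card_fun_zmod, Nat.card_zmod] at h
  have hp0 : (p : ℝ) ≠ 0 := by exact_mod_cast hp.ne_zero
  have h' := congrArg (Nat.cast : ℕ → ℝ) h
  push_cast at h'
  rw [localDensity, e, div_eq_div_iff (pow_ne_zero _ hp0) hp0, h', one_mul]

lemma card_common_zeros_mul_sq {t p : ℕ} (hp : p.Prime) {l l' : Fin t → ℤ} {j j' : Fin t}
    (hminor : (l j * l' j' - l j' * l' j : ZMod p) ≠ 0) (k k' : ℤ) :
    Nat.card {y : Fin t → ZMod p // affineForm p l k y = 0 ∧ affineForm p l' k' y = 0} * p ^ 2 =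
      p ^ t := by
  have := Fact.mk hp
  have hsurj : Function.Surjective ((linearPart p l).prod (linearPart p l')) := by
    rintro ⟨c, c'⟩
    set Δ : ZMod p := l j * l' j' - l j' * l' j with hΔ
    refine ⟨Pi.single j (Δ⁻¹ * (l' j' * c - l j' * c')) +
      Pi.single j' (Δ⁻¹ * (l j * c' - l' j * c)), ?_⟩
    rw [AddMonoidHom.prod_apply, map_add, map_add, linearPart_single, linearPart_single,
      linearPart_single, linearPart_single, Prod.mk.injEq]
    constructor
    · calc _ = Δ⁻¹ * Δ * c := by rw [hΔ]; ring
        _ = c := by rw [inv_mul_cancel₀ hminor, one_mul]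
    · calc _ = Δ⁻¹ * Δ * c' := by rw [hΔ]; ring
        _ = c' := by rw [inv_mul_cancel₀ hminor, one_mul]
  have h := card_fiber_mul_card _ hsurj (-(k : ZMod p), -(k' : ZMod p))
  rw [card_fun_zmod, Nat.card_prod, Nat.card_zmod, ← sq] at h
  rw [← h]
  congr 1
  exact Nat.card_congr (Equiv.subtypeEquivRight fun y => by
    simp [affineForm_eq_zero_iff])

lemma localDensity_le_of_minor {m t : ℕ} {l : Fin m → Fin t → ℤ} (k : Fin m → ℤ) {p : ℕ}
    (hp : p.Prime) {T : Finset (Fin m)} {i i' : Fin m} (hi : i ∈ T) (hi' : i' ∈ T) {j j' : Fin t}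
    (hminor : (l i j * l i' j' - l i j' * l i' j : ZMod p) ≠ 0) :
    localDensity l k p T ≤ 1 / (p : ℝ) ^ 2 := by
  have := Fact.mk hp
  have h := card_common_zeros_mul_sq hp hminor (k i) (k i')
  have h1 : Nat.card {y : Fin t → ZMod p // ∀ i ∈ T, affineForm p (l i) (k i) y = 0} ≤
      Nat.card {y : Fin t → ZMod p // affineForm p (l i) (k i) y = 0 ∧
        affineForm p (l i') (k i') y = 0} :=
    Nat.card_le_card_of_injective (fun y => ⟨y.1, y.2 i hi, y.2 i' hi'⟩) fun y z hyz => by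
      simpa [Subtype.ext_iff] using hyz
  have h2 := Nat.mul_le_mul_right (p ^ 2) h1
  rw [h] at h2
  have hp0 : (0 : ℝ) < p := by exact_mod_cast hp.pos
  rw [localDensity, div_le_div_iff₀ (by positivity) (by positivity), one_mul]
  exact_mod_cast h2

lemma abs_localDensity_sub_le {m t : ℕ} {l : Fin m → Fin t → ℤ} (k : Fin m → ℤ) {p : ℕ}
    (hp : p.Prime) (h1 : ∀ i, ∃ j, (l i j : ZMod p) ≠ 0)
    (h2 : ∀ i i', i ≠ i' → ∃ j j', (l i j * l i' j' - l i j' * l i' j : ZMod p) ≠ 0)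
    (T : Finset (Fin m)) :
    |localDensity l k p T - (1 / (p : ℝ)) ^ #T| ≤ 1 / (p : ℝ) ^ 2 := by
  have hp1 : (1 : ℝ) ≤ p := by exact_mod_cast hp.one_le
  rcases Nat.lt_or_ge 1 #T with hT | hT
  · obtain ⟨i, hi, i', hi', hii⟩ := one_lt_card.1 hT
    obtain ⟨j, j', hj⟩ := h2 i i' hii
    have a1 := localDensity_le_of_minor k hp hi hi' hj
    have a2 := localDensity_nonneg l k p T
    have a3 : (1 / (p : ℝ)) ^ #T ≤ 1 / (p : ℝ) ^ 2 := by
      rw [← one_div_pow]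
      exact pow_le_pow_of_le_one (by positivity) (div_le_one_of_le₀ hp1 (by positivity)) hT
    have a4 : 0 ≤ (1 / (p : ℝ)) ^ #T := by positivity
    rw [abs_le]; constructor <;> linarith
  · have : localDensity l k p T = (1 / (p : ℝ)) ^ #T := by
      rcases Nat.eq_zero_or_pos #T with h0 | h0
      · rw [card_eq_zero.1 h0, localDensity_empty l k hp.ne_zero]; simp
      · obtain ⟨i, rfl⟩ := card_eq_one.1 (by omega : #T = 1)
        obtain ⟨j, hj⟩ := h1 i
        rw [localDensity_singleton k hp hj]; simp
    rw [this, sub_self, abs_zero]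
    positivity

lemma exists_minor_ne_zero {t : ℕ} {u v : Fin t → ℤ} (hu : u ≠ 0)
    (huv : ∀ q : ℚ, (fun j => (v j : ℚ)) ≠ q • fun j => (u j : ℚ)) :
    ∃ j j', u j * v j' - u j' * v j ≠ 0 := by
  obtain ⟨j, hj⟩ := Function.ne_iff.1 hu
  by_contra! h
  refine huv (v j / u j) (funext fun j' => ?_)
  have h1 : (u j : ℚ) * v j' - u j' * v j = 0 := by exact_mod_cast h j j'
  have h2 : (u j : ℚ) ≠ 0 := by exact_mod_cast hj
  simp only [Pi.smul_apply, smul_eq_mul]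
  field_simp
  linarith

lemma intCast_zmod_ne_zero {p : ℕ} {a : ℤ} (ha : a ≠ 0) (hap : |(a : ℝ)| < p) :
    (a : ZMod p) ≠ 0 := by
  rw [Ne, ZMod.intCast_zmod_eq_zero_iff_dvd]
  intro h
  exact ha (Int.eq_zero_of_abs_lt_dvd h (by exact_mod_cast hap))

lemma natCast_smallPrimorial_ne_zero {w p : ℕ} (hp : p.Prime) (hwp : w < p) :
    (smallPrimorial w : ZMod p) ≠ 0 := by
  rw [Ne, ZMod.natCast_eq_zero_iff, smallPrimorial, hp.prime.dvd_finsetProd_iff]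
  rintro ⟨q, hq, hpq⟩
  have hqp := prime_of_mem_smallPrimes hq
  rw [mem_smallPrimes hqp] at hq
  rw [(Nat.prime_dvd_prime_iff_eq hp hqp).1 hpq] at hwp
  omega

lemma abs_localDensity_scaled_sub_le {m t w : ℕ} {L : Fin m → Fin t → ℤ}
    (hL : ∀ i j, |(L i j : ℝ)| ≤ Real.sqrt w / 2) (hL0 : ∀ i, L i ≠ 0)
    (hLL : ∀ i i' : Fin m, i ≠ i' →
      ∀ q : ℚ, (fun j => (L i j : ℚ)) ≠ q • (fun j => (L i' j : ℚ)))
    (k : Fin m → ℤ) {p : ℕ} (hp : p.Prime) (hwp : w < p) (T : Finset (Fin m)) :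
    |localDensity (fun i j => (smallPrimorial w : ℤ) * L i j) k p T - (1 / (p : ℝ)) ^ #T| ≤
      1 / (p : ℝ) ^ 2 := by
  have := Fact.mk hp
  have hW := natCast_smallPrimorial_ne_zero hp hwp
  have hwp' : (w : ℝ) + 1 ≤ p := by exact_mod_cast hwp
  have hs := Real.sq_sqrt (Nat.cast_nonneg (α := ℝ) w)
  have hs0 := Real.sqrt_nonneg (w : ℝ)
  refine abs_localDensity_sub_le k hp (fun i => ?_) (fun i i' hii => ?_) T
  · obtain ⟨j, hj⟩ := Function.ne_iff.1 (hL0 i)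
    refine ⟨j, ?_⟩
    push_cast
    refine mul_ne_zero hW (intCast_zmod_ne_zero hj ((hL i j).trans_lt ?_))
    nlinarith [sq_nonneg (Real.sqrt w - 1)]
  · obtain ⟨j, j', hj⟩ := exists_minor_ne_zero (hL0 i) (hLL i' i hii.symm)
    refine ⟨j, j', ?_⟩
    have h1 := intCast_zmod_ne_zero (p := p) hj (by
      push_cast
      have b : ∀ a b : ℤ, |(a : ℝ)| ≤ Real.sqrt w / 2 → |(b : ℝ)| ≤ Real.sqrt w / 2 →
          |(a : ℝ) * b| ≤ w / 4 := by
        intro a b ha hb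
        rw [abs_mul]
        calc _ ≤ Real.sqrt w / 2 * (Real.sqrt w / 2) := by gcongr
          _ = w / 4 := by linarith
      calc _ ≤ |(L i j : ℝ) * L i' j'| + |(L i j' : ℝ) * L i' j| := abs_sub _ _
        _ ≤ w / 4 + w / 4 := add_le_add (b _ _ (hL _ _) (hL _ _)) (b _ _ (hL _ _) (hL _ _))
        _ < p := by have : (0 : ℝ) ≤ w := Nat.cast_nonneg w
                    linarith)
    push_cast at h1 ⊢
    have h2 := mul_ne_zero (mul_ne_zero hW hW) h1
    intro h3
    apply h2
    rw [← h3]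
    ring

lemma exists_int_congr {S : Finset ℕ} (hS : ∀ p ∈ S, p.Prime) (z : ∀ p : S, ZMod p) :
    ∃ v : ℤ, ∀ p : S, ((v : ℤ) : ZMod p) = z p := by
  have hr : ∀ p : S, ∃ a : ℕ, (a : ZMod p) = z p := fun p =>
    have : NeZero (p : ℕ) := ⟨(hS p p.2).ne_zero⟩
    ⟨(z p).val, ZMod.natCast_zmod_val _⟩
  choose r hr using hr
  obtain ⟨k, hk⟩ := Nat.chineseRemainderOfFinset r (fun p : S => (p : ℕ)) univ
    (fun p _ => (hS p p.2).ne_zero) (fun p _ q _ hpq =>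
      (Nat.coprime_primes (hS p p.2) (hS q q.2)).2 fun h => hpq (Subtype.ext h))
  refine ⟨k, fun p => ?_⟩
  rw [← hr p, Int.cast_natCast]
  exact (ZMod.natCast_eq_natCast_iff _ _ _).2 (hk p (mem_univ p))

lemma abs_card_modEq_sub_le {a c : ℤ} (hac : a ≤ c + 1) {M : ℤ} (hM : 0 < M) (v : ℤ) :
    |(#{x ∈ Icc a c | x ≡ v [ZMOD M]} : ℝ) - ((c - a + 1 : ℤ) : ℝ) / M| ≤ 1 := by
  have hI : Icc a c = Ioc (a - 1) c := by ext x; simp only [mem_Icc, mem_Ioc]; omega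
  have h := Int.Ioc_filter_modEq_card (a - 1) c hM v
  rw [← hI] at h
  have h' := congrArg (fun n : ℤ => ((n : ℚ))) h
  push_cast at h'
  have hMq : (0 : ℚ) < M := by exact_mod_cast hM
  have key : |(#{x ∈ Icc a c | x ≡ v [ZMOD M]} : ℚ) - ((c - a + 1 : ℤ) : ℚ) / M| ≤ 1 := by
    rw [h']
    set α : ℚ := ((a : ℚ) - 1 - v) / M with hα
    set β : ℚ := ((c : ℚ) - v) / M with hβ
    have hd : ((c - a + 1 : ℤ) : ℚ) / M = β - α := by
      rw [hα, hβ]; push_cast; ring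
    have hαβ : α ≤ β := by
      have : (0 : ℚ) ≤ ((c - a + 1 : ℤ) : ℚ) := by
        exact_mod_cast (by omega : (0 : ℤ) ≤ c - a + 1)
      have := div_nonneg this hMq.le
      linarith
    have hfl : (⌊α⌋ : ℚ) ≤ ⌊β⌋ := by exact_mod_cast Int.floor_le_floor hαβ
    rw [hd, max_eq_left (by linarith), abs_le]
    have := Int.floor_le α
    have := Int.floor_le β
    have := Int.lt_floor_add_one α
    have := Int.lt_floor_add_one β
    constructor <;> linarith
  have := (Rat.cast_le (K := ℝ)).2 key
  push_cast at this ⊢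
  exact this

lemma forall_zmod_eq_iff_modEq {S : Finset ℕ} (hS : ∀ p ∈ S, p.Prime) (x v : ℤ) :
    (∀ p : S, (x : ZMod p) = v) ↔ x ≡ v [ZMOD (∏ p ∈ S, p : ℕ)] := by
  rw [Int.modEq_iff_dvd]
  constructor
  · intro h
    push_cast
    refine Finset.prod_dvd_of_coprime (fun p hp q hq hpq => ?_) fun p hp => ?_
    · exact Nat.isCoprime_iff_coprime.2 ((Nat.coprime_primes (hS p hp) (hS q hq)).2 hpq)
    · exact (ZMod.intCast_eq_intCast_iff_dvd_sub _ _ _).1 (h ⟨p, hp⟩)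
  · intro h p
    refine (ZMod.intCast_eq_intCast_iff_dvd_sub _ _ _).2 (dvd_trans ?_ h)
    exact_mod_cast dvd_prod_of_mem (fun p => p) p.2

lemma abs_prod_sub_le {ι : Type*} (s : Finset ι) {q η : ℝ} (hq : 0 < q) (f : ι → ℝ)
    (hf : ∀ i ∈ s, |f i - q| ≤ q * η) :
    |∏ i ∈ s, f i - q ^ #s| ≤ q ^ #s * (Real.exp (#s * η) - 1) := by
  have h1 := Finset.norm_prod_one_add_sub_one_le s (fun i => (f i - q) / q)
  have h2 : ∏ i ∈ s, f i = q ^ #s * ∏ i ∈ s, (1 + (f i - q) / q) := by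
    rw [← prod_const, ← prod_mul_distrib]
    refine prod_congr rfl fun i _ => ?_
    field_simp; ring
  have h3 : ∑ i ∈ s, ‖(f i - q) / q‖ ≤ #s * η := by
    rw [← nsmul_eq_mul]
    refine sum_le_card_nsmul _ _ _ fun i hi => ?_
    rw [Real.norm_eq_abs, abs_div, abs_of_pos hq, div_le_iff₀ hq, mul_comm]
    exact hf i hi
  have h4 : ∏ i ∈ s, f i - q ^ #s = q ^ #s * (∏ i ∈ s, (1 + (f i - q) / q) - 1) := by
    rw [h2]; ring
  rw [h4, abs_mul, abs_of_pos (pow_pos hq _)]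
  refine mul_le_mul_of_nonneg_left (h1.trans ?_) (pow_pos hq _).le
  have := Real.exp_le_exp.2 h3
  linarith

/-- The box with corners `a` and `c`. -/
def box {t : ℕ} (a c : Fin t → ℤ) : Finset (Fin t → ℤ) :=
  Fintype.piFinset fun j => Icc (a j) (c j)

/-- The volume of the box with corners `a` and `c`. -/
def boxVolume {t : ℕ} (a c : Fin t → ℤ) : ℝ := ∏ j, ((c j - a j + 1 : ℤ) : ℝ)

lemma abs_card_box_fiber_sub_le {t : ℕ} {S : Finset ℕ} (hS : ∀ p ∈ S, p.Prime) {a c : Fin t → ℤ}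
    {ℓ : ℝ} (hℓ : 0 < ℓ) (hac : ∀ j, ℓ ≤ ((c j - a j + 1 : ℤ) : ℝ))
    (z : ∀ p : S, Fin t → ZMod p) :
    |(#{x ∈ box a c | (fun (p : S) j => ((x j : ℤ) : ZMod p)) = z} : ℝ) / boxVolume a c -
      (1 / realProd S) ^ t| ≤
      (1 / realProd S) ^ t * (Real.exp (t * (realProd S / ℓ)) - 1) := by
  have hM := realProd_pos hS
  choose v hv using fun j => exists_int_congr hS fun p => z p j
  have h1 : {x ∈ box a c | (fun (p : S) j => ((x j : ℤ) : ZMod p)) = z} =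
      Fintype.piFinset fun j => {x ∈ Icc (a j) (c j) | x ≡ v j [ZMOD (∏ p ∈ S, p : ℕ)]} := by
    ext x
    simp only [box, mem_filter, Fintype.mem_piFinset, ← forall_zmod_eq_iff_modEq hS, hv,
      forall_and, funext_iff]
    rw [forall_comm]
  rw [h1, Fintype.card_piFinset, boxVolume]
  push_cast
  rw [← prod_div_distrib]
  have h2 := abs_prod_sub_le (univ : Finset (Fin t)) (q := 1 / realProd S) (η := realProd S / ℓ)
    (by positivity) (fun j => (#{x ∈ Icc (a j) (c j) | x ≡ v j [ZMOD (∏ p ∈ S, p : ℕ)]} : ℝ) /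
      (c j - a j + 1)) (fun j _ => ?_)
  · simpa using h2
  · have hlen := hac j
    have h0 : (0 : ℝ) < ((c j - a j + 1 : ℤ) : ℝ) := hℓ.trans_le hlen
    have h0' : 0 < c j - a j + 1 := by exact_mod_cast h0
    have hMi : (0 : ℤ) < ((∏ p ∈ S, p : ℕ) : ℤ) := by
      rw [realProd_eq_cast] at hM; exact_mod_cast hM
    have h3 := abs_card_modEq_sub_le (a := a j) (c := c j) (by omega) hMi (v j)
    rw [Int.cast_natCast, ← realProd_eq_cast] at h3
    have h4 : (1 / realProd S) * (realProd S / ℓ) = 1 / ℓ := by field_simp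
    rw [h4]
    have h5 : ((c j : ℝ) - a j + 1) = ((c j - a j + 1 : ℤ) : ℝ) := by push_cast; ring
    rw [h5]
    set d : ℝ := ((c j - a j + 1 : ℤ) : ℝ)
    set n : ℝ := (#{x ∈ Icc (a j) (c j) | x ≡ v j [ZMOD (∏ p ∈ S, p : ℕ)]} : ℝ)
    have h6 : n / d - 1 / realProd S = (n - d / realProd S) / d := by field_simp
    rw [h6, abs_div, abs_of_pos h0]
    exact div_le_div₀ zero_le_one h3 hℓ hlen

/-- The density of a box subject to congruence conditions is close to the product of the local
densities. -/
lemma abs_box_density_sub_le {m t : ℕ} (l : Fin m → Fin t → ℤ) (k : Fin m → ℤ) {S : Finset ℕ}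
    (hS : ∀ p ∈ S, p.Prime) {a c : Fin t → ℤ} {ℓ : ℝ} (hℓ : 0 < ℓ)
    (hac : ∀ j, ℓ ≤ ((c j - a j + 1 : ℤ) : ℝ)) (T : ℕ → Finset (Fin m)) :
    |(#{x ∈ box a c | ∀ p ∈ S, ∀ i ∈ T p, (p : ℤ) ∣ ∑ j, l i j * x j + k i} : ℝ) /
      boxVolume a c - ∏ p ∈ S, localDensity l k p (T p)| ≤
      Real.exp (t * (realProd S / ℓ)) - 1 := by
  have hM := realProd_pos hS
  have : ∀ p : S, NeZero (p : ℕ) := fun p => ⟨(hS p p.2).ne_zero⟩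
  set Z : ∀ p : S, Finset (Fin t → ZMod p) := fun p =>
    univ.filter fun y => ∀ i ∈ T p, affineForm p (l i) (k i) y = 0 with hZ
  have hmaps : Set.MapsTo (fun (x : Fin t → ℤ) (p : S) j => ((x j : ℤ) : ZMod p))
      ({x ∈ box a c | ∀ p ∈ S, ∀ i ∈ T p, (p : ℤ) ∣ ∑ j, l i j * x j + k i} : Finset _)
      (Fintype.piFinset Z : Finset _) := by
    intro x hx
    simp only [coe_filter, Set.mem_ofPred_eq] at hx
    simp only [mem_coe, Fintype.mem_piFinset, hZ, mem_filter, mem_univ, true_and]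
    intro p i hi
    have := (ZMod.intCast_zmod_eq_zero_iff_dvd _ _).2 (hx.2 p p.2 i hi)
    push_cast at this
    exact this
  have hcard := card_eq_sum_card_fiberwise hmaps
  have hfib : ∀ z ∈ Fintype.piFinset Z,
      {x ∈ {x ∈ box a c | ∀ p ∈ S, ∀ i ∈ T p, (p : ℤ) ∣ ∑ j, l i j * x j + k i} |
        (fun (p : S) j => ((x j : ℤ) : ZMod p)) = z} =
      {x ∈ box a c | (fun (p : S) j => ((x j : ℤ) : ZMod p)) = z} := by
    intro z hz
    rw [filter_filter]
    refine filter_congr fun x _ => ⟨fun h => h.2, fun h => ⟨fun p hp i hi => ?_, h⟩⟩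
    have h1 := Fintype.mem_piFinset.1 hz ⟨p, hp⟩
    rw [← h] at h1
    simp only [hZ, mem_filter, mem_univ, true_and] at h1
    have h2 := h1 i hi
    rw [← ZMod.intCast_zmod_eq_zero_iff_dvd]
    push_cast
    exact h2
  rw [sum_congr rfl fun z hz => by rw [hfib z hz]] at hcard
  have hprod : ∏ p ∈ S, localDensity l k p (T p) =
      ∑ z ∈ Fintype.piFinset Z, (1 / realProd S) ^ t := by
    rw [sum_const, Fintype.card_piFinset, nsmul_eq_mul, realProd, one_div, ← prod_inv_distrib,
      ← prod_pow, ← prod_attach S, ← prod_attach S (fun p => ((p : ℝ)⁻¹) ^ t), univ_eq_attach]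
    push_cast
    rw [← prod_mul_distrib]
    refine prod_congr rfl fun p _ => ?_
    rw [localDensity, Nat.card_eq_fintype_card, Fintype.card_subtype, div_eq_mul_inv, inv_pow]
  rw [hprod, hcard]
  push_cast
  rw [sum_div, ← sum_sub_distrib]
  refine (abs_sum_le_sum_abs _ _).trans
    ((sum_le_sum fun z _ => abs_card_box_fiber_sub_le hS hℓ hac z).trans ?_)
  rw [← sum_mul, ← hprod]
  have h1 : ∏ p ∈ S, localDensity l k p (T p) ≤ 1 := by
    refine prod_le_one (fun _ _ => localDensity_nonneg _ _ _ _) fun p hp => ?_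
    have : NeZero p := ⟨(hS p hp).ne_zero⟩
    have hp0 : (0 : ℝ) < p := by exact_mod_cast (hS p hp).pos
    rw [localDensity, div_le_one (by positivity)]
    have h := Finite.card_subtype_le fun y : Fin t → ZMod p =>
      ∀ i ∈ T p, affineForm p (l i) (k i) y = 0
    rw [card_fun_zmod] at h
    exact_mod_cast h
  have h2 : 0 ≤ Real.exp (t * (realProd S / ℓ)) - 1 := by
    have := Real.one_le_exp (x := t * (realProd S / ℓ)) (by positivity)
    linarith
  exact mul_le_of_le_one_left h2 h1

lemma one_lt_of_posLog_ne_zero {x : ℝ} (hx : 0 ≤ x) (h : Real.posLog x ≠ 0) : 1 < x := by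
  by_contra! h1
  exact h (posLog_eq_zero_of_le_one hx h1)

lemma LambdaR_eq_sum_powerset {w n : ℕ} {R : ℝ} (hR : 0 < R) (hn : n ≠ 0)
    (hcop : (smallPrimorial w).Coprime n) :
    LambdaR R n = ∑ A ∈ (largePrimes w R).powerset,
      (-1) ^ #A * (if ∀ p ∈ A, p ∣ n then Real.posLog (R / realProd A) else 0) := by
  have h := sum_powerset_eq_sum_moebius (V := largePrimes w R)
    (fun p => prime_of_mem_largePrimes) (D := n.divisors.filter (fun d : ℕ => (d : ℝ) ≤ R))
    (f := fun d => if d ∣ n then Real.posLog (R / d) else 0) ?_ ?_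
  · rw [LambdaR]
    refine Eq.trans (sum_congr rfl fun d hd => ?_) (h.symm.trans (sum_congr rfl fun A hA => ?_))
    · rw [mem_filter, Nat.mem_divisors] at hd
      have hd0 : (0 : ℝ) < d := by exact_mod_cast Nat.pos_of_dvd_of_pos hd.1.1 (by omega)
      rw [if_pos hd.1.1, Real.posLog_eq_log]
      rw [abs_of_nonneg (by positivity), le_div_iff₀ hd0, one_mul]
      exact hd.2
    · rw [← realProd_eq_cast]
      congr 2
      refine propext ⟨fun h p hp => (dvd_prod_of_mem (fun p => p) hp).trans h, fun h => ?_⟩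
      exact prod_primes_dvd n (fun p hp => (prime_of_mem_largePrimes
        (mem_powerset.1 hA hp)).prime) h
  · intro d hd _ _ p hp
    rw [mem_filter, Nat.mem_divisors] at hd
    have hpp := Nat.prime_of_mem_primeFactors hp
    have hpd := Nat.dvd_of_mem_primeFactors hp
    have hd0 : 0 < d := Nat.pos_of_dvd_of_pos hd.1.1 (by omega)
    refine mem_sdiff.2 ⟨mem_primesLE hpp ?_, fun hps => ?_⟩
    · exact le_trans (by exact_mod_cast Nat.le_of_dvd hd0 hpd) hd.2
    · have := Nat.dvd_gcd (dvd_prod_of_mem (fun p => p) hps) (hpd.trans hd.1.1)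
      change p ∣ (smallPrimorial w).gcd n at this
      rw [hcop] at this
      exact hpp.one_lt.ne' (Nat.dvd_one.1 this)
  · intro A hA hne
    rw [← realProd_eq_cast] at hne
    have hA0 := realProd_pos fun p hp => prime_of_mem_largePrimes (hA hp)
    simp only [ne_eq, ite_eq_right_iff, Classical.not_imp] at hne
    rw [mem_filter, Nat.mem_divisors, ← realProd_eq_cast]
    refine ⟨⟨hne.1, hn⟩, ?_⟩
    have := one_lt_of_posLog_ne_zero (by positivity) hne.2
    rw [one_lt_div hA0] at this
    exact this.le

lemma LambdaR_sq_eq_sum {w n : ℕ} {R : ℝ} (hR : 0 < R) (hn : n ≠ 0)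
    (hcop : (smallPrimorial w).Coprime n) :
    LambdaR R n ^ 2 = ∑ X ∈ subsetPairs (largePrimes w R),
      pairWeight R X * (if ∀ p ∈ X.1 ∪ X.2, p ∣ n then 1 else 0) := by
  rw [sq, LambdaR_eq_sum_powerset hR hn hcop, sum_mul_sum, subsetPairs, sum_product]
  refine sum_congr rfl fun A _ => sum_congr rfl fun B _ => ?_
  simp only [pairWeight, mem_union, or_imp, forall_and]
  split_ifs <;> first | tauto | ring

/-- The primes occurring in a tuple of pairs. -/
def tupleSupport {m : ℕ} (D : Fin m → Finset ℕ × Finset ℕ) : Finset ℕ :=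
  univ.biUnion fun i => (D i).1 ∪ (D i).2

lemma forall_mem_tupleSupport {m : ℕ} {D : Fin m → Finset ℕ × Finset ℕ} {P : ℕ → Fin m → Prop} :
    (∀ p ∈ tupleSupport D, ∀ i ∈ indicesAt p D, P p i) ↔
      ∀ i, ∀ p ∈ (D i).1 ∪ (D i).2, P p i := by
  simp only [tupleSupport, indicesAt, mem_biUnion, mem_filter, mem_univ, true_and]
  exact ⟨fun h i p hp => h p ⟨i, hp⟩ i hp, fun h p _ i hp => h i p hp⟩

lemma realProd_union_le {A B : Finset ℕ} (hA : ∀ p ∈ A, p.Prime) (hB : ∀ p ∈ B, p.Prime) :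
    realProd (A ∪ B) ≤ realProd A * realProd B := by
  rw [← union_sdiff_self_eq_union, realProd_union disjoint_sdiff]
  refine mul_le_mul_of_nonneg_left ?_ (realProd_pos hA).le
  have h := realProd_union (disjoint_sdiff (s := B ∩ A) (t := B))
  rw [union_sdiff_of_subset inter_subset_left, sdiff_inter_self_left] at h
  rw [h]
  exact le_mul_of_one_le_left (realProd_pos fun p hp => hB p (sdiff_subset hp)).le
    (one_le_realProd fun p hp => hB p (inter_subset_left hp))

lemma realProd_biUnion_le {ι : Type*} (s : Finset ι) (f : ι → Finset ℕ)
    (hf : ∀ i ∈ s, ∀ p ∈ f i, p.Prime) : realProd (s.biUnion f) ≤ ∏ i ∈ s, realProd (f i) := by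
  induction s using Finset.induction_on with
  | empty => simp [realProd]
  | insert i s hi ih =>
    rw [biUnion_insert, prod_insert hi]
    have h1 := fun j hj => hf j (mem_insert_of_mem hj)
    have h2 := hf i (mem_insert_self i s)
    refine (realProd_union_le h2 fun p hp => ?_).trans
      (mul_le_mul_of_nonneg_left (ih h1) (realProd_pos h2).le)
    obtain ⟨j, hj, hp⟩ := mem_biUnion.1 hp
    exact h1 j hj p hp

lemma realProd_tupleSupport_le {m : ℕ} {V : Finset ℕ} (hV : ∀ p ∈ V, p.Prime) {R : ℝ} (hR : 0 < R)
    {D : Fin m → Finset ℕ × Finset ℕ} (hD : D ∈ Fintype.piFinset fun _ => subsetPairs V)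
    (h : ∏ i, pairWeight R (D i) ≠ 0) : realProd (tupleSupport D) ≤ R ^ (2 * m) := by
  have hD' := fun i => mem_subsetPairs.1 (Fintype.mem_piFinset.1 hD i)
  refine (realProd_biUnion_le _ _ fun i _ p hp => hV p (union_subset (hD' i).1 (hD' i).2 hp)).trans
    ?_
  have : R ^ (2 * m) = ∏ _i : Fin m, R * R := by simp [pow_mul, sq]
  rw [this]
  refine prod_le_prod (fun i _ => (realProd_pos fun p hp =>
    hV p (union_subset (hD' i).1 (hD' i).2 hp)).le) fun i _ => ?_
  have hi := prod_ne_zero_iff.1 h i (mem_univ i)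
  have h1 := realProd_pos fun p hp => hV p ((hD' i).1 hp)
  have h2 := realProd_pos fun p hp => hV p ((hD' i).2 hp)
  have h3 := one_lt_of_posLog_ne_zero (x := R / realProd (D i).1) (by positivity) fun h0 =>
    hi (by simp [pairWeight, h0])
  have h4 := one_lt_of_posLog_ne_zero (x := R / realProd (D i).2) (by positivity) fun h0 =>
    hi (by simp [pairWeight, h0])
  rw [one_lt_div h1] at h3
  rw [one_lt_div h2] at h4
  exact (realProd_union_le (fun p hp => hV p ((hD' i).1 hp)) fun p hp => hV p ((hD' i).2 hp)).trans
    (mul_le_mul h3.le h4.le h2.le hR.le)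

lemma sum_posLog_le {V : Finset ℕ} (hV : ∀ p ∈ V, p.Prime) {R : ℝ} (hR : 1 ≤ R) :
    ∑ A ∈ V.powerset, Real.posLog (R / realProd A) ≤ R * Real.log R := by
  have hA0 : ∀ A ∈ V.powerset, 1 ≤ realProd A := fun A hA =>
    one_le_realProd fun p hp => hV p (mem_powerset.1 hA hp)
  have h1 : ∑ A ∈ V.powerset, Real.posLog (R / realProd A) =
      ∑ A ∈ V.powerset with realProd A ≤ R, Real.posLog (R / realProd A) := by
    rw [sum_filter]
    refine sum_congr rfl fun A hA => ?_
    have := hA0 A hA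
    split_ifs with h
    · rfl
    · exact posLog_eq_zero_of_le_one (by positivity)
        (div_le_one_of_le₀ (not_le.1 h).le (by linarith))
  have h2 : #{A ∈ V.powerset | realProd A ≤ R} ≤ ⌊R⌋₊ := by
    have : #(Ioc 0 ⌊R⌋₊) = ⌊R⌋₊ := by simp
    rw [← this]
    refine card_le_card_of_injOn (fun A => ∏ p ∈ A, p) ?_ ?_
    · intro A hA
      rw [mem_coe, mem_filter] at hA
      have hA1 := hA0 A hA.1
      rw [realProd_eq_cast] at hA hA1
      rw [mem_coe, mem_Ioc]
      refine ⟨?_, Nat.le_floor hA.2⟩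
      exact_mod_cast hA1
    · intro A hA B hB hAB
      rw [mem_coe, mem_filter, mem_powerset] at hA hB
      have := congrArg Nat.primeFactors hAB
      rwa [Nat.primeFactors_prod fun p hp => hV p (hA.1 hp),
        Nat.primeFactors_prod fun p hp => hV p (hB.1 hp)] at this
  rw [h1]
  refine (sum_le_card_nsmul _ _ (Real.log R) fun A hA => ?_).trans ?_
  · rw [mem_filter] at hA
    have := hA0 A hA.1
    rw [Real.posLog_eq_log]
    · exact Real.log_le_log (by positivity) (div_le_self (by linarith) this)
    · rw [abs_of_nonneg (by positivity), one_le_div (by linarith)]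
      exact hA.2
  · rw [nsmul_eq_mul]
    refine mul_le_mul_of_nonneg_right ?_ (Real.log_nonneg hR)
    exact le_trans (by exact_mod_cast h2) (Nat.floor_le (by linarith))

lemma sum_abs_pairWeight_le {V : Finset ℕ} (hV : ∀ p ∈ V, p.Prime) {R : ℝ} (hR : 1 ≤ R) :
    ∑ X ∈ subsetPairs V, |pairWeight R X| ≤ R ^ 4 := by
  have h1 : ∑ X ∈ subsetPairs V, |pairWeight R X| =
      (∑ A ∈ V.powerset, Real.posLog (R / realProd A)) ^ 2 := by
    rw [sq, sum_mul_sum, subsetPairs, sum_product]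
    refine sum_congr rfl fun A _ => sum_congr rfl fun B _ => ?_
    simp [pairWeight, abs_mul, abs_of_nonneg Real.posLog_nonneg]
  rw [h1]
  have h2 := sum_posLog_le hV hR
  have h3 : R * Real.log R ≤ R ^ 2 := by
    have := Real.log_le_sub_one_of_pos (by linarith : 0 < R)
    nlinarith
  calc _ ≤ (R ^ 2) ^ 2 := by
        refine pow_le_pow_left₀ (sum_nonneg fun _ _ => Real.posLog_nonneg) (h2.trans h3) 2
    _ = R ^ 4 := by ring

lemma prod_localDensity_eq {m t : ℕ} (l : Fin m → Fin t → ℤ) (k : Fin m → ℤ) {V : Finset ℕ}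
    (hV : ∀ p ∈ V, p.Prime) {D : Fin m → Finset ℕ × Finset ℕ}
    (hD : D ∈ Fintype.piFinset fun _ => subsetPairs V) :
    ∏ p ∈ tupleSupport D, localDensity l k p (indicesAt p D) =
      ∏ p ∈ V, localDensity l k p (indicesAt p D) := by
  have hD' := fun i => mem_subsetPairs.1 (Fintype.mem_piFinset.1 hD i)
  refine prod_subset (biUnion_subset.2 fun i _ => union_subset (hD' i).1 (hD' i).2)
    fun p hp hpD => ?_
  have : indicesAt p D = ∅ := by
    refine filter_eq_empty_iff.2 fun i _ hpi => hpD ?_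
    exact mem_biUnion.2 ⟨i, mem_univ i, hpi⟩
  rw [this, localDensity_empty l k (hV p hp).ne_zero]

lemma sum_box_prod_eq {m t w : ℕ} {R : ℝ} (hR : 0 < R) (θ : Fin m → (Fin t → ℤ) → ℤ)
    {a c : Fin t → ℤ} (hθ : ∀ x ∈ box a c, ∀ i, 1 ≤ θ i x)
    (hcop : ∀ x i, IsCoprime (smallPrimorial w : ℤ) (θ i x)) :
    ∑ x ∈ box a c, ∏ i, LambdaR R (θ i x).toNat ^ 2 =
      ∑ D ∈ Fintype.piFinset (fun _ : Fin m => subsetPairs (largePrimes w R)),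
        (∏ i, pairWeight R (D i)) *
        #{x ∈ box a c | ∀ p ∈ tupleSupport D, ∀ i ∈ indicesAt p D, (p : ℤ) ∣ θ i x} := by
  have h1 : ∀ x ∈ box a c, ∏ i, LambdaR R (θ i x).toNat ^ 2 =
      ∑ D ∈ Fintype.piFinset (fun _ : Fin m => subsetPairs (largePrimes w R)),
        (∏ i, pairWeight R (D i)) *
        (if ∀ p ∈ tupleSupport D, ∀ i ∈ indicesAt p D, (p : ℤ) ∣ θ i x then 1 else 0) := by
    intro x hx
    have h2 : ∀ i, LambdaR R (θ i x).toNat ^ 2 = ∑ X ∈ subsetPairs (largePrimes w R),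
        pairWeight R X * (if ∀ p ∈ X.1 ∪ X.2, (p : ℤ) ∣ θ i x then 1 else 0) := by
      intro i
      have h3 : ((θ i x).toNat : ℤ) = θ i x := Int.toNat_of_nonneg (by linarith [hθ x hx i])
      have h4 := hθ x hx i
      rw [LambdaR_sq_eq_sum hR (w := w) (by omega)
        (Nat.isCoprime_iff_coprime.1 (by rw [h3]; exact hcop x i))]
      simp only [← Int.natCast_dvd_natCast, h3]
    rw [prod_congr rfl fun i _ => h2 i, prod_univ_sum]
    refine sum_congr rfl fun D _ => ?_
    rw [prod_mul_distrib, prod_ite_zero]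
    simp only [mem_univ, true_imp_iff, prod_const_one, forall_mem_tupleSupport]
  rw [sum_congr rfl h1, sum_comm]
  refine sum_congr rfl fun D _ => ?_
  rw [← mul_sum, sum_boole]

/-- The box average of the product of squared divisor sums is close to the local sum. -/
lemma abs_box_average_sub_localSum_le {m t w : ℕ} {R : ℝ} (hR : 1 ≤ R) (htR : (t : ℝ) ≤ R)
    (hm : 1 ≤ m) (l : Fin m → Fin t → ℤ) (k : Fin m → ℤ) {a c : Fin t → ℤ}
    (hac : ∀ j, R ^ (10 * m) ≤ ((c j - a j + 1 : ℤ) : ℝ))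
    (hθ : ∀ x ∈ box a c, ∀ i, 1 ≤ ∑ j, l i j * x j + k i)
    (hcop : ∀ (x : Fin t → ℤ) i, IsCoprime (smallPrimorial w : ℤ) (∑ j, l i j * x j + k i)) :
    |(∑ x ∈ box a c, ∏ i, LambdaR R (∑ j, l i j * x j + k i).toNat ^ 2) / boxVolume a c -
      localSum m (largePrimes w R) R (localDensity l k)| ≤ 2 * t / R := by
  have hR0 : 0 < R := by linarith
  have hV : ∀ p ∈ largePrimes w R, p.Prime := fun p => prime_of_mem_largePrimes
  rw [sum_box_prod_eq hR0 (fun i x => ∑ j, l i j * x j + k i) hθ hcop, localSum, sum_div,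
    ← sum_sub_distrib]
  have hs0 : 0 ≤ (t : ℝ) * (R ^ (2 * m) / R ^ (10 * m)) := by positivity
  have hs : (t : ℝ) * (R ^ (2 * m) / R ^ (10 * m)) = t / R ^ (8 * m) := by
    have : R ^ (10 * m) = R ^ (2 * m) * R ^ (8 * m) := by rw [← pow_add]; congr 1; ring
    rw [this]; field_simp
  have hR8 : R ≤ R ^ (8 * m) := le_self_pow₀ hR (by omega)
  have hs1 : (t : ℝ) * (R ^ (2 * m) / R ^ (10 * m)) ≤ 1 := by
    rw [hs]; exact div_le_one_of_le₀ (htR.trans hR8) (by positivity)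
  have hE : Real.exp (t * (R ^ (2 * m) / R ^ (10 * m))) - 1 ≤ 2 * (t / R ^ (8 * m)) := by
    have := Real.abs_exp_sub_one_le (by rwa [abs_of_nonneg hs0])
    rw [abs_of_nonneg hs0] at this
    rw [← hs]
    exact (le_abs_self _).trans this
  have hterm : ∀ D ∈ Fintype.piFinset (fun _ : Fin m => subsetPairs (largePrimes w R)),
      |(∏ i, pairWeight R (D i)) * (#{x ∈ box a c | ∀ p ∈ tupleSupport D, ∀ i ∈ indicesAt p D,
        (p : ℤ) ∣ ∑ j, l i j * x j + k i} : ℝ) / boxVolume a c -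
      (∏ i, pairWeight R (D i)) * ∏ p ∈ largePrimes w R, localDensity l k p (indicesAt p D)| ≤
      (∏ i, |pairWeight R (D i)|) * (2 * (t / R ^ (8 * m))) := by
    intro D hD
    rw [mul_div_assoc, ← mul_sub, abs_mul, abs_prod]
    by_cases h0 : ∏ i, pairWeight R (D i) = 0
    · rw [← abs_prod, h0, abs_zero, zero_mul, zero_mul]
    refine mul_le_mul_of_nonneg_left ?_ (prod_nonneg fun _ _ => abs_nonneg _)
    have hD' := fun i => mem_subsetPairs.1 (Fintype.mem_piFinset.1 hD i)
    have hSp : ∀ p ∈ tupleSupport D, p.Prime := by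
      intro p hp
      obtain ⟨i, _, hp⟩ := mem_biUnion.1 hp
      exact hV p (union_subset (hD' i).1 (hD' i).2 hp)
    rw [← prod_localDensity_eq l k hV hD]
    refine (abs_box_density_sub_le l k hSp (by positivity) hac fun p => indicesAt p D).trans
      (le_trans ?_ hE)
    have := realProd_tupleSupport_le hV hR0 hD h0
    gcongr
  refine (abs_sum_le_sum_abs _ _).trans ((sum_le_sum hterm).trans ?_)
  rw [← sum_mul, ← prod_univ_sum (fun _ : Fin m => subsetPairs (largePrimes w R))
    (fun _ X => |pairWeight R X|), prod_const, card_univ, Fintype.card_fin]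
  have h5 : (∑ X ∈ subsetPairs (largePrimes w R), |pairWeight R X|) ^ m ≤ R ^ (4 * m) := by
    rw [pow_mul]
    exact pow_le_pow_left₀ (sum_nonneg fun _ _ => abs_nonneg _) (sum_abs_pairWeight_le hV hR) m
  calc _ ≤ R ^ (4 * m) * (2 * (t / R ^ (8 * m))) := by gcongr
    _ = 2 * t / R ^ (4 * m) := by
        have : R ^ (8 * m) = R ^ (4 * m) * R ^ (4 * m) := by rw [← pow_add]; congr 1; ring
        rw [this]; field_simp
    _ ≤ 2 * t / R := by
        gcongr
        exact le_self_pow₀ hR (by omega)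

lemma one_add_sieveFactor_mul_le_exp {w : ℕ} {x : ℝ} (hx : 0 ≤ x) (hwx : (w : ℝ) ≤ x / 2) :
    1 + sieveFactor (smallPrimes w) * (1 + Real.log (smallPrimorial w)) ≤
      11 * Real.exp (4 / 5 * x) := by
  have hW1 : 1 ≤ (smallPrimorial w : ℝ) := by exact_mod_cast smallPrimorial_pos w
  have hW4 : (smallPrimorial w : ℝ) ≤ 4 ^ w := by exact_mod_cast primorial_le_four_pow w
  have hlog4 : Real.log 4 ≤ 7 / 5 := by
    rw [show (4 : ℝ) = 2 ^ 2 by norm_num, Real.log_pow]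
    push_cast
    linarith [Real.log_two_lt_d9]
  have hlogW : Real.log (smallPrimorial w) ≤ 7 / 10 * x := by
    have h1 := Real.log_le_log (by linarith) hW4
    rw [Real.log_pow] at h1
    have h2 : w * Real.log 4 ≤ x / 2 * (7 / 5) :=
      mul_le_mul hwx hlog4 (Real.log_nonneg (by norm_num)) (by linarith)
    linarith
  have hWe : (smallPrimorial w : ℝ) ≤ Real.exp (7 / 10 * x) :=
    (Real.log_le_iff_le_exp (by linarith)).1 hlogW
  have hF : sieveFactor (smallPrimes w) ≤ Real.exp (7 / 10 * x) := by
    rw [sieveFactor_smallPrimes]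
    refine (div_le_self (by linarith) ?_).trans hWe
    exact_mod_cast Nat.totient_pos.2 (smallPrimorial_pos w)
  have h1 : 1 + Real.log (smallPrimorial w) ≤ 10 * Real.exp (1 / 10 * x) := by
    have := Real.add_one_le_exp (1 / 10 * x)
    linarith
  have h2 : sieveFactor (smallPrimes w) * (1 + Real.log (smallPrimorial w)) ≤
      Real.exp (7 / 10 * x) * (10 * Real.exp (1 / 10 * x)) :=
    mul_le_mul hF h1 (by have := Real.log_nonneg hW1; linarith) (Real.exp_pos _).le
  have h3 : Real.exp (7 / 10 * x) * (10 * Real.exp (1 / 10 * x)) = 10 * Real.exp (4 / 5 * x) := by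
    rw [mul_left_comm, ← Real.exp_add]; congr 2; ring
  have h4 := Real.one_le_exp (x := 4 / 5 * x) (by positivity)
  linarith

lemma eventually_smallPrimorial_small {γ τ : ℝ} (hγ : 0 < γ) (hτ : 0 < τ) {w : ℕ → ℕ}
    (hwb : ∀ᶠ N : ℕ in atTop, (w N : ℝ) ≤ Real.log (Real.log N) / 2) :
    ∀ᶠ N : ℕ in atTop,
      1 + sieveFactor (smallPrimes (w N)) * (1 + Real.log (smallPrimorial (w N))) ≤
        τ * Real.log ((N : ℝ) ^ γ) ∧ (w N : ℝ) ≤ τ * Real.log ((N : ℝ) ^ γ) := by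
  have hlog : Tendsto (fun N : ℕ => Real.log N) atTop atTop :=
    Real.tendsto_log_atTop.comp tendsto_natCast_atTop_atTop
  have hloglog := Real.tendsto_log_atTop.comp hlog
  filter_upwards [hwb, hlog.eventually_gt_atTop 0, hloglog.eventually_ge_atTop 0,
    hloglog.eventually_ge_atTop (5 * Real.log (11 / (τ * γ))), eventually_gt_atTop 0]
    with N h1 h2 h3 h4 hN
  simp only [Function.comp_apply] at h3 h4
  set x := Real.log (Real.log N)
  have hx : Real.exp x = Real.log N := Real.exp_log h2
  have hN0 : (0 : ℝ) < N := by exact_mod_cast hN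
  have h5 : 11 / (τ * γ) ≤ Real.exp (1 / 5 * x) :=
    (Real.log_le_iff_le_exp (by positivity)).1 (by linarith)
  have h6 : 11 * Real.exp (4 / 5 * x) ≤ τ * Real.log ((N : ℝ) ^ γ) := by
    rw [Real.log_rpow hN0, ← hx]
    rw [div_le_iff₀ (by positivity)] at h5
    calc 11 * Real.exp (4 / 5 * x) ≤ Real.exp (1 / 5 * x) * (τ * γ) * Real.exp (4 / 5 * x) := by
          gcongr
      _ = τ * (γ * (Real.exp (1 / 5 * x) * Real.exp (4 / 5 * x))) := by ring
      _ = τ * (γ * Real.exp x) := by rw [← Real.exp_add]; congr 4; ring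
  refine ⟨(one_add_sieveFactor_mul_le_exp h3 h1).trans h6, le_trans ?_ h6⟩
  have := Real.add_one_le_exp (4 / 5 * x)
  linarith

lemma abs_pow_sub_pow_le {S T δ : ℝ} {m : ℕ} (hm : 1 ≤ m) (hT : 0 < T) (hδ : 0 < δ)
    (h : |S - T| ≤ Real.log (1 + δ) / m * T) : |S ^ m - T ^ m| ≤ δ * T ^ m := by
  have h1 := abs_prod_sub_le (univ : Finset (Fin m)) hT (fun _ => S)
    (η := Real.log (1 + δ) / m) fun _ _ => by rwa [mul_comm]
  have hm0 : (m : ℝ) ≠ 0 := by positivity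
  rw [prod_const, card_univ, Fintype.card_fin, mul_div_cancel₀ _ hm0,
    Real.exp_log (by linarith)] at h1
  linarith

end GoldstonYildirim

/-- Goldston–Yıldırım, linear forms estimate:
`E(Λ_R(θ_1(x))² ⋯ Λ_R(θ_m(x))² | x ∈ B) = (1 + o_{m,t}(1)) (W log R / φ(W))^m`
for boxes `B` of side length at least `R^{10m}`, with `R = N^γ`. -/
theorem goldston_yildirim_linear_forms (m t : ℕ) (hm : 1 ≤ m) (ht : 1 ≤ t)
    (γ : ℝ) (hγ0 : 0 < γ) (hγ1 : γ < 1)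
    (w : ℕ → ℕ) (hw : Tendsto w atTop atTop)
    (hwb : ∀ᶠ N : ℕ in atTop, (w N : ℝ) ≤ Real.log (Real.log N) / 2) :
    ∀ δ : ℝ, 0 < δ → ∃ N₀ : ℕ, ∀ N ≥ N₀,
      ∀ (L : Fin m → Fin t → ℤ) (b : Fin m → ℤ),
        (∀ i j, |(L i j : ℝ)| ≤ Real.sqrt (w N) / 2) →
        (∀ i, L i ≠ 0) →
        (∀ i i' : Fin m, i ≠ i' →
          ∀ q : ℚ, (fun j => (L i j : ℚ)) ≠ q • (fun j => (L i' j : ℚ))) →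
        ∀ a c : Fin t → ℤ,
          (∀ j, ((N : ℝ) ^ γ) ^ (10 * m) ≤ ((c j - a j + 1 : ℤ) : ℝ)) →
          (∀ x ∈ Fintype.piFinset (fun j : Fin t => Finset.Icc (a j) (c j)), ∀ i : Fin m,
            1 ≤ (Wprim w N : ℤ) * (∑ j, L i j * x j + b i) + 1) →
          |(∑ x ∈ Fintype.piFinset (fun j : Fin t => Finset.Icc (a j) (c j)),
              ∏ i : Fin m,
                (LambdaR ((N : ℝ) ^ γ)
                  (((Wprim w N : ℤ) * (∑ j, L i j * x j + b i) + 1).toNat)) ^ 2) /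
              (∏ j : Fin t, ((c j - a j + 1 : ℤ) : ℝ)) -
            ((Wprim w N : ℝ) * Real.log ((N : ℝ) ^ γ) / (Nat.totient (Wprim w N))) ^ m| ≤
          δ * ((Wprim w N : ℝ) * Real.log ((N : ℝ) ^ γ) / (Nat.totient (Wprim w N))) ^ m := by
  intro δ hδ
  open GoldstonYildirim in
  obtain ⟨w₀, τ, L₀, hw₀, hτ0, hτ1, hpair⟩ := pairSum_asymptotic
    (δ := Real.log (1 + δ / 3) / m)
    (div_pos (Real.log_pos (by linarith)) (by exact_mod_cast hm))
  have hR : Tendsto (fun N : ℕ => (N : ℝ) ^ γ) atTop atTop :=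
    (tendsto_rpow_atTop hγ0).comp tendsto_natCast_atTop_atTop
  have hlogR := Real.tendsto_log_atTop.comp hR
  have hexp : Tendsto (fun N => (64 : ℝ) ^ m * (Real.exp (16 ^ m / w N) - 1)) atTop (nhds 0) := by
    have h1 : Tendsto (fun N => (16 : ℝ) ^ m / w N) atTop (nhds 0) :=
      tendsto_const_nhds.div_atTop (tendsto_natCast_atTop_atTop.comp hw)
    have h2 := ((Real.continuous_exp.tendsto 0).comp h1).sub_const 1
    rw [Real.exp_zero, sub_self] at h2
    simpa using h2.const_mul ((64 : ℝ) ^ m)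
  have hsmall : Tendsto (fun N : ℕ => 2 * (t : ℝ) / (N : ℝ) ^ γ) atTop (nhds 0) :=
    tendsto_const_nhds.div_atTop hR
  have hδ3 : 0 < δ / 3 := by positivity
  obtain ⟨N₀, hN₀⟩ := eventually_atTop.1 ((hw.eventually_ge_atTop w₀).and <|
    (GoldstonYildirim.eventually_smallPrimorial_small hγ0 hτ0 hwb).and <|
    (hlogR.eventually_ge_atTop (max L₀ 1)).and <| (hR.eventually_ge_atTop (max t 1)).and <|
    (hexp.eventually_le_const hδ3).and (hsmall.eventually_le_const hδ3))
  refine ⟨N₀, fun N hN L b hL hL0 hLL a c hac hθ => ?_⟩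
  obtain ⟨hwN, ⟨hc, hwR⟩, hlR, hRt, hE, hs⟩ := hN₀ N hN
  simp only [Function.comp_apply] at hlR
  set R : ℝ := (N : ℝ) ^ γ
  have hR1 : 1 ≤ R := (le_max_right _ _).trans hRt
  have htR : (t : ℝ) ≤ R := (le_max_left _ _).trans hRt
  have hl1 : 1 ≤ Real.log R := (le_max_right _ _).trans hlR
  have hτl : τ * Real.log R ≤ Real.log R := mul_le_of_le_one_left (by linarith) hτ1
  have hwR' : (w N : ℝ) ≤ R := by
    have := Real.log_le_sub_one_of_pos (by linarith : 0 < R)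
    linarith
  have hw2 : 2 ≤ w N := hw₀.trans hwN
  have hT : (Wprim w N : ℝ) * Real.log R / (Nat.totient (Wprim w N)) =
      GoldstonYildirim.sieveFactor (GoldstonYildirim.smallPrimes (w N)) * Real.log R := by
    rw [GoldstonYildirim.sieveFactor_smallPrimes, mul_div_right_comm]; rfl
  rw [hT]
  have hF : 1 ≤ GoldstonYildirim.sieveFactor (GoldstonYildirim.smallPrimes (w N)) :=
    GoldstonYildirim.one_le_sieveFactor fun p => GoldstonYildirim.prime_of_mem_smallPrimes
  have hPS := hpair (w N) R hwN hwR' ((le_max_left _ _).trans hlR) hc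
  set T : ℝ := GoldstonYildirim.sieveFactor (GoldstonYildirim.smallPrimes (w N)) * Real.log R
    with hTdef
  have hT1 : 1 ≤ T := one_le_mul_of_one_le_of_one_le hF hl1
  have hTm : 1 ≤ T ^ m := one_le_pow₀ hT1
  have hform : ∀ (x : Fin t → ℤ) i, (Wprim w N : ℤ) * (∑ j, L i j * x j + b i) + 1 =
      ∑ j, (GoldstonYildirim.smallPrimorial (w N) : ℤ) * L i j * x j +
        ((GoldstonYildirim.smallPrimorial (w N) : ℤ) * b i + 1) := by
    intro x i
    simp only [mul_assoc, ← mul_sum]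
    change (GoldstonYildirim.smallPrimorial (w N) : ℤ) * _ + 1 = _
    ring
  simp only [hform] at hθ ⊢
  have e1 := GoldstonYildirim.abs_box_average_sub_localSum_le hR1 htR hm
    (fun i j => (GoldstonYildirim.smallPrimorial (w N) : ℤ) * L i j)
    (fun i => (GoldstonYildirim.smallPrimorial (w N) : ℤ) * b i + 1) hac hθ
    (w := w N) fun x i => by
      rw [← hform]
      exact ⟨-(∑ j, L i j * x j + b i), 1, by
        change _ * (Wprim w N : ℤ) + _ = _
        ring⟩
  have e2 := GoldstonYildirim.abs_localSum_largePrimes_sub_pow_le hw2 hwR' (hc.trans hτl)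
    (ω := GoldstonYildirim.localDensity
      (fun i j => (GoldstonYildirim.smallPrimorial (w N) : ℤ) * L i j)
      (fun i => (GoldstonYildirim.smallPrimorial (w N) : ℤ) * b i + 1))
    fun p hp X => GoldstonYildirim.abs_localDensity_scaled_sub_le hL hL0 hLL _
      (GoldstonYildirim.prime_of_mem_largePrimes hp) (GoldstonYildirim.lt_of_mem_largePrimes hp) X
  have e3 := GoldstonYildirim.abs_pow_sub_pow_le hm (by linarith) hδ3 hPS
  rw [← hTdef] at e2
  have e2' := e2.trans (mul_le_mul_of_nonneg_right hE (by linarith))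
  have e1' : 2 * (t : ℝ) / R ≤ δ / 3 * T ^ m := hs.trans (le_mul_of_one_le_right hδ3.le hTm)
  refine (abs_sub_le _ _ _).trans ((add_le_add (e1.trans e1')
    ((abs_sub_le _ _ _).trans (add_le_add e2' e3))).trans (le_of_eq (by ring)))

end
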